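/- The group cohomology of GL_4(ℤ) with trivial complex coefficients satisfies: H^0(GL_4(ℤ), ℂ) ≅ ℂ and H^i(GL_4(ℤ), ℂ) = 0 for all i ≥ 1. -/

import Mathlib

open Equiv

/-- alternating (skew-symmetric) functions on tuples -/
def Alt {X : Type*} {k : ℕ} (φ : (Fin k → X) → ℂ) : Prop :=
  ∀ (t : Fin k → X) (π : Perm (Fin k)), φ (t ∘ π) = ((Perm.sign π : ℤ) : ℂ) * φ t

theorem sign_mul_self' {k : ℕ} (π : Perm (Fin k)) :
    ((Perm.sign π : ℤ) : ℂ) * ((Perm.sign π : ℤ) : ℂ) = 1 := by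
  rcases Int.units_eq_one_or (Perm.sign π) with h | h <;> simp [h]

theorem Alt.inj {X : Type*} {k : ℕ} {φ : (Fin k → X) → ℂ} (h : Alt φ) {t : Fin k → X}
    (ht : φ t ≠ 0) : Function.Injective t := by
  intro i j hij
  by_contra hne
  apply ht
  have := h t (Equiv.swap i j)
  rw [Perm.sign_swap hne] at this
  have h2 : t ∘ (Equiv.swap i j) = t := by
    funext x
    simp only [Function.comp, Equiv.swap_apply_def]
    split_ifs with h1 h2
    · rw [h1, hij]
    · rw [h2, hij]
    · rfl
  rw [h2] at this
  simp at this
  linear_combination this / 2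

theorem cons_comp_perm {X : Type*} {k : ℕ} (x : X) (u : Fin k → X) (π : Perm (Fin k)) :
    (Fin.cons x (u ∘ π) : Fin (k+1) → X) =
      (Fin.cons x u : Fin (k+1) → X) ∘ (Equiv.Perm.decomposeFin.symm (0, π)) := by
  funext i
  refine Fin.cases ?_ (fun i => ?_) i
  · simp
  · simp [Equiv.Perm.decomposeFin_symm_apply_succ]

theorem Alt.cons {X : Type*} {k : ℕ} {φ : (Fin (k+1) → X) → ℂ} (h : Alt φ) (x : X)
    (u : Fin k → X) (π : Perm (Fin k)) :
    φ (Fin.cons x (u ∘ π)) = ((Perm.sign π : ℤ) : ℂ) * φ (Fin.cons x u) := by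
  rw [cons_comp_perm, h]
  simp [Equiv.Perm.decomposeFin.symm_sign]

theorem Alt.cons_swap {X : Type*} {k : ℕ} {φ : (Fin (k+2) → X) → ℂ} (h : Alt φ) (x y : X)
    (u : Fin k → X) :
    φ (Fin.cons x (Fin.cons y u)) = - φ (Fin.cons y (Fin.cons x u)) := by
  have := h (Fin.cons y (Fin.cons x u)) (Equiv.swap 0 1)
  rw [Perm.sign_swap (by simp)] at this
  have h2 : (Fin.cons y (Fin.cons x u) : Fin (k+2) → X) ∘ (Equiv.swap 0 1)
      = Fin.cons x (Fin.cons y u) := by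
    funext i
    refine Fin.cases ?_ (fun i => ?_) i
    · simp
    · refine Fin.cases ?_ (fun i => ?_) i
      · simp
      · simp only [Function.comp, Fin.cons_succ]
        rw [Equiv.swap_apply_of_ne_of_ne]
        · simp
        · exact Fin.succ_ne_zero _
        · rw [← Fin.succ_zero_eq_one]
          intro h; exact Fin.succ_ne_zero _ (Fin.succ_injective _ h)
  rw [h2] at this
  simpa using this

/-- if `e` occurs in `t`, then `t` is a permutation of a tuple starting with `e` -/
theorem exists_cons_perm {X : Type*} {k : ℕ} (t : Fin (k+1) → X) {e : X}
    (he : e ∈ Set.range t) :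
    ∃ (u : Fin k → X) (π : Perm (Fin (k+1))), t = (Fin.cons e u : Fin (k+1) → X) ∘ π := by
  obtain ⟨j, rfl⟩ := he
  refine ⟨Fin.tail (t ∘ Equiv.swap 0 j), Equiv.swap 0 j, ?_⟩
  have : (Fin.cons (t j) (Fin.tail (t ∘ Equiv.swap 0 j)) : Fin (k+1) → X)
      = t ∘ Equiv.swap 0 j := by
    conv_rhs => rw [← Fin.cons_self_tail (t ∘ Equiv.swap 0 j)]
    simp
  rw [this]
  funext i
  simp

/-- antisymmetrized extension -/
noncomputable def wedge {X : Type*} {k : ℕ} (B : X → (Fin k → X) → ℂ) (t : Fin (k+1) → X) : ℂ :=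
  ((k.factorial : ℂ))⁻¹ * ∑ π : Perm (Fin (k+1)),
    ((Perm.sign π : ℤ) : ℂ) * B (t (π 0)) (t ∘ π ∘ Fin.succ)

theorem wedge_alt {X : Type*} {k : ℕ} (B : X → (Fin k → X) → ℂ) : Alt (wedge B) := by
  intro t π
  unfold wedge
  rw [mul_left_comm]
  congr 1
  rw [Finset.mul_sum]
  refine Fintype.sum_equiv (Equiv.mulLeft π) _ _ (fun ρ => ?_)
  simp only [Equiv.coe_mulLeft, Perm.sign_mul, Units.val_mul, Int.cast_mul, Perm.mul_apply,
    Function.comp_apply]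
  have : (t ∘ ⇑(π * ρ) ∘ Fin.succ) = ((t ∘ ⇑π) ∘ ⇑ρ ∘ Fin.succ) := rfl
  rw [this]
  linear_combination (-((Perm.sign ρ : ℤ) : ℂ) * B (t (π (ρ 0))) ((t ∘ ⇑π) ∘ ⇑ρ ∘ Fin.succ)) *
    sign_mul_self' π

theorem wedge_cons {X : Type*} {k : ℕ} (B : X → (Fin k → X) → ℂ) (x : X) (u : Fin k → X)
    (hx : Alt (B x))
    (h0 : ∀ π : Perm (Fin (k+1)), π 0 ≠ 0 →
      B ((Fin.cons x u : Fin (k+1) → X) (π 0)) ((Fin.cons x u : Fin (k+1) → X) ∘ π ∘ Fin.succ) = 0) :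
    wedge B (Fin.cons x u) = B x u := by
  unfold wedge
  rw [← Equiv.sum_comp Equiv.Perm.decomposeFin.symm, Fintype.sum_prod_type, Fin.sum_univ_succ,
    Finset.sum_eq_zero (s := Finset.univ) (f := fun i : Fin k => _)]
  · have : ∀ π : Perm (Fin k), ((Perm.sign (Perm.decomposeFin.symm ((0 : Fin (k+1)), π)) : ℤ) : ℂ) *
        B ((Fin.cons x u : Fin (k+1) → X) ((Perm.decomposeFin.symm ((0 : Fin (k+1)), π)) 0))
        ((Fin.cons x u : Fin (k+1) → X) ∘ (Perm.decomposeFin.symm ((0 : Fin (k+1)), π)) ∘ Fin.succ) = B x u := by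
      intro π
      have e1 : ((Fin.cons x u : Fin (k+1) → X) ∘ (Perm.decomposeFin.symm ((0 : Fin (k+1)), π)) ∘ Fin.succ)
          = u ∘ π := by
        funext i; simp [Equiv.Perm.decomposeFin_symm_apply_succ]
      rw [e1, Equiv.Perm.decomposeFin.symm_sign]
      simp only [if_true, Perm.decomposeFin_symm_apply_zero, Fin.cons_zero, one_mul]
      rw [hx, ← mul_assoc, sign_mul_self', one_mul]
    rw [Finset.sum_congr rfl (fun π _ => this π)]
    have hk : (k.factorial : ℂ) ≠ 0 := by exact_mod_cast k.factorial_ne_zero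
    simp [Fintype.card_perm, hk]
  · intro i _
    apply Finset.sum_eq_zero
    intro π _
    rw [h0, mul_zero]
    simp

section cochains
variable {X : Type*} (Cell : Set X → Prop)

/-- cochains: alternating functions supported on cells -/
def DD (k : ℕ) : Submodule ℂ ((Fin k → X) → ℂ) where
  carrier := {φ | Alt φ ∧ ∀ t, φ t ≠ 0 → Cell (Set.range t)}
  zero_mem' := ⟨fun t π => by simp, fun t h => absurd rfl h⟩
  add_mem' := by
    rintro a b ⟨ha, ha'⟩ ⟨hb, hb'⟩
    refine ⟨fun t π => ?_, fun t h => ?_⟩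
    · simp only [Pi.add_apply, ha t π, hb t π]; ring
    · by_cases h1 : a t = 0
      · apply hb'; intro h2; apply h; simp [h1, h2]
      · exact ha' _ h1
  smul_mem' := by
    rintro c a ⟨ha, ha'⟩
    refine ⟨fun t π => ?_, fun t h => ?_⟩
    · simp only [Pi.smul_apply, ha t π, smul_eq_mul]; ring
    · apply ha'; intro h1; apply h; simp [h1]

open Classical in
/-- the coboundary -/
noncomputable def bd {k : ℕ} (φ : (Fin (k+1) → X) → ℂ) (t : Fin k → X) : ℂ :=
  if Cell (Set.range t) then ∑ᶠ s, φ (Fin.cons s t) else 0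

/-- conditions on a family of cells -/
structure GoodCells : Prop where
  fin : ∀ σ, Cell σ → {s | Cell (insert s σ)}.Finite
  conv : ∀ σ ρ τ, Cell σ → Cell τ → σ ⊆ ρ → ρ ⊆ τ → Cell ρ

variable {Cell}

theorem DD.alt {k : ℕ} {φ : (Fin k → X) → ℂ} (h : φ ∈ DD Cell k) : Alt φ := h.1
theorem DD.cell {k : ℕ} {φ : (Fin k → X) → ℂ} (h : φ ∈ DD Cell k) {t : Fin k → X}
    (ht : φ t ≠ 0) : Cell (Set.range t) := h.2 t ht

theorem DD.supp {k : ℕ} (hC : GoodCells Cell) {φ : (Fin (k+1) → X) → ℂ} (h : φ ∈ DD Cell (k+1))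
    {t : Fin k → X} (ht : Cell (Set.range t)) : (Function.support fun s => φ (Fin.cons s t)).Finite := by
  refine (hC.fin _ ht).subset ?_
  intro s hs
  have := h.2 _ hs
  rwa [Fin.range_cons] at this

theorem bd_of_cell {k : ℕ} {φ : (Fin (k+1) → X) → ℂ} {t : Fin k → X}
    (ht : Cell (Set.range t)) : bd Cell φ t = ∑ᶠ s, φ (Fin.cons s t) := if_pos ht
theorem bd_of_not {k : ℕ} {φ : (Fin (k+1) → X) → ℂ} {t : Fin k → X}
    (ht : ¬ Cell (Set.range t)) : bd Cell φ t = 0 := if_neg ht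

theorem bd_mem {k : ℕ} {φ : (Fin (k+1) → X) → ℂ} (h : φ ∈ DD Cell (k+1)) :
    bd Cell φ ∈ DD Cell k := by
  refine ⟨fun t π => ?_, fun t ht => ?_⟩
  · have hr : Set.range (t ∘ π) = Set.range t := EquivLike.range_comp t π
    by_cases hc : Cell (Set.range t)
    · rw [bd_of_cell hc, bd_of_cell (by rwa [hr]), ← smul_eq_mul, smul_finsum]
      refine finsum_congr fun s => ?_
      rw [h.1.cons, smul_eq_mul]
    · rw [bd_of_not hc, bd_of_not (by rwa [hr]), mul_zero]
  · by_contra hc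
    exact ht (bd_of_not hc)

theorem bd_add (hC : GoodCells Cell) {k : ℕ} {φ ψ : (Fin (k+1) → X) → ℂ} (h : φ ∈ DD Cell (k+1))
    (h' : ψ ∈ DD Cell (k+1)) : bd Cell (φ + ψ) = bd Cell φ + bd Cell ψ := by
  funext t
  by_cases hc : Cell (Set.range t)
  · simp only [Pi.add_apply, bd_of_cell hc]
    exact finsum_add_distrib (DD.supp hC h hc) (DD.supp hC h' hc)
  · simp [bd_of_not hc]

theorem bd_smul (c : ℂ) {k : ℕ} {φ : (Fin (k+1) → X) → ℂ} :
    bd Cell (c • φ) = c • bd Cell φ := by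
  funext t
  by_cases hc : Cell (Set.range t)
  · simp only [Pi.smul_apply, bd_of_cell hc]
    rw [smul_finsum]
  · simp [bd_of_not hc]

theorem bd_sub (hC : GoodCells Cell) {k : ℕ} {φ ψ : (Fin (k+1) → X) → ℂ} (h : φ ∈ DD Cell (k+1))
    (h' : ψ ∈ DD Cell (k+1)) : bd Cell (φ - ψ) = bd Cell φ - bd Cell ψ := by
  have : φ - ψ = φ + (-1 : ℂ) • ψ := by funext t; simp; ring
  rw [this, bd_add hC h (Submodule.smul_mem _ _ h'), bd_smul]
  funext t; simp; ring

theorem bd_zero {k : ℕ} : bd Cell (0 : (Fin (k+1) → X) → ℂ) = 0 := by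
  funext t
  by_cases hc : Cell (Set.range t)
  · rw [bd_of_cell hc]; simp
  · rw [bd_of_not hc]; simp

theorem bd_bd (hC : GoodCells Cell) {k : ℕ} {φ : (Fin (k+2) → X) → ℂ} (h : φ ∈ DD Cell (k+2)) :
    bd Cell (bd Cell φ) = 0 := by
  funext t
  by_cases hc : Cell (Set.range t)
  swap
  · rw [bd_of_not hc]; rfl
  set F := (hC.fin _ hc).toFinset with hF
  have key : ∀ s s', φ (Fin.cons s (Fin.cons s' t)) ≠ 0 → s ∈ F ∧ s' ∈ F := by
    intro s s' hs
    have h1 := h.2 _ hs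
    rw [Fin.range_cons, Fin.range_cons] at h1
    rw [hF, Set.Finite.mem_toFinset, Set.Finite.mem_toFinset]
    constructor
    · refine hC.conv _ _ _ hc h1 (Set.subset_insert _ _) ?_
      exact Set.insert_subset_insert (Set.subset_insert _ _)
    · exact hC.conv _ _ _ hc h1 (Set.subset_insert _ _) (Set.subset_insert _ _)
  have h1 : ∀ s', bd Cell φ (Fin.cons s' t) = ∑ s ∈ F, φ (Fin.cons s (Fin.cons s' t)) := by
    intro s'
    by_cases hs : Cell (Set.range (Fin.cons s' t : Fin (k+1) → X))
    · rw [bd_of_cell hs]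
      apply finsum_eq_sum_of_support_subset
      intro s hs
      exact (key s s' hs).1
    · rw [bd_of_not hs]
      symm
      apply Finset.sum_eq_zero
      intro s hs'
      by_contra hne
      have := (key s s' hne).2
      rw [hF, Set.Finite.mem_toFinset] at this
      exact hs (by rwa [Fin.range_cons])
  rw [bd_of_cell hc]
  simp only [h1]
  rw [finsum_eq_sum_of_support_subset (s := F)]
  · have hanti : ∑ s' ∈ F, ∑ s ∈ F, φ (Fin.cons s (Fin.cons s' t))
        = - ∑ s' ∈ F, ∑ s ∈ F, φ (Fin.cons s (Fin.cons s' t)) := by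
      conv_lhs => rw [Finset.sum_comm]
      rw [← Finset.sum_neg_distrib]
      refine Finset.sum_congr rfl fun s' _ => ?_
      rw [← Finset.sum_neg_distrib]
      refine Finset.sum_congr rfl fun s _ => ?_
      exact h.1.cons_swap _ _ _
    simp only [Pi.zero_apply]
    linear_combination hanti / 2
  · intro s' hs'
    obtain ⟨s, _, hs⟩ := Finset.exists_ne_zero_of_sum_ne_zero hs'
    exact (key s s' hs).2

end cochains

open Equiv

/-- combinatorial data of a simple polyhedron with a generic height function -/
structure Polyh (X V : Type*) where
  S : V → Finset X
  nb : V → X → V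
  f : V → ℝ
  nb_mem : ∀ P, ∀ s ∈ S P, ∀ s' ∈ S P, s' ≠ s → s' ∈ S (nb P s)
  nb_ne : ∀ P, ∀ s ∈ S P, f (nb P s) ≠ f P
  conv : ∀ P (σ : Set X), σ ⊆ S P → (∀ s ∈ S P, s ∉ σ → f (nb P s) < f P) →
    ∀ Q, σ ⊆ S Q → Q ≠ P → f Q < f P
  fin : ∀ c : ℝ, {P | f P ≤ c}.Finite

namespace Polyh
variable {X V : Type*} (A : Polyh X V)

/-- the bounded faces -/
def Cell (σ : Set X) : Prop := (∃ P, σ ⊆ A.S P) ∧ {P | σ ⊆ A.S P}.Finite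

theorem cell_mono {σ ρ : Set X} (h : A.Cell σ) (h1 : σ ⊆ ρ) {P : V} (h2 : ρ ⊆ A.S P) : A.Cell ρ :=
  ⟨⟨P, h2⟩, h.2.subset fun _ hQ => h1.trans hQ⟩

theorem good : GoodCells A.Cell where
  fin := by
    intro σ h
    refine (h.2.biUnion (t := fun P => (A.S P : Set X)) (fun P _ => (A.S P).finite_toSet)).subset ?_
    rintro s ⟨⟨P, hP⟩, -⟩
    simp only [Set.mem_iUnion]
    exact ⟨P, (Set.subset_insert _ _).trans hP, hP (Set.mem_insert _ _)⟩
  conv := by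
    rintro σ ρ τ h ⟨⟨P, hP⟩, -⟩ h1 h2
    exact A.cell_mono h h1 (h2.trans hP)

/-- `P` is the top vertex of `σ` -/
def IsMax (σ : Set X) (P : V) : Prop :=
  σ ⊆ A.S P ∧ ∀ s ∈ A.S P, s ∉ σ → A.f (A.nb P s) < A.f P

theorem exists_isMax {σ : Set X} (h : A.Cell σ) : ∃ P, A.IsMax σ P := by
  obtain ⟨⟨P0, h0⟩, hf⟩ := h
  obtain ⟨P, hP, hm⟩ := hf.exists_maximalFor A.f _ ⟨P0, h0⟩
  refine ⟨P, hP, fun s hs hσ => lt_of_le_of_ne ?_ (A.nb_ne P s hs)⟩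
  have : A.nb P s ∈ {P | σ ⊆ A.S P} := by
    intro s' hs'
    exact A.nb_mem P s hs s' (hP hs') (by rintro rfl; exact hσ hs')
  rcases le_total (A.f (A.nb P s)) (A.f P) with h | h
  · exact h
  · exact hm this h

theorem IsMax.cell {σ : Set X} {P : V} (h : A.IsMax σ P) : A.Cell σ := by
  refine ⟨⟨P, h.1⟩, (A.fin (A.f P)).subset ?_⟩
  intro Q hQ
  by_cases hQP : Q = P
  · rw [hQP]; exact le_refl (A.f P)
  · exact (A.conv P σ h.1 h.2 Q hQ hQP).le

theorem IsMax.le {σ : Set X} {P Q : V} (h : A.IsMax σ P) (hQ : σ ⊆ A.S Q) (hne : Q ≠ P) :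
    A.f Q < A.f P := A.conv P σ h.1 h.2 Q hQ hne

theorem IsMax.unique {σ : Set X} {P Q : V} (h : A.IsMax σ P) (h' : A.IsMax σ Q) : P = Q := by
  by_contra hne
  exact lt_asymm (h.le A h'.1 (Ne.symm hne)) (h'.le A h.1 hne)

open Classical in
noncomputable def e (x0 : X) (P : V) : X :=
  if h : ∃ s ∈ A.S P, A.f (A.nb P s) < A.f P then h.choose else x0

open Classical in
noncomputable def top (P0 : V) (σ : Set X) : V :=
  if h : A.Cell σ then (A.exists_isMax h).choose else P0

variable {A}
theorem top_isMax (P0 : V) {σ : Set X} (h : A.Cell σ) : A.IsMax σ (A.top P0 σ) := by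
  unfold top
  rw [dif_pos h]
  exact (A.exists_isMax h).choose_spec

theorem top_eq (P0 : V) {σ : Set X} {P : V} (h : A.IsMax σ P) : A.top P0 σ = P :=
  (top_isMax P0 (h.cell A)).unique A h

theorem e_spec (x0 : X) {P : V} (h : ∃ s ∈ A.S P, A.f (A.nb P s) < A.f P) :
    A.e x0 P ∈ A.S P ∧ A.f (A.nb P (A.e x0 P)) < A.f P := by
  unfold e
  rw [dif_pos h]
  exact h.choose_spec

variable (A)
noncomputable def rk (P : V) : ℕ := {Q | A.f Q < A.f P}.ncard

variable {A}
theorem rk_lt {P Q : V} (h : A.f P < A.f Q) : A.rk P < A.rk Q := by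
  apply Set.ncard_lt_ncard
  · rw [Set.ssubset_iff_of_subset]
    · exact ⟨P, h, fun h' => lt_irrefl (A.f P) h'⟩
    · intro R hR; exact lt_trans hR h
  · exact (A.fin (A.f Q)).subset fun R (hR : A.f R < A.f Q) => show A.f R ≤ A.f Q from le_of_lt hR

variable (A)
/-- matching condition -/
def HC (x0 : X) (P0 : V) (x : X) (σ : Set X) : Prop :=
  A.Cell σ ∧ x = A.e x0 (A.top P0 σ) ∧ A.f (A.nb (A.top P0 σ) x) < A.f (A.top P0 σ)

open Classical in
/-- the Morse homotopy -/
noncomputable def hom (x0 : X) (P0 : V) {k : ℕ} (φ : (Fin k → X) → ℂ) : (Fin (k+1) → X) → ℂ :=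
  wedge fun x u => if A.HC x0 P0 x (insert x (Set.range u)) then φ u else 0

variable {A}
variable {x0 : X} {P0 : V} {k d : ℕ}

theorem insert_range_perm {k : ℕ} (t : Fin (k+1) → X) (π : Perm (Fin (k+1))) :
    insert (t (π 0)) (Set.range (t ∘ π ∘ Fin.succ)) = Set.range t := by
  have h : t ∘ π = Fin.cons (t (π 0)) (t ∘ π ∘ Fin.succ) := by
    funext i; refine Fin.cases ?_ (fun i => ?_) i <;> simp
  rw [← Fin.range_cons, ← h, EquivLike.range_comp]

theorem hom_eq_zero {φ : (Fin k → X) → ℂ} {t : Fin (k+1) → X}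
    (h : ∀ x ∈ Set.range t, ¬ A.HC x0 P0 x (Set.range t)) :
    A.hom x0 P0 φ t = 0 := by
  unfold hom wedge
  rw [Finset.sum_eq_zero, mul_zero]
  intro π _
  beta_reduce
  rw [if_neg, mul_zero]
  rw [insert_range_perm]
  exact h _ ⟨_, rfl⟩

theorem hom_mem {φ : (Fin k → X) → ℂ} : A.hom x0 P0 φ ∈ DD A.Cell (k+1) := by
  refine ⟨wedge_alt _, fun t ht => ?_⟩
  by_contra h
  exact ht (hom_eq_zero fun x _ h' => h h'.1)

theorem hom_cons {φ : (Fin k → X) → ℂ} (hφ : Alt φ) {e : X} {u : Fin k → X}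
    (hc : A.HC x0 P0 e (insert e (Set.range u)))
    (hu : e ∉ Set.range u) : A.hom x0 P0 φ (Fin.cons e u) = φ u := by
  unfold hom
  rw [wedge_cons]
  · rw [if_pos hc]
  · intro t π
    have hr : Set.range (t ∘ π) = Set.range t := EquivLike.range_comp t π
    beta_reduce
    rw [hr]
    split_ifs
    · exact hφ t π
    · simp
  · intro π hπ
    rw [if_neg]
    rw [insert_range_perm, Fin.range_cons]
    rintro ⟨-, h, -⟩
    obtain ⟨j, hj⟩ := Fin.exists_succ_eq.mpr hπ
    rw [← hc.2.1, ← hj, Fin.cons_succ] at h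
    exact hu ⟨j, h⟩

/-- removing the descending facet does not change the top vertex -/
theorem IsMax.diff {σ : Set X} {P : V} {e : X} (h : A.IsMax (insert e σ) P)
    (he : A.f (A.nb P e) < A.f P) : A.IsMax σ P := by
  refine ⟨(Set.subset_insert _ _).trans h.1, fun s hs hσ => ?_⟩
  by_cases hse : s = e
  · rwa [hse]
  · exact h.2 s hs (by simp [hse, hσ])

theorem IsMax.ins {σ : Set X} {P : V} {e : X} (h : A.IsMax σ P) (he : e ∈ A.S P) :
    A.IsMax (insert e σ) P := by
  refine ⟨Set.insert_subset he h.1, fun s hs hσ => ?_⟩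
  exact h.2 s hs (fun h' => hσ (Set.mem_insert_of_mem _ h'))

/-- For a cell with fewer than `d` elements, `e` is a descending direction at the top. -/
theorem e_spec' (hd : ∀ P, (A.S P).card = d) {σ : Set X} {P : V} (h : A.IsMax σ P)
    (hk : σ.encard < d) : A.e x0 P ∈ A.S P ∧ A.f (A.nb P (A.e x0 P)) < A.f P := by
  apply e_spec
  have : ∃ s ∈ A.S P, s ∉ σ := by
    by_contra hcon
    push Not at hcon
    have h1 : ((A.S P : Set X)) ⊆ σ := hcon
    have h2 := Set.encard_le_encard h1
    rw [Set.encard_coe_eq_coe_finsetCard, hd] at h2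
    exact absurd (lt_of_le_of_lt h2 hk) (lt_irrefl _)
  obtain ⟨s, hs, hσ⟩ := this
  exact ⟨s, hs, h.2 s hs hσ⟩

theorem range_encard {k : ℕ} (t : Fin k → X) : (Set.range t).encard ≤ k := by
  rw [← Set.image_univ]
  refine (Set.encard_image_le _ _).trans ?_
  simp


/-- if `hom φ t ≠ 0` then `t` is, up to permutation, `e :: u` with the same top -/
theorem hom_ne_zero {φ : (Fin k → X) → ℂ} (hφ : Alt φ) {t : Fin (k+1) → X}
    (h : A.hom x0 P0 φ t ≠ 0) : ∃ (u : Fin k → X) (P : V) (π : Perm (Fin (k+1))),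
      t = (Fin.cons (A.e x0 P) u : Fin (k+1) → X) ∘ π ∧ A.IsMax (Set.range t) P ∧
      A.IsMax (Set.range u) P ∧ φ u ≠ 0 ∧ A.e x0 P ∉ Set.range u ∧ A.e x0 P ∈ Set.range t := by
  have h1 : ∃ x ∈ Set.range t, A.HC x0 P0 x (Set.range t) := by
    by_contra hcon
    push Not at hcon
    exact h (hom_eq_zero hcon)
  obtain ⟨x, hx, hc⟩ := h1
  have hinj := (hom_mem (A := A) (x0 := x0) (P0 := P0) (φ := φ)).1.inj h
  obtain ⟨u, π, hu⟩ := exists_cons_perm t hx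
  have hP := top_isMax P0 hc.1
  have hxe := hc.2.1
  have hr : Set.range t = insert x (Set.range u) := by
    rw [hu, EquivLike.range_comp, Fin.range_cons]
  have hxu : x ∉ Set.range u := by
    rintro ⟨i, hi⟩
    have e1 : t (π.symm 0) = t (π.symm i.succ) := by rw [hu]; simp [hi]
    have := π.symm.injective (hinj e1)
    exact Fin.succ_ne_zero i this.symm
  refine ⟨u, A.top P0 (Set.range t), π, ?_, hP, ?_, ?_, ?_, ?_⟩
  · rw [← hxe]; exact hu
  · have h2 := hP
    rw [hr] at h2
    rw [← hr] at h2
    refine IsMax.diff (e := x) ?_ hc.2.2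
    rw [← hr]; exact hP
  · intro h0
    apply h
    rw [hu, (hom_mem (A := A) (x0 := x0) (P0 := P0) (φ := φ)).1, hom_cons hφ, h0, mul_zero]
    · rw [← hr]; exact hc
    · exact hxu
  · rw [← hxe]; exact hxu
  · rw [← hxe]; exact hx

/-- cocycle condition -/
def Coc (Cell : Set X → Prop) : (k : ℕ) → ((Fin k → X) → ℂ) → Prop
  | 0, _ => True
  | _ + 1, φ => bd Cell φ = 0

variable (A) in
/-- vanishing on cells of small rank -/
def Van (n : ℕ) (φ : (Fin k → X) → ℂ) : Prop :=
  ∀ t P, A.IsMax (Set.range t) P → A.rk P < n → φ t = 0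

theorem hom_van {φ : (Fin k → X) → ℂ} (hφ : Alt φ) {n : ℕ} (hv : A.Van n φ) :
    A.Van n (A.hom x0 P0 φ) := by
  intro t P hP hr
  by_contra hne
  obtain ⟨u, P', π, ht, h1, h2, h3, -⟩ := hom_ne_zero hφ hne
  rw [h1.unique A hP] at h2
  exact h3 (hv u P h2 hr)

/-- sums over the star reduce to sums over the facets at the top vertex -/
theorem bd_van {ψ : (Fin (k+1) → X) → ℂ} (hψ : ψ ∈ DD A.Cell (k+1)) {n : ℕ} (hv : A.Van n ψ)
    {t : Fin k → X} {P : V} (hP : A.IsMax (Set.range t) P) (hn : A.rk P ≤ n) :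
    bd A.Cell ψ t = ∑ s ∈ A.S P, ψ (Fin.cons s t) := by
  rw [bd_of_cell (hP.cell A)]
  apply finsum_eq_sum_of_support_subset
  intro s hs
  by_contra hsP
  obtain ⟨Q, hQ⟩ := A.exists_isMax (hψ.2 _ hs)
  have hQt : Set.range t ⊆ A.S Q := by
    refine Set.Subset.trans ?_ hQ.1
    rw [Fin.range_cons]; exact Set.subset_insert _ _
  have hne : Q ≠ P := by
    rintro rfl
    exact hsP (hQ.1 (by rw [Fin.range_cons]; exact Set.mem_insert _ _))
  exact hs (hv _ Q hQ (lt_of_lt_of_le (rk_lt (hP.le A hQt hne)) hn))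

theorem hom_step (hd : ∀ P, (A.S P).card = d) (hk : k < d) {φ : (Fin k → X) → ℂ}
    (hφ : φ ∈ DD A.Cell k) (hco : Coc A.Cell k φ) {n : ℕ} (hv : A.Van n φ)
    {t : Fin k → X} {P : V} (hP : A.IsMax (Set.range t) P) (hn : A.rk P ≤ n) :
    bd A.Cell (A.hom x0 P0 φ) t = φ t := by
  classical
  rw [bd_van hom_mem (hom_van hφ.1 hv) hP hn]
  by_cases hti : Function.Injective t
  swap
  · have : φ t = 0 := by
      by_contra h; exact hti (hφ.1.inj h)
    rw [this]
    apply Finset.sum_eq_zero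
    intro s _
    by_contra h
    exact hti (fun i j hij => Fin.succ_injective _ ((hom_mem (A := A)).1.inj h (by simpa using hij)))
  have hes := e_spec' (x0 := x0) hd hP (lt_of_le_of_lt (range_encard t) (by exact_mod_cast hk))
  set e := A.e x0 P with he
  -- matching condition
  have hHC : ∀ σ : Set X, A.IsMax (insert e σ) P → A.HC x0 P0 e (insert e σ) := by
    intro σ h
    refine ⟨h.cell A, ?_, ?_⟩
    · rw [top_eq P0 h]
    · rw [top_eq P0 h]; exact hes.2
  by_cases het : e ∈ Set.range t
  · -- e occurs in t
    cases k with
    | zero => obtain ⟨i, _⟩ := het; exact i.elim0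
    | succ k =>
      obtain ⟨u, π, hu⟩ := exists_cons_perm t het
      have hr : Set.range t = insert e (Set.range u) := by
        rw [hu, EquivLike.range_comp, Fin.range_cons]
      have heu : e ∉ Set.range u := by
        rintro ⟨i, hi⟩
        have e1 : t (π.symm 0) = t (π.symm i.succ) := by rw [hu]; simp [hi]
        have := π.symm.injective (hti e1)
        exact Fin.succ_ne_zero i this.symm
      have hPe : A.IsMax (insert e (Set.range u)) P := hr ▸ hP
      have hPu : A.IsMax (Set.range u) P := IsMax.diff hPe hes.2
      have hcu : ∑ s ∈ A.S P, φ (Fin.cons s u) = 0 := by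
        rw [← bd_van hφ hv hPu hn]
        exact congrFun hco u
      rw [hu, hφ.1]
      have h1 : ∀ s ∈ A.S P, A.hom x0 P0 φ (Fin.cons s ((Fin.cons e u : Fin (k+1) → X) ∘ π))
          = ((Perm.sign π : ℤ) : ℂ) * (if s = e then 0 else - φ (Fin.cons s u)) := by
        intro s hs
        rw [(hom_mem (A := A)).1.cons]
        congr 1
        split_ifs with hse
        · rw [hse]
          by_contra h
          have := (hom_mem (A := A)).1.inj h
          have h2 := @this 0 1 (by simp)
          simp at h2
        · rw [(hom_mem (A := A)).1.cons_swap, hom_cons hφ.1]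
          · apply hHC
            rw [Fin.range_cons, Set.insert_comm]
            exact hPe.ins hs
          · rw [Fin.range_cons]
            simp only [Set.mem_insert_iff, not_or]
            exact ⟨fun h => hse h.symm, heu⟩
      rw [Finset.sum_congr rfl h1, ← Finset.mul_sum]
      congr 1
      rw [← Finset.add_sum_erase _ _ hes.1] at hcu ⊢
      rw [if_pos rfl, zero_add]
      rw [Finset.sum_congr rfl (fun s hs => if_neg (Finset.ne_of_mem_erase hs)),
        Finset.sum_neg_distrib]
      linear_combination (-1 : ℂ) * hcu
  · -- e does not occur in t
    rw [Finset.sum_eq_single e]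
    · rw [hom_cons hφ.1 (hHC _ (hP.ins hes.1)) het]
    · intro s hs hse
      by_contra hne
      obtain ⟨u, P', π, ht, h1, h2, h3, h4, h5⟩ := hom_ne_zero hφ.1 hne
      rw [Fin.range_cons] at h1 h5
      have : P' = P := h1.unique A (hP.ins hs)
      rw [this, ← he] at h5
      rcases h5 with h5 | h5
      · exact hse h5.symm
      · exact het h5
    · intro h; exact absurd hes.1 h

theorem coc_sub_bd {φ : (Fin k → X) → ℂ} {ψ : (Fin (k+1) → X) → ℂ} (hφ : φ ∈ DD A.Cell k)
    (hψ : ψ ∈ DD A.Cell (k+1)) (h : Coc A.Cell k φ) : Coc A.Cell k (φ - bd A.Cell ψ) := by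
  cases k with
  | zero => trivial
  | succ k =>
    change bd A.Cell _ = 0
    rw [bd_sub A.good hφ (bd_mem hψ), bd_bd A.good hψ, sub_zero]
    exact h

variable (A) in
/-- successive approximations -/
noncomputable def approx (x0 : X) (P0 : V) (φ : (Fin k → X) → ℂ) : ℕ → (Fin (k+1) → X) → ℂ
  | 0 => 0
  | n + 1 => approx x0 P0 φ n + A.hom x0 P0 (φ - bd A.Cell (approx x0 P0 φ n))

theorem approx_spec (hd : ∀ P, (A.S P).card = d) (hk : k < d) {φ : (Fin k → X) → ℂ}
    (hφ : φ ∈ DD A.Cell k) (hco : Coc A.Cell k φ) (n : ℕ) :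
    A.approx x0 P0 φ n ∈ DD A.Cell (k+1) ∧ A.Van n (φ - bd A.Cell (A.approx x0 P0 φ n)) := by
  induction n with
  | zero =>
    refine ⟨Submodule.zero_mem _, fun t P _ h => absurd h (Nat.not_lt_zero _)⟩
  | succ n ih =>
    obtain ⟨h1, h2⟩ := ih
    have hm : φ - bd A.Cell (A.approx x0 P0 φ n) ∈ DD A.Cell k :=
      Submodule.sub_mem _ hφ (bd_mem h1)
    refine ⟨Submodule.add_mem _ h1 hom_mem, ?_⟩
    intro t P hP hr
    have := hom_step (x0 := x0) (P0 := P0) hd hk hm (coc_sub_bd hφ h1 hco) h2 hP (Nat.lt_succ_iff.mp hr)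
    simp only [approx]
    rw [bd_add A.good h1 hom_mem]
    simp only [Pi.sub_apply, Pi.add_apply] at this ⊢
    rw [this]; ring

theorem approx_stable (hd : ∀ P, (A.S P).card = d) (hk : k < d) {φ : (Fin k → X) → ℂ}
    (hφ : φ ∈ DD A.Cell k) (hco : Coc A.Cell k φ) {t : Fin (k+1) → X} {P : V}
    (hP : A.IsMax (Set.range t) P) (m : ℕ) :
    A.approx x0 P0 φ (A.rk P + 1 + m) t = A.approx x0 P0 φ (A.rk P + 1) t := by
  induction m with
  | zero => rfl
  | succ m ih =>
    obtain ⟨h1, h2⟩ := approx_spec (x0 := x0) (P0 := P0) hd hk hφ hco (A.rk P + 1 + m)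
    have hm : φ - bd A.Cell (A.approx x0 P0 φ (A.rk P + 1 + m)) ∈ DD A.Cell k :=
      Submodule.sub_mem _ hφ (bd_mem h1)
    rw [← add_assoc]
    simp only [approx, Pi.add_apply]
    simp only [approx, Pi.add_apply] at ih
    rw [ih, hom_van hm.1 h2 t P hP (by omega), add_zero]

theorem exact_aux (x0 : X) (P0 : V) (hd : ∀ P, (A.S P).card = d) (hk : k < d)
    {φ : (Fin k → X) → ℂ}
    (hφ : φ ∈ DD A.Cell k) (hco : Coc A.Cell k φ) :
    ∃ ψ ∈ DD A.Cell (k+1), bd A.Cell ψ = φ := by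
  classical
  set ψ : (Fin (k+1) → X) → ℂ := fun t => A.approx x0 P0 φ (A.rk (A.top P0 (Set.range t)) + 1) t with hψ
  have hA := fun n => approx_spec (x0 := x0) (P0 := P0) hd hk hφ hco n
  have hψm : ψ ∈ DD A.Cell (k+1) := by
    refine ⟨fun t π => ?_, fun t ht => ?_⟩
    · simp only [hψ]
      rw [EquivLike.range_comp]
      exact (hA _).1.1 t π
    · exact (hA _).1.2 t ht
  refine ⟨ψ, hψm, ?_⟩
  funext t
  by_cases hc : A.Cell (Set.range t)
  swap
  · rw [bd_of_not hc]
    by_contra h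
    exact hc (hφ.2 t (Ne.symm h))
  obtain ⟨P, hP⟩ := A.exists_isMax hc
  have h1 : bd A.Cell ψ t = bd A.Cell (A.approx x0 P0 φ (A.rk P + 1)) t := by
    rw [bd_of_cell hc, bd_of_cell hc]
    refine finsum_congr fun s => ?_
    by_cases hs : A.Cell (Set.range (Fin.cons s t : Fin (k+1) → X))
    · obtain ⟨Q, hQ⟩ := A.exists_isMax hs
      have hle : A.rk Q ≤ A.rk P := by
        by_cases hQP : Q = P
        · rw [hQP]
        · have hQt : Set.range t ⊆ A.S Q := by
            refine Set.Subset.trans ?_ hQ.1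
            rw [Fin.range_cons]; exact Set.subset_insert _ _
          exact (rk_lt (hP.le A hQt hQP)).le
      simp only [hψ]
      rw [top_eq P0 hQ]
      obtain ⟨m, hm⟩ := Nat.exists_eq_add_of_le hle
      have := approx_stable (x0 := x0) (P0 := P0) hd hk hφ hco hQ m
      rw [show A.rk P + 1 = A.rk Q + 1 + m by omega, this]
    · have z : ∀ χ ∈ DD A.Cell (k+1), χ (Fin.cons s t) = 0 := by
        intro χ hχ; by_contra h; exact hs (hχ.2 _ h)
      rw [z _ hψm, z _ (hA _).1]
  rw [h1]
  have := (hA (A.rk P + 1)).2 t P hP (Nat.lt_succ_self _)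
  simp only [Pi.sub_apply] at this
  linear_combination -this

theorem exact (hd : ∀ P, (A.S P).card = d) (hk : k < d) {φ : (Fin k → X) → ℂ}
    (hφ : φ ∈ DD A.Cell k) (hco : Coc A.Cell k φ) :
    ∃ ψ ∈ DD A.Cell (k+1), bd A.Cell ψ = φ := by
  by_cases hV : Nonempty V
  · obtain ⟨P0⟩ := hV
    have : (A.S P0).Nonempty := by
      rw [← Finset.card_pos, hd]; omega
    obtain ⟨x0, _⟩ := this
    exact exact_aux x0 P0 hd hk hφ hco
  · have z : φ = 0 := by
      funext t
      by_contra h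
      obtain ⟨⟨P, _⟩, _⟩ := hφ.2 t h
      exact hV ⟨P⟩
    exact ⟨0, Submodule.zero_mem _, by rw [bd_zero, z]⟩

end Polyh

open Equiv

section Homological
open CategoryTheory Limits

/-- positive degree cohomology vanishes -/
def Acyc {G : Type} [Group G] (A : Rep.{0} ℂ G) : Prop :=
  ∀ n : ℕ, IsZero (groupCohomology A (n+1))

theorem acyc_of_retract {G : Type} [Group G] {V : Type} [AddCommGroup V] [Module ℂ V]
    (ρ : Representation ℂ G V) (r : (G → V) →ₗ[ℂ] V)
    (h1 : ∀ a, r (fun x => ρ x a) = a) (h2 : ∀ g f, r (fun x => f (x * g)) = ρ g (r f)) :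
    Acyc (Rep.of ρ) := by
  intro n
  let A0 : Rep.{0} ℂ (⊥ : Subgroup G) := Rep.trivial ℂ (⊥ : Subgroup G) V
  let C : Rep.{0} ℂ G := Rep.coind (⊥ : Subgroup G).subtype A0
  have hC : IsZero (groupCohomology C (n+1)) :=
    (isZero_groupCohomology_succ_of_subsingleton A0 n).of_iso
      (groupCohomology.coindIso A0 (n+1))
  let i : Rep.of ρ ⟶ C := Rep.ofHom
    { toFun := fun a => ⟨fun x => ρ x a, by
        rintro ⟨g, hg⟩ h
        obtain rfl : g = 1 := by simpa using hg
        simp [A0]⟩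
      map_add' := by intro a b; apply Subtype.ext; funext x; simp
      map_smul' := by intro a b; apply Subtype.ext; funext x; simp
      isIntertwining' := by
        intro g; ext a x
        change ρ x (ρ g a) = ρ (x * g) a
        simp }
  let q : C ⟶ Rep.of ρ := Rep.ofHom
    { toFun := fun f => r f.1
      map_add' := by intro a b; exact map_add r a.1 b.1
      map_smul' := by intro a b; exact map_smul r a b.1
      isIntertwining' := by
        intro g; ext f
        exact h2 g f.1 }
  have hiq : i ≫ q = 𝟙 _ := by
    apply Rep.hom_ext
    ext a
    exact h1 a
  have h3 : (groupCohomology.functor ℂ G (n+1)).map i ≫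
      (groupCohomology.functor ℂ G (n+1)).map q = 𝟙 _ := by
    rw [← Functor.map_comp, hiq, CategoryTheory.Functor.map_id]
  have h4 : (groupCohomology.functor ℂ G (n+1)).map i = 0 := hC.eq_of_tgt _ _
  rw [h4, zero_comp] at h3
  exact (IsZero.iff_id_eq_zero _).2 h3.symm

theorem acyc_shift {G : Type} [Group G] {V1 V2 V3 : Type}
    [AddCommGroup V1] [Module ℂ V1] [AddCommGroup V2] [Module ℂ V2] [AddCommGroup V3] [Module ℂ V3]
    (ρ1 : Representation ℂ G V1) (ρ2 : Representation ℂ G V2) (ρ3 : Representation ℂ G V3)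
    (i : V1 →ₗ[ℂ] V2) (p : V2 →ₗ[ℂ] V3)
    (hi : ∀ g v, i (ρ1 g v) = ρ2 g (i v)) (hp : ∀ g v, p (ρ2 g v) = ρ3 g (p v))
    (hinj : Function.Injective i) (hsurj : Function.Surjective p)
    (hz : ∀ v, p (i v) = 0) (hex : ∀ v, p v = 0 → ∃ w, i w = v)
    (h2 : Acyc (Rep.of ρ2)) (h3 : Acyc (Rep.of ρ3))
    (hinv : ∀ v, (∀ g, ρ3 g v = v) → ∃ w, (∀ g, ρ2 g w = w) ∧ p w = v) :
    Acyc (Rep.of ρ1) := by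
  let f : Rep.of ρ1 ⟶ Rep.of ρ2 := Rep.ofHom
    { i with isIntertwining' := by intro g; ext v; exact hi g v }
  let q : Rep.of ρ2 ⟶ Rep.of ρ3 := Rep.ofHom
    { p with isIntertwining' := by intro g; ext v; exact hp g v }
  let X : ShortComplex (Rep.{0} ℂ G) := ShortComplex.mk f q (by
    apply Rep.hom_ext; ext v; exact hz v)
  have hX : X.ShortExact :=
    { exact := by
        apply (forget₂ (Rep.{0} ℂ G) (ModuleCat ℂ)).reflects_exact_of_faithful
        rw [ShortComplex.moduleCat_exact_iff]
        intro v hv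
        exact hex v hv
      mono_f := (Rep.mono_iff_injective _).2 hinj
      epi_g := (Rep.epi_iff_surjective _).2 hsurj }
  intro n
  have he := groupCohomology.epi_δ_of_isZero hX n (h2 n)
  rcases n with _ | n
  · have hs : Epi ((groupCohomology.functor ℂ G 0).map q) := by
      have : Epi ((Rep.invariantsFunctor ℂ G).map q) := by
        rw [ModuleCat.epi_iff_surjective]
        rintro ⟨v, hv⟩
        obtain ⟨w, hw, hwv⟩ := hinv v hv
        exact ⟨⟨w, hw⟩, Subtype.ext hwv⟩
      have h5 : (groupCohomology.functor ℂ G 0).map q =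
          (groupCohomology.H0Iso (Rep.of ρ2)).hom ≫ (Rep.invariantsFunctor ℂ G).map q ≫
          (groupCohomology.H0Iso (Rep.of ρ3)).inv := by
        rw [← Category.assoc]
        refine (Iso.eq_comp_inv _).2 ?_
        exact groupCohomology.map_id_comp_H0Iso_hom q
      rw [h5]
      have e1 : Epi (groupCohomology.H0Iso (Rep.of ρ2)).hom := inferInstance
      have e2 : Epi (groupCohomology.H0Iso (Rep.of ρ3)).inv := inferInstance
      exact @epi_comp _ _ _ _ _ _ e1 _ (@epi_comp _ _ _ _ _ _ this _ e2)
    have h6 := (groupCohomology.mapShortComplex₃ hX (rfl : 0 + 1 = 1)).zero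
    have h7 : groupCohomology.δ hX 0 1 rfl = 0 := by
      exact hs.left_cancellation _ _ (h6.trans comp_zero.symm)
    exact IsZero.of_epi_eq_zero (groupCohomology.δ hX 0 1 rfl) h7
  · exact IsZero.of_epi (groupCohomology.δ hX (n+1) (n+1+1) rfl) (h3 n)

theorem acyc_of_equiv {G : Type} [Group G] {V1 V2 : Type}
    [AddCommGroup V1] [Module ℂ V1] [AddCommGroup V2] [Module ℂ V2]
    (ρ1 : Representation ℂ G V1) (ρ2 : Representation ℂ G V2)
    (e : V1 ≃ₗ[ℂ] V2) (he : ∀ g v, e (ρ1 g v) = ρ2 g (e v)) (h : Acyc (Rep.of ρ1)) :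
    Acyc (Rep.of ρ2) := by
  intro n
  let I : Rep.of ρ1 ≅ Rep.of ρ2 := Rep.mkIso (Representation.Equiv.mk e
    (by intro g; ext v; exact he g v))
  exact (h n).of_iso ((groupCohomology.functor ℂ G (n+1)).mapIso I.symm)

end Homological

open Equiv

section Chains
open Pointwise

theorem mul_fs {ι : Sort*} (c : ℂ) (f : ι → ℂ) : c * ∑ᶠ i, f i = ∑ᶠ i, c * f i := smul_finsum c f
theorem mul_fs_mem {ι : Type*} (c : ℂ) (s : Set ι) (f : ι → ℂ) :
    c * ∑ᶠ i ∈ s, f i = ∑ᶠ i ∈ s, c * f i := by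
  rw [mul_fs]
  exact finsum_congr fun i => mul_fs _ _

/-- an invariant system of cells with finite stabilisers -/
structure CellSys {G X : Type} [Group G] [MulAction G X] (Cell : Set X → Prop) : Prop where
  good : GoodCells Cell
  inv : ∀ (g : G) (σ : Set X), Cell σ → Cell (g • σ)
  stab : ∀ σ, Cell σ → {g : G | g • σ = σ}.Finite

variable {G X : Type} [Group G] [MulAction G X] {Cell : Set X → Prop} (χ : G →* ℤˣ)

/-- the sign attached to a group element -/
def sg (g : G) : ℂ := ((χ g : ℤ) : ℂ)

theorem sg_mul (g h : G) : sg χ (g * h) = sg χ g * sg χ h := by simp [sg]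
theorem sg_one : sg χ (1 : G) = 1 := by simp [sg]
theorem sg_self (g : G) : sg χ g * sg χ g = 1 := by
  rcases Int.units_eq_one_or (χ g) with h | h <;> simp [sg, h]
theorem sg_inv (g : G) : sg χ g⁻¹ = sg χ g := by
  rcases Int.units_eq_one_or (χ g) with h | h <;> simp [sg, h]
theorem sg_ne (g : G) : sg χ g ≠ 0 := fun h => by
  have := sg_self χ g; rw [h] at this; simp at this

theorem range_smul' {k : ℕ} (g : G) (t : Fin k → X) : Set.range (g • t) = g • Set.range t := by
  ext x; constructor
  · rintro ⟨i, rfl⟩; exact ⟨t i, ⟨i, rfl⟩, rfl⟩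
  · rintro ⟨_, ⟨i, rfl⟩, rfl⟩; exact ⟨i, rfl⟩

theorem CellSys.iff (hC : CellSys (G := G) Cell) (g : G) (σ : Set X) : Cell (g • σ) ↔ Cell σ :=
  ⟨fun h => by simpa using hC.inv g⁻¹ _ h, hC.inv g σ⟩

theorem smul_cons {k : ℕ} (g : G) (s : X) (t : Fin k → X) :
    g • (Fin.cons s t : Fin (k+1) → X) = Fin.cons (g • s) (g • t) := by
  funext i; refine Fin.cases ?_ ?_ i <;> simp

/-- the twisted action on functions on tuples -/
def act {k : ℕ} (g : G) : ((Fin k → X) → ℂ) →ₗ[ℂ] ((Fin k → X) → ℂ) where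
  toFun φ := fun t => sg χ g * φ (g⁻¹ • t)
  map_add' φ ψ := by funext t; simp [mul_add]
  map_smul' c φ := by funext t; simp; ring

theorem act_apply {k : ℕ} (g : G) (φ : (Fin k → X) → ℂ) (t : Fin k → X) :
    act χ g φ t = sg χ g * φ (g⁻¹ • t) := rfl

theorem act_one {k : ℕ} (φ : (Fin k → X) → ℂ) : act χ (1 : G) φ = φ := by
  funext t; simp [act_apply, sg_one]

theorem act_mul {k : ℕ} (g h : G) (φ : (Fin k → X) → ℂ) :
    act χ (g * h) φ = act χ g (act χ h φ) := by
  funext t; simp [act_apply, sg_mul, mul_smul, mul_assoc]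

theorem act_mem (hC : CellSys (G := G) Cell) {k : ℕ} (g : G) {φ : (Fin k → X) → ℂ}
    (h : φ ∈ DD Cell k) : act χ g φ ∈ DD Cell k := by
  refine ⟨fun t π => ?_, fun t ht => ?_⟩
  · have := DD.alt h (g⁻¹ • t) π
    simp only [act_apply]
    rw [show g⁻¹ • (t ∘ π) = (g⁻¹ • t) ∘ π from rfl, this]; ring
  · have h1 : φ (g⁻¹ • t) ≠ 0 := fun h0 => ht (by simp [act_apply, h0])
    have := DD.cell h h1
    rwa [range_smul', hC.iff] at this

theorem bd_act (hC : CellSys (G := G) Cell) {k : ℕ} (g : G) (φ : (Fin (k+1) → X) → ℂ) :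
    bd Cell (act χ g φ) = act χ g (bd Cell φ) := by
  funext t
  by_cases ht : Cell (Set.range t)
  · have ht' : Cell (Set.range (g⁻¹ • t)) := by rwa [range_smul', hC.iff]
    rw [act_apply, bd_of_cell ht, bd_of_cell ht']
    simp only [act_apply, smul_cons]
    rw [← mul_fs]
    congr 1
    exact finsum_comp_equiv (MulAction.toPerm g⁻¹) (f := fun s => φ (Fin.cons s (g⁻¹ • t)))
  · have ht' : ¬ Cell (Set.range (g⁻¹ • t)) := by rwa [range_smul', hC.iff]
    rw [act_apply, bd_of_not ht, bd_of_not ht', mul_zero]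

theorem coc_act (hC : CellSys (G := G) Cell) {k : ℕ} (g : G) {φ : (Fin k → X) → ℂ}
    (h : Polyh.Coc Cell k φ) : Polyh.Coc Cell k (act χ g φ) := by
  cases k with
  | zero => trivial
  | succ k =>
    change bd Cell φ = 0 at h
    change bd Cell _ = 0
    rw [bd_act χ hC, h, map_zero]

/-- the representation on cochains -/
def repD (hC : CellSys (G := G) Cell) (k : ℕ) : Representation ℂ G (DD Cell k) where
  toFun g := (act χ g).restrict (fun _ h => act_mem χ hC g h)
  map_one' := by ext φ; simp [act_one]
  map_mul' g h := by ext φ; simp [act_mul]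

/-- cocycles -/
def ZZ (hC : GoodCells Cell) (k : ℕ) : Submodule ℂ ((Fin k → X) → ℂ) where
  carrier := {φ | φ ∈ DD Cell k ∧ Polyh.Coc Cell k φ}
  zero_mem' := ⟨Submodule.zero_mem _, by
    cases k with
    | zero => trivial
    | succ k => exact bd_zero⟩
  add_mem' := by
    rintro a b ⟨ha, ha'⟩ ⟨hb, hb'⟩
    refine ⟨Submodule.add_mem _ ha hb, ?_⟩
    cases k with
    | zero => trivial
    | succ k =>
      change bd Cell a = 0 at ha'
      change bd Cell b = 0 at hb'
      change bd Cell _ = 0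
      rw [bd_add hC ha hb, ha', hb', add_zero]
  smul_mem' := by
    rintro c a ⟨ha, ha'⟩
    refine ⟨Submodule.smul_mem _ c ha, ?_⟩
    cases k with
    | zero => trivial
    | succ k =>
      change bd Cell a = 0 at ha'
      change bd Cell _ = 0
      rw [bd_smul, ha', smul_zero]

/-- the representation on cocycles -/
def repZ (hC : CellSys (G := G) Cell) (k : ℕ) : Representation ℂ G (ZZ hC.good k) where
  toFun g := (act χ g).restrict (fun _ h => ⟨act_mem χ hC g h.1, coc_act χ hC g h.2⟩)
  map_one' := by ext φ : 1; exact Subtype.ext (act_one χ φ.1)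
  map_mul' g h := by ext φ : 1; exact Subtype.ext (act_mul χ g h φ.1)

/-- orbit representative -/
noncomputable def orep (σ : Set X) : Set X :=
  (Quotient.mk (MulAction.orbitRel G (Set X)) σ).out

theorem orep_smul (g : G) (σ : Set X) : orep (G := G) (g • σ) = orep (G := G) σ := by
  unfold orep
  congr 1
  apply Quotient.sound
  exact ⟨g, rfl⟩

/-- elements moving a set to its orbit representative -/
def TT (σ : Set X) : Set G := {x | x • σ = orep (G := G) σ}

theorem TT_nonempty (σ : Set X) : (TT (G := G) σ).Nonempty := by
  obtain ⟨g, hg⟩ : (orep (G := G) σ) ∈ MulAction.orbit G σ :=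
    Quotient.exact (s := MulAction.orbitRel G (Set X)) (Quotient.out_eq _)
  exact ⟨g, hg⟩

theorem TT_finite (hC : CellSys (G := G) Cell) {σ : Set X} (h : Cell σ) : (TT (G := G) σ).Finite := by
  obtain ⟨x0, hx0⟩ := TT_nonempty (G := G) σ
  refine ((hC.stab σ h).image (fun y => x0 * y)).subset ?_
  intro x hx
  refine ⟨x0⁻¹ * x, ?_, by simp⟩
  change (x0⁻¹ * x) • σ = σ
  change x • σ = _ at hx
  change x0 • σ = _ at hx0
  rw [mul_smul, hx, ← hx0, inv_smul_smul]

theorem TT_bij (g : G) (σ : Set X) : Set.BijOn (fun x => x * g) (TT (G := G) σ) (TT (g⁻¹ • σ)) := by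
  refine ⟨fun x hx => ?_, fun x _ y _ h => mul_right_cancel h, fun y hy => ⟨y * g⁻¹, ?_, by simp⟩⟩
  · change (x * g) • g⁻¹ • σ = _
    rw [orep_smul, mul_smul, smul_inv_smul]; exact hx
  · change y • g⁻¹ • σ = _ at hy
    change (y * g⁻¹) • σ = _
    rw [orep_smul] at hy
    rw [mul_smul]; exact hy

open Classical in
/-- averaging -/
noncomputable def avg (Cell : Set X → Prop) {k : ℕ} (f : G → (Fin k → X) → ℂ) (t : Fin k → X) : ℂ :=
  if Cell (Set.range t) then ((TT (G := G) (Set.range t)).ncard : ℂ)⁻¹ *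
    ∑ᶠ x ∈ TT (G := G) (Set.range t), sg χ x * f x (x • t) else 0

theorem avg_mem {k : ℕ} (f : G → (Fin k → X) → ℂ) (hf : ∀ x, f x ∈ DD Cell k) :
    avg χ Cell f ∈ DD Cell k := by
  refine ⟨fun t π => ?_, fun t ht => ?_⟩
  · have hr : Set.range (t ∘ π) = Set.range t := by
      rw [Set.range_comp, π.surjective.range_eq, Set.image_univ]
    unfold avg
    rw [hr]
    split_ifs with hc
    · rw [mul_left_comm]
      congr 1
      rw [mul_fs_mem]
      apply finsum_mem_congr rfl
      intro x _
      rw [show x • (t ∘ π) = (x • t) ∘ π from rfl, DD.alt (hf x) (x • t) π]; ring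
    · simp
  · by_contra hc
    exact ht (by simp [avg, hc])

theorem acyc_D (hC : CellSys (G := G) Cell) (k : ℕ) : Acyc (Rep.of (repD χ hC k)) := by
  refine acyc_of_retract _
    { toFun := fun f => ⟨avg χ Cell (fun x => (f x).1), avg_mem χ _ fun x => (f x).2⟩
      map_add' := fun f h => Subtype.ext (funext fun t => ?_)
      map_smul' := fun c f => Subtype.ext (funext fun t => ?_) } ?_ ?_
  · change avg _ _ _ t = avg _ _ _ t + avg _ _ _ t
    unfold avg
    split_ifs with hc
    · rw [← mul_add, ← finsum_mem_add_distrib (TT_finite hC hc)]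
      congr 1
      apply finsum_mem_congr rfl
      intro x _
      simp [mul_add]
    · simp
  · change avg _ _ _ t = c * avg _ _ _ t
    unfold avg
    split_ifs with hc
    · rw [mul_left_comm]
      congr 1
      rw [mul_fs_mem]
      apply finsum_mem_congr rfl
      intro x _
      simp; ring
    · simp
  · intro a
    refine Subtype.ext (funext fun t => ?_)
    change avg χ Cell (fun x => act χ x a.1) t = a.1 t
    unfold avg
    split_ifs with hc
    · have hfin := TT_finite hC hc
      have : ∑ᶠ x ∈ TT (G := G) (Set.range t), sg χ x * act χ x a.1 (x • t) =
          ∑ᶠ x ∈ TT (G := G) (Set.range t), a.1 t := by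
        apply finsum_mem_congr rfl
        intro x _
        rw [act_apply, inv_smul_smul, ← mul_assoc, sg_self, one_mul]
      rw [this, finsum_mem_eq_finite_toFinset_sum _ hfin, Finset.sum_const, nsmul_eq_mul,
        ← Set.ncard_eq_toFinset_card _ hfin, ← mul_assoc, inv_mul_cancel₀, one_mul]
      rw [Nat.cast_ne_zero]
      exact (Set.ncard_pos hfin).2 (TT_nonempty _) |>.ne'
    · by_contra h0
      exact hc (DD.cell a.2 (Ne.symm h0))
  · intro g f
    refine Subtype.ext (funext fun t => ?_)
    change avg χ Cell (fun x => (f (x * g)).1) t = act χ g (avg χ Cell fun x => (f x).1) t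
    rw [act_apply]
    unfold avg
    rw [range_smul', hC.iff]
    split_ifs with hc
    · rw [mul_left_comm]
      congr 1
      · rw [← (TT_bij g (Set.range t)).image_eq, Set.ncard_image_of_injOn (TT_bij g _).injOn]
      · rw [mul_fs_mem]
        apply finsum_mem_eq_of_bijOn _ (TT_bij g (Set.range t))
        intro x _
        change _ = sg χ g * (sg χ (x * g) * (f (x * g)).1 ((x * g) • g⁻¹ • t))
        rw [mul_smul, smul_inv_smul, sg_mul]
        linear_combination (- sg χ x * (f (x * g)).1 (x • t)) * sg_self χ g
    · simp

/-- invariant functions -/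
def IsInv {k : ℕ} (φ : (Fin k → X) → ℂ) : Prop := ∀ g : G, ∀ t, φ (g • t) = sg χ g * φ t

theorem inv_iff_act {k : ℕ} (φ : (Fin k → X) → ℂ) : IsInv χ φ ↔ ∀ g : G, act χ g φ = φ := by
  constructor
  · intro h g; funext t
    rw [act_apply, h, sg_inv, ← mul_assoc, sg_self, one_mul]
  · intro h g t
    conv_lhs => rw [← h g]
    rw [act_apply, inv_smul_smul]

theorem acyc_Z (hC : CellSys (G := G) Cell) (d : ℕ)
    (hex : ∀ k < d, ∀ φ ∈ DD Cell k, Polyh.Coc Cell k φ → ∃ ψ ∈ DD Cell (k+1), bd Cell ψ = φ)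
    (hin : ∀ k < d, ∀ φ ∈ DD Cell k, Polyh.Coc Cell k φ → IsInv χ φ →
      ∃ ψ ∈ DD Cell (k+1), IsInv χ ψ ∧ bd Cell ψ = φ) :
    ∀ k ≤ d, Acyc (Rep.of (repZ χ hC k)) := by
  intro k
  induction k with
  | zero =>
    intro _
    refine acyc_of_equiv (repD χ hC 0) _ (LinearEquiv.ofEq _ _ ?_) ?_ (acyc_D χ hC 0)
    · ext φ; exact ⟨fun h => ⟨h, trivial⟩, fun h => h.1⟩
    · intro g v; rfl
  | succ k ih =>
    intro hk
    have hcoc : ∀ ψ ∈ DD Cell (k+1), Polyh.Coc Cell k (bd Cell ψ) := by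
      intro ψ hψ
      cases k with
      | zero => trivial
      | succ k => exact bd_bd hC.good hψ
    refine acyc_shift (repZ χ hC (k+1)) (repD χ hC (k+1)) (repZ χ hC k)
      (Submodule.inclusion (fun φ h => h.1))
      { toFun := fun ψ => ⟨bd Cell ψ.1, bd_mem ψ.2, hcoc ψ.1 ψ.2⟩
        map_add' := fun a b => Subtype.ext (bd_add hC.good a.2 b.2)
        map_smul' := fun c a => Subtype.ext (bd_smul c) } ?_ ?_ ?_ ?_ ?_ ?_
      (acyc_D χ hC (k+1)) (ih (by omega)) ?_
    · intro g v; rfl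
    · intro g v; exact Subtype.ext (bd_act χ hC g v.1)
    · exact Submodule.inclusion_injective _
    · rintro ⟨φ, h1, h2⟩
      obtain ⟨ψ, hψ, h3⟩ := hex k (by omega) φ h1 h2
      exact ⟨⟨ψ, hψ⟩, Subtype.ext h3⟩
    · rintro ⟨φ, h1, h2⟩
      exact Subtype.ext h2
    · rintro ⟨φ, h1⟩ h2
      exact ⟨⟨φ, h1, congrArg Subtype.val h2⟩, rfl⟩
    · rintro ⟨φ, h1, h2⟩ h3
      obtain ⟨ψ, hψ, h4, h5⟩ := hin k (by omega) φ h1 h2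
        ((inv_iff_act χ φ).2 fun g => congrArg Subtype.val (h3 g))
      exact ⟨⟨ψ, hψ⟩, fun g => Subtype.ext ((inv_iff_act χ ψ).1 h4 g), Subtype.ext h5⟩

theorem acyc_trivial (hC : CellSys (G := G) Cell) (d : ℕ)
    (hex : ∀ k < d, ∀ φ ∈ DD Cell k, Polyh.Coc Cell k φ → ∃ ψ ∈ DD Cell (k+1), bd Cell ψ = φ)
    (hin : ∀ k < d, ∀ φ ∈ DD Cell k, Polyh.Coc Cell k φ → IsInv χ φ →
      ∃ ψ ∈ DD Cell (k+1), IsInv χ ψ ∧ bd Cell ψ = φ)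
    (ω : (Fin d → X) → ℂ) (hω : ω ∈ DD Cell d) (hω1 : Polyh.Coc Cell d ω) (hω2 : IsInv χ ω)
    (hω3 : ω ≠ 0) (htop : ∀ φ ∈ DD Cell d, Polyh.Coc Cell d φ → ∃ c : ℂ, φ = c • ω) :
    Acyc (Rep.trivial ℂ G ℂ) := by
  let w : ZZ hC.good d := ⟨ω, hω, hω1⟩
  have hw : w ≠ 0 := fun h => hω3 (congrArg Subtype.val h)
  let e : ℂ ≃ₗ[ℂ] ZZ hC.good d := LinearEquiv.ofBijective (LinearMap.toSpanSingleton ℂ _ w)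
    ⟨by
      intro a b h
      simp only [LinearMap.toSpanSingleton_apply] at h
      exact smul_left_injective ℂ hw h, by
      rintro ⟨φ, h1, h2⟩
      obtain ⟨c, hc⟩ := htop φ h1 h2
      exact ⟨c, Subtype.ext hc.symm⟩⟩
  refine acyc_of_equiv (repZ χ hC d) (Representation.trivial ℂ G ℂ) e.symm ?_
    (acyc_Z χ hC d hex hin d le_rfl)
  intro g v
  rw [LinearEquiv.symm_apply_eq]
  obtain ⟨c, rfl⟩ := e.surjective v
  simp only [LinearEquiv.symm_apply_apply, Representation.trivial_apply]
  change repZ χ hC d g (c • w) = c • w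
  rw [map_smul]
  congr 1
  exact Subtype.ext ((inv_iff_act χ ω).1 hω2 g)

end Chains

open Equiv

abbrev M4 := Matrix (Fin 4) (Fin 4) ℤ
abbrev G4 := Matrix.GeneralLinearGroup (Fin 4) ℤ

/-- constraints: integral symmetric matrices with the congruence action -/
structure X4 : Type where
  m : M4

theorem X4.ext' {a b : X4} (h : a.m = b.m) : a = b := by cases a; cases b; cases h; rfl
instance : DecidableEq X4 := fun a b => decidable_of_iff (a.m = b.m) ⟨X4.ext', fun h => by rw [h]⟩

instance : MulAction G4 X4 where
  smul g s := ⟨g.1 * s.m * g.1.transpose⟩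
  one_smul s := by
    apply X4.ext'
    change (1 : G4).1 * s.m * (1 : G4).1.transpose = s.m
    simp
  mul_smul g h s := by
    apply X4.ext'
    change (g * h : G4).1 * s.m * (g * h : G4).1.transpose =
      g.1 * (h.1 * s.m * h.1.transpose) * g.1.transpose
    simp [Matrix.mul_assoc]

theorem smul_m (g : G4) (s : X4) : (g • s).m = g.1 * s.m * g.1.transpose := rfl

/-- action on forms -/
def fa (g : G4) (P : M4) : M4 := (g⁻¹).1.transpose * P * (g⁻¹).1

theorem fa_one (P : M4) : fa 1 P = P := by simp [fa]
theorem fa_mul (g h : G4) (P : M4) : fa (g * h) P = fa g (fa h P) := by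
  simp only [fa, mul_inv_rev, Units.val_mul, Matrix.transpose_mul, Matrix.mul_assoc]

/-- the pairing -/
def pr (s : X4) (P : M4) : ℤ := ∑ i, ∑ j, s.m i j * P j i
theorem pr_eq (s : X4) (P : M4) : pr s P = Matrix.trace (s.m * P) := by
  simp [pr, Matrix.trace, Matrix.mul_apply]

theorem inv_mul4 (g : G4) : (g⁻¹).1 * g.1 = 1 := by rw [← Units.val_mul]; simp
theorem mul_inv4 (g : G4) : g.1 * (g⁻¹).1 = 1 := by rw [← Units.val_mul]; simp
theorem inv_mul4t (g : G4) : (g⁻¹).1.transpose * g.1.transpose = 1 := by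
  rw [← Matrix.transpose_mul, mul_inv4, Matrix.transpose_one]
theorem mul_inv4t (g : G4) : g.1.transpose * (g⁻¹).1.transpose = 1 := by
  rw [← Matrix.transpose_mul, inv_mul4, Matrix.transpose_one]

theorem pr_smul' (g : G4) (s : X4) (P : M4) :
    pr (g • s) P = pr s (g.1.transpose * P * g.1) := by
  rw [pr_eq, pr_eq, smul_m]
  calc Matrix.trace (g.1 * s.m * g.1.transpose * P)
      = Matrix.trace (g.1 * (s.m * g.1.transpose * P)) := by simp only [Matrix.mul_assoc]
    _ = Matrix.trace ((s.m * g.1.transpose * P) * g.1) := Matrix.trace_mul_comm _ _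
    _ = _ := by simp only [Matrix.mul_assoc]

theorem pr_smul (g : G4) (s : X4) (P : M4) : pr (g • s) (fa g P) = pr s P := by
  rw [pr_smul', fa]
  congr 1
  calc g.1.transpose * ((g⁻¹).1.transpose * P * (g⁻¹).1) * g.1
      = (g.1.transpose * (g⁻¹).1.transpose) * P * ((g⁻¹).1 * g.1) := by simp only [Matrix.mul_assoc]
    _ = P := by rw [mul_inv4t, inv_mul4]; simp

/-- rank one constraints -/
def ou (v : Fin 4 → ℤ) : X4 := ⟨fun i j => 17 * v i * v j⟩

theorem ou_m (v : Fin 4 → ℤ) (i j : Fin 4) : (ou v).m i j = 17 * v i * v j := rfl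

theorem ou_smul (g : G4) (v : Fin 4 → ℤ) : g • ou v = ou (g.1.mulVec v) := by
  apply X4.ext'
  rw [smul_m]
  funext i j
  simp [ou_m, Matrix.mul_apply, Matrix.mulVec, dotProduct, Fin.sum_univ_four]
  ring

/-- value of a quadratic form -/
def qf (P : M4) (v : Fin 4 → ℤ) : ℤ := ∑ i, ∑ j, v i * v j * P j i
theorem pr_ou (v : Fin 4 → ℤ) (P : M4) : pr (ou v) P = 17 * qf P v := by
  simp only [pr, ou, qf, Finset.mul_sum]
  exact Finset.sum_congr rfl fun i _ => Finset.sum_congr rfl fun j _ => by ring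

def D4 : M4 := ![![2, 0, -1, 0], ![0, 2, -1, 0], ![-1, -1, 2, -1], ![0, 0, -1, 2]]
def A4 : M4 := ![![2, 1, 1, 1], ![1, 2, 1, 1], ![1, 1, 2, 1], ![1, 1, 1, 2]]
def C4 : M4 := ![![2, 1, 2, 1], ![1, 2, 2, 1], ![2, 2, 4, 2], ![1, 1, 2, 2]]
def Na : M4 := ![![2, 1, -2, 0], ![1, 2, -2, 0], ![-2, -2, 4, -2], ![0, 0, -2, 4]]
def Nb : M4 := ![![2, 0, -2, 1], ![0, 2, -1, 0], ![-2, -1, 4, -3], ![1, 0, -3, 4]]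
def base : Fin 3 → M4 := ![fun i j => 4 * A4 i j, fun i j => 3 * D4 i j + Na i j, fun i j => 3 * D4 i j + Nb i j]
def vec : Fin 3 → Fin 10 → Fin 4 → ℤ :=
  ![![![1, -1, 0, 0], ![1, 0, -1, 0], ![1, 0, 0, -1], ![1, 0, 0, 0], ![0, 1, -1, 0], ![0, 1, 0, -1], ![0, 1, 0, 0], ![0, 0, 1, -1], ![0, 0, 1, 0], ![0, 0, 0, 1]],
  ![![0, 1, 0, 0], ![0, 1, 1, 0], ![0, 1, 1, 1], ![1, 0, 0, 0], ![1, 0, 1, 0], ![1, 0, 1, 1], ![1, 1, 1, 0], ![1, 1, 1, 1], ![1, 1, 2, 1], ![0, 0, 0, 0]],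
  ![![0, 0, 1, 1], ![0, 1, 0, 0], ![0, 1, 1, 1], ![1, 0, 0, 0], ![1, 0, 1, 0], ![1, 0, 1, 1], ![1, 1, 1, 0], ![1, 1, 1, 1], ![1, 1, 2, 1], ![0, 0, 0, 0]]]
def wty : Fin 3 → Fin 10 → Fin 3 :=
  ![![2, 2, 2, 2, 2, 2, 2, 2, 2, 2], ![2, 2, 2, 2, 2, 2, 2, 2, 2, 1], ![1, 1, 1, 2, 2, 2, 2, 2, 2, 0]]
def wg : Fin 3 → Fin 10 → M4 :=
  ![![![![0, 0, -1, 1], ![1, 0, -1, 1], ![0, -1, 1, -1], ![0, 1, 0, -1]],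
    ![![0, 0, -1, 1], ![0, -1, 1, -1], ![1, 0, -1, 1], ![0, 1, 0, -1]],
    ![![0, 0, -1, 1], ![0, -1, 1, -1], ![0, 1, 0, -1], ![1, 0, -1, 1]],
    ![![-1, 0, 1, -1], ![1, 0, -1, 0], ![0, -1, 0, 1], ![0, 1, -1, 1]],
    ![![0, -1, 1, -1], ![0, 0, -1, 1], ![1, 0, -1, 1], ![0, 1, 0, -1]],
    ![![0, -1, 1, -1], ![0, 0, -1, 1], ![0, 1, 0, -1], ![1, 0, -1, 1]],
    ![![1, 0, -1, 0], ![-1, 0, 1, -1], ![0, -1, 0, 1], ![0, 1, -1, 1]],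
    ![![1, 0, -1, 0], ![0, -1, 0, 1], ![-1, 0, 1, -1], ![0, 0, 1, -1]],
    ![![1, 0, -1, 0], ![0, -1, 0, 1], ![-1, 0, 1, -1], ![0, 1, -1, 1]],
    ![![1, 0, -1, 0], ![0, -1, 0, 1], ![0, 1, -1, 1], ![-1, 0, 1, -1]]],
  ![![![-1, 0, 0, 0], ![-1, 0, 0, 1], ![-2, 0, 1, 0], ![-1, 1, 0, 0]],
    ![![-1, 0, 0, 0], ![-1, -1, 1, 0], ![-2, 0, 1, 0], ![-1, 0, 0, 1]],
    ![![-1, 0, 0, 0], ![-1, -1, 1, 0], ![-2, 0, 1, 0], ![-1, 0, 1, -1]],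
    ![![0, -1, 0, 0], ![-1, 0, 0, 0], ![-1, -1, 1, -1], ![-1, -1, 1, 0]],
    ![![0, 0, 0, -1], ![-1, 0, 0, 0], ![-1, 1, 0, -1], ![0, 1, -1, 0]],
    ![![0, 0, 0, -1], ![-1, 0, 0, 0], ![-1, 1, 0, -1], ![-1, 0, 1, -1]],
    ![![0, -1, 0, 0], ![1, -1, 0, 0], ![0, -2, 1, 0], ![0, -1, 1, -1]],
    ![![0, -1, 0, 0], ![1, -1, 0, 0], ![0, -2, 1, 0], ![0, -1, 0, 1]],
    ![![0, 0, 0, -1], ![1, 0, 0, -1], ![0, 0, 1, -2], ![0, 1, 0, -1]],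
    ![![1, 1, -1, -1], ![0, 0, 1, -2], ![1, 1, 0, -2], ![1, 0, 0, -1]]],
  ![![![-1, 0, 0, 0], ![-1, 1, 0, 0], ![-2, 0, 1, 0], ![-1, 0, 0, 1]],
    ![![-1, 0, 0, 0], ![-1, 0, 1, -1], ![-2, 0, 1, 0], ![-1, 1, 0, 0]],
    ![![0, -1, 0, 0], ![-1, -1, 1, 0], ![0, -2, 1, 0], ![0, -1, 0, 1]],
    ![![0, -1, 0, 0], ![0, 0, 0, -1], ![-1, -1, 1, -1], ![-1, 0, 0, 0]],
    ![![0, 0, 0, -1], ![-1, 0, 0, 0], ![-1, 1, 0, -1], ![0, 1, -1, 0]],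
    ![![0, -1, 0, 0], ![-1, -1, 1, 0], ![0, -2, 1, 0], ![0, -1, 0, 1]],
    ![![1, -1, 0, 0], ![0, -1, 0, 1], ![1, -1, 0, 1], ![0, -1, 1, 0]],
    ![![0, -1, 0, 0], ![1, -1, 0, 0], ![0, -2, 1, 0], ![0, -1, 0, 1]],
    ![![0, 0, 0, -1], ![0, -1, 1, -1], ![0, 0, 1, -2], ![1, 0, 0, -1]],
    ![![-1, 0, 1, 0], ![0, 0, 1, 1], ![0, 1, 2, 1], ![0, 1, 1, 1]]]]
def wh : Fin 3 → Fin 10 → M4 :=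
  ![![![![-1, 1, 0, 0], ![-1, 0, -1, 0], ![-2, 0, -1, -1], ![-1, 0, -1, -1]],
    ![![-1, 0, 1, 0], ![-1, -1, 0, 0], ![-2, -1, 0, -1], ![-1, -1, 0, -1]],
    ![![-1, 0, 0, 1], ![-1, -1, 0, 0], ![-2, -1, -1, 0], ![-1, -1, -1, 0]],
    ![![-2, -1, -1, -1], ![-1, -1, -1, 0], ![-2, -2, -1, -1], ![-1, -1, 0, 0]],
    ![![0, -1, 1, 0], ![-1, -1, 0, 0], ![-1, -2, 0, -1], ![-1, -1, 0, -1]],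
    ![![0, -1, 0, 1], ![-1, -1, 0, 0], ![-1, -2, -1, 0], ![-1, -1, -1, 0]],
    ![![-1, -2, -1, -1], ![-1, -1, -1, 0], ![-2, -2, -1, -1], ![-1, -1, 0, 0]],
    ![![0, 0, -1, 1], ![-1, -1, -1, 0], ![-1, 0, -1, 1], ![-1, 0, -1, 0]],
    ![![-1, -1, -2, -1], ![-1, -1, -1, 0], ![-2, -1, -2, -1], ![-1, 0, -1, 0]],
    ![![-1, -1, -1, -2], ![-1, -1, 0, -1], ![-2, -1, -1, -2], ![-1, 0, 0, -1]]],
  ![![![-1, 0, 0, 0], ![-1, 0, 0, 1], ![-2, 0, 1, 0], ![-1, 1, 0, 0]],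
    ![![-1, 0, 0, 0], ![-1, -1, 1, 0], ![-2, 0, 1, 0], ![-1, 0, 0, 1]],
    ![![-1, 0, 0, 0], ![-1, -1, 1, 0], ![-2, 0, 1, 0], ![-1, 0, 1, -1]],
    ![![0, -1, 0, 0], ![-1, 0, 0, 0], ![-1, -1, 0, 1], ![0, 0, -1, 1]],
    ![![0, -1, 0, 0], ![-1, -1, 1, 0], ![-1, -1, 1, -1], ![-1, 0, 0, 0]],
    ![![0, -1, 0, 0], ![-1, -1, 1, 0], ![-1, -1, 0, 1], ![-1, 0, 0, 0]],
    ![![-1, 1, 0, 0], ![-1, 0, 0, 0], ![-2, 0, 1, 0], ![-1, 0, 1, -1]],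
    ![![-1, 1, 0, 0], ![-1, 0, 0, 0], ![-2, 0, 1, 0], ![-1, 0, 0, 1]],
    ![![-1, 1, 0, 0], ![-1, 0, 0, 1], ![-2, 0, 1, 0], ![-1, 0, 0, 0]],
    ![![-1, -1, 1, 1], ![-1, -1, 2, -1], ![-2, -1, 2, 0], ![-1, -1, 1, 0]]],
  ![![![-1, 0, 0, 0], ![-1, 1, 0, 0], ![-2, 0, 1, 0], ![-1, 0, 0, 1]],
    ![![-1, 0, 0, 0], ![-1, 0, 0, 1], ![-2, 0, 1, 0], ![-1, -1, 1, 0]],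
    ![![-1, -1, 1, 0], ![-1, 0, 0, 0], ![-2, 0, 1, 0], ![-1, 0, 0, 1]],
    ![![0, 0, 0, -1], ![-1, 0, 0, 0], ![-1, -1, 1, -1], ![0, -1, 0, 0]],
    ![![0, -1, 0, 0], ![-1, -1, 1, 0], ![-1, -1, 1, -1], ![-1, 0, 0, 0]],
    ![![-1, -1, 1, 0], ![-1, 0, 0, 0], ![-2, 0, 1, 0], ![-1, 0, 0, 1]],
    ![![0, -1, 1, 0], ![-1, -1, 1, 0], ![-1, -1, 1, 1], ![-1, 0, 1, 0]],
    ![![-1, 1, 0, 0], ![-1, 0, 0, 0], ![-2, 0, 1, 0], ![-1, 0, 0, 1]],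
    ![![-1, 0, 0, 1], ![-1, -1, 1, 0], ![-2, 0, 1, 0], ![-1, 0, 0, 0]],
    ![![-1, 0, 1, -1], ![0, -1, 0, 1], ![0, 0, 1, -1], ![0, 1, -1, 1]]]]
def c0 : X4 := ⟨fun i j => 4 * C4 i j⟩
def sv (τ : Fin 3) (i : Fin 10) : X4 := if τ ≠ 0 ∧ i = 9 then c0 else ou (vec τ i)

def IsV (s : X4) : Prop := ∃ v : Fin 4 → ℤ, v ≠ 0 ∧ s = ou v
def IsC (s : X4) : Prop := ∃ g : G4, s = g • c0
def IsVx (P : M4) : Prop := ∃ (g : G4) (τ : Fin 3), P = fa g (base τ)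

theorem wgh : ∀ τ i, wg τ i * wh τ i = 1 ∧ wh τ i * wg τ i = 1 := by decide +kernel
def wG (τ : Fin 3) (i : Fin 10) : G4 := ⟨wg τ i, wh τ i, (wgh τ i).1, (wgh τ i).2⟩
theorem wpr : ∀ τ i j, (j ≠ i → pr (sv τ j) ((wh τ i).transpose * base (wty τ i) * wh τ i) = 136) ∧
    (j = i → 136 < pr (sv τ j) ((wh τ i).transpose * base (wty τ i) * wh τ i)) := by decide +kernel
theorem wprs : ∀ τ j, pr (sv τ j) (base τ) = 136 := by decide +kernel
theorem sv_inj : ∀ τ, Function.Injective (sv τ) := by unfold Function.Injective; decide +kernel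
theorem vec_ne : ∀ τ j, ¬ (τ ≠ 0 ∧ j = 9) → vec τ j ≠ 0 := by decide +kernel

open Equiv

/-- even positive definite forms -/
structure EP (Q : M4) : Prop where
  sym : ∀ i j, Q i j = Q j i
  even : ∀ i, 2 ∣ Q i i
  pos : ∀ v : Fin 4 → ℤ, v ≠ 0 → 0 < qf Q v

theorem EP.dvd {Q : M4} (h : EP Q) (v : Fin 4 → ℤ) : 2 ∣ qf Q v := by
    simp only [qf, Fin.sum_univ_four]
    rw [h.sym 1 0, h.sym 2 0, h.sym 3 0, h.sym 2 1, h.sym 3 1, h.sym 3 2]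
    obtain ⟨a, ha⟩ := h.even 0
    obtain ⟨b, hb⟩ := h.even 1
    obtain ⟨c, hc⟩ := h.even 2
    obtain ⟨d, hd⟩ := h.even 3
    rw [ha, hb, hc, hd]
    refine ⟨v 0 * v 0 * a + v 1 * v 1 * b + v 2 * v 2 * c + v 3 * v 3 * d + v 0 * v 1 * Q 0 1
      + v 0 * v 2 * Q 0 2 + v 0 * v 3 * Q 0 3 + v 1 * v 2 * Q 1 2 + v 1 * v 3 * Q 1 3
      + v 2 * v 3 * Q 2 3, by ring⟩

theorem EP.two {Q : M4} (h : EP Q) {v : Fin 4 → ℤ} (hv : v ≠ 0) : 2 ≤ qf Q v := by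
  have h1 := h.pos v hv
  have h2 := h.dvd v
  omega

theorem vec4_ne {v : Fin 4 → ℤ} (h : v 3 = 0 → v 2 = 0 → v 1 = 0 → v 0 = 0 → False) : v ≠ 0 := by
  rintro rfl; exact h rfl rfl rfl rfl

theorem vec4_eq {v : Fin 4 → ℤ} (h0 : v 0 = 0) (h1 : v 1 = 0) (h2 : v 2 = 0) (h3 : v 3 = 0) : v = 0 := by
  funext i; fin_cases i <;> assumption

theorem pos_of_ldl {q a b c d e f k x0 x1 x2 x3 : ℤ} {k1 k2 k3 k4 m0 m1 m2 : ℤ} (hk : 0 < k)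
    (h1 : 0 < k1) (h2 : 0 < k2) (h3 : 0 < k3) (h4 : 0 < k4) (hm0 : m0 ≠ 0) (hm1 : m1 ≠ 0) (hm2 : m2 ≠ 0)
    (hid : k * q = k1 * (m0 * x0 + a * x1 + b * x2 + c * x3)^2 + k2 * (m1 * x1 + d * x2 + e * x3)^2
      + k3 * (m2 * x2 + f * x3)^2 + k4 * x3^2)
    (hn : ¬ (x0 = 0 ∧ x1 = 0 ∧ x2 = 0 ∧ x3 = 0)) : 0 < q := by
  by_contra hq
  have hq' : k * q ≤ 0 := mul_nonpos_of_nonneg_of_nonpos hk.le (not_lt.mp hq)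
  have p1 : 0 ≤ k1 * (m0 * x0 + a * x1 + b * x2 + c * x3)^2 := by positivity
  have p2 : 0 ≤ k2 * (m1 * x1 + d * x2 + e * x3)^2 := by positivity
  have p3 : 0 ≤ k3 * (m2 * x2 + f * x3)^2 := by positivity
  have p4 : 0 ≤ k4 * x3^2 := by positivity
  have e4 : k4 * x3^2 = 0 := by linarith
  have e3 : k3 * (m2 * x2 + f * x3)^2 = 0 := by linarith
  have e2 : k2 * (m1 * x1 + d * x2 + e * x3)^2 = 0 := by linarith
  have e1 : k1 * (m0 * x0 + a * x1 + b * x2 + c * x3)^2 = 0 := by linarith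
  have z3 : x3 = 0 := by simpa [h4.ne'] using e4
  subst z3
  have z2 : x2 = 0 := by simpa [h3.ne', hm2] using e3
  subst z2
  have z1 : x1 = 0 := by simpa [h2.ne', hm1] using e2
  subst z1
  have z0 : x0 = 0 := by simpa [h1.ne', hm0] using e1
  exact hn ⟨z0, rfl, rfl, rfl⟩

theorem ne_vec4 {v : Fin 4 → ℤ} (h : v ≠ 0) : ¬ (v 0 = 0 ∧ v 1 = 0 ∧ v 2 = 0 ∧ v 3 = 0) :=
  fun ⟨a, b, c, d⟩ => h (vec4_eq a b c d)

theorem qf_D4 (v : Fin 4 → ℤ) : qf D4 v = 2 * v 0^2 + 2 * v 1^2 + 2 * v 2^2 + 2 * v 3^2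
    - 2 * v 2 * (v 0 + v 1 + v 3) := by
  simp [qf, Fin.sum_univ_four, D4]; ring
theorem qf_A4 (v : Fin 4 → ℤ) : qf A4 v = v 0^2 + v 1^2 + v 2^2 + v 3^2 + (v 0 + v 1 + v 2 + v 3)^2 := by
  simp [qf, Fin.sum_univ_four, A4]; ring
theorem qf_Na (v : Fin 4 → ℤ) : qf Na v = 2 * v 0^2 + 2 * v 1^2 + 4 * v 2^2 + 4 * v 3^2
    + 2 * v 0 * v 1 - 4 * v 2 * (v 0 + v 1 + v 3) := by
  simp [qf, Fin.sum_univ_four, Na]; ring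
theorem qf_Nb (v : Fin 4 → ℤ) : qf Nb v = 2 * v 0^2 + 2 * v 1^2 + 4 * v 2^2 + 4 * v 3^2
    - 4 * v 0 * v 2 + 2 * v 0 * v 3 - 2 * v 1 * v 2 - 6 * v 2 * v 3 := by
  simp [qf, Fin.sum_univ_four, Nb]; ring

theorem epD4 : EP D4 where
  sym := by intro i j; fin_cases i <;> fin_cases j <;> rfl
  even := by decide +kernel
  pos v hv := by
    refine pos_of_ldl (k := 2) (k1 := 1) (k2 := 1) (k3 := 2) (k4 := 2) (m0 := 2) (m1 := 2) (m2 := 1)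
      (a := 0) (b := -1) (c := 0) (d := -1) (e := 0) (f := -1) (by norm_num) (by norm_num) (by norm_num) (by norm_num) (by norm_num)
      (by norm_num) (by norm_num) (by norm_num) ?_ (ne_vec4 hv)
    rw [qf_D4]; ring

theorem epA4 : EP A4 where
  sym := by intro i j; fin_cases i <;> fin_cases j <;> rfl
  even := by decide +kernel
  pos v hv := by
    refine pos_of_ldl (k := 12) (k1 := 6) (k2 := 2) (k3 := 1) (k4 := 15) (m0 := 2) (m1 := 3) (m2 := 4)
      (a := 1) (b := 1) (c := 1) (d := 1) (e := 1) (f := 1) (by norm_num) (by norm_num) (by norm_num) (by norm_num) (by norm_num)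
      (by norm_num) (by norm_num) (by norm_num) ?_ (ne_vec4 hv)
    rw [qf_A4]; ring

theorem epNa : EP Na where
  sym := by intro i j; fin_cases i <;> fin_cases j <;> rfl
  even := by decide +kernel
  pos v hv := by
    refine pos_of_ldl (k := 6) (k1 := 3) (k2 := 1) (k3 := 2) (k4 := 6) (m0 := 2) (m1 := 3) (m2 := 2)
      (a := 1) (b := -2) (c := 0) (d := -2) (e := 0) (f := -3) (by norm_num) (by norm_num) (by norm_num) (by norm_num) (by norm_num)
      (by norm_num) (by norm_num) (by norm_num) ?_ (ne_vec4 hv)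
    rw [qf_Na]; ring

theorem epNb : EP Nb where
  sym := by intro i j; fin_cases i <;> fin_cases j <;> rfl
  even := by decide +kernel
  pos v hv := by
    refine pos_of_ldl (k := 6) (k1 := 3) (k2 := 3) (k3 := 1) (k4 := 5) (m0 := 2) (m1 := 2) (m2 := 3)
      (a := 0) (b := -2) (c := 1) (d := -1) (e := 0) (f := -4) (by norm_num) (by norm_num) (by norm_num) (by norm_num) (by norm_num)
      (by norm_num) (by norm_num) (by norm_num) ?_ (ne_vec4 hv)
    rw [qf_Nb]; ring

theorem qf_conj (g : G4) (Q : M4) (v : Fin 4 → ℤ) :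
    qf (g.1.transpose * Q * g.1) v = qf Q (g.1.mulVec v) := by
  have h := pr_smul' g (ou v) Q
  rw [ou_smul, pr_ou, pr_ou] at h
  omega

theorem mulVec_ne (g : G4) {v : Fin 4 → ℤ} (hv : v ≠ 0) : g.1.mulVec v ≠ 0 := by
  intro h
  apply hv
  have := congrArg (g⁻¹).1.mulVec h
  rwa [Matrix.mulVec_mulVec, inv_mul4, Matrix.one_mulVec, Matrix.mulVec_zero] at this

theorem EP.conj {Q : M4} (h : EP Q) (g : G4) : EP (g.1.transpose * Q * g.1) where
  sym i j := by
    have hQ : Q.transpose = Q := by ext i j; exact h.sym j i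
    have : (g.1.transpose * Q * g.1).transpose = g.1.transpose * Q * g.1 := by
      simp [Matrix.transpose_mul, hQ, Matrix.mul_assoc]
    conv_lhs => rw [← this]
    rfl
  even i := by
    have : (g.1.transpose * Q * g.1) i i = qf (g.1.transpose * Q * g.1) (Pi.single i 1) := by
      generalize g.1.transpose * Q * g.1 = R
      simp [qf, Pi.single_apply]
    rw [this, qf_conj]
    exact h.dvd _
  pos v hv := by rw [qf_conj]; exact h.pos _ (mulVec_ne g hv)

theorem pr_c0 (R : M4) : pr c0 R = 4 * ∑ i, ∑ j, C4 i j * R j i := by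
  simp only [pr, c0, Finset.mul_sum]
  exact Finset.sum_congr rfl fun i _ => Finset.sum_congr rfl fun j _ => by ring

theorem frame1 {R : M4} (h : EP R) : pr c0 R =
    4 * (qf R ![0,0,0,1] + qf R ![0,1,0,0] + qf R ![1,0,0,0] + qf R ![1,1,2,1]) := by
  rw [pr_c0]
  simp [qf, Fin.sum_univ_four, C4]
  rw [h.sym 1 0, h.sym 2 0, h.sym 3 0, h.sym 2 1, h.sym 3 1, h.sym 3 2]; ring
theorem frame2 {R : M4} (h : EP R) : pr c0 R =
    4 * (qf R ![0,0,1,0] + qf R ![0,1,1,1] + qf R ![1,0,1,1] + qf R ![1,1,1,0]) := by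
  rw [pr_c0]
  simp [qf, Fin.sum_univ_four, C4]
  rw [h.sym 1 0, h.sym 2 0, h.sym 3 0, h.sym 2 1, h.sym 3 1, h.sym 3 2]; ring
theorem frame3 {R : M4} (h : EP R) : pr c0 R =
    4 * (qf R ![0,0,1,1] + qf R ![0,1,1,0] + qf R ![1,0,1,0] + qf R ![1,1,1,1]) := by
  rw [pr_c0]
  simp [qf, Fin.sum_univ_four, C4]
  rw [h.sym 1 0, h.sym 2 0, h.sym 3 0, h.sym 2 1, h.sym 3 1, h.sym 3 2]; ring

theorem pr_c0_ge {R : M4} (h : EP R) : 32 ≤ pr c0 R := by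
  rw [frame1 h]
  have h1 := h.two (v := ![0,0,0,1]) (by decide)
  have h2 := h.two (v := ![0,1,0,0]) (by decide)
  have h3 := h.two (v := ![1,0,0,0]) (by decide)
  have h4 := h.two (v := ![1,1,2,1]) (by decide)
  omega

theorem pr_c0_eq {R : M4} (h : EP R) (hlt : pr c0 R < 40) : R = D4 := by
  have f1 := frame1 h
  have f2 := frame2 h
  have f3 := frame3 h
  have a1 := h.two (v := ![0,0,0,1]) (by decide)
  have a2 := h.two (v := ![0,1,0,0]) (by decide)
  have a3 := h.two (v := ![1,0,0,0]) (by decide)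
  have a4 := h.two (v := ![1,1,2,1]) (by decide)
  have b1 := h.two (v := ![0,0,1,0]) (by decide)
  have b2 := h.two (v := ![0,1,1,1]) (by decide)
  have b3 := h.two (v := ![1,0,1,1]) (by decide)
  have b4 := h.two (v := ![1,1,1,0]) (by decide)
  have c1 := h.two (v := ![0,0,1,1]) (by decide)
  have c2 := h.two (v := ![0,1,1,0]) (by decide)
  have c3 := h.two (v := ![1,0,1,0]) (by decide)
  have c4 := h.two (v := ![1,1,1,1]) (by decide)
  have d1 := h.dvd ![0,0,0,1]
  have d2 := h.dvd ![0,1,0,0]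
  have d3 := h.dvd ![1,0,0,0]
  have d4 := h.dvd ![1,1,2,1]
  have e1 : qf R ![0,0,0,1] = 2 := by omega
  have e2 : qf R ![0,1,0,0] = 2 := by omega
  have e3 : qf R ![1,0,0,0] = 2 := by omega
  have e4 : qf R ![1,1,2,1] = 2 := by omega
  have e5 : qf R ![0,0,1,0] = 2 := by omega
  have e6 : qf R ![0,1,1,1] = 2 := by omega
  have e7 : qf R ![1,0,1,1] = 2 := by omega
  have e8 : qf R ![1,1,1,0] = 2 := by omega
  have e9 : qf R ![0,0,1,1] = 2 := by omega
  have e10 : qf R ![0,1,1,0] = 2 := by omega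
  have e11 : qf R ![1,0,1,0] = 2 := by omega
  clear a1 a2 a3 a4 b1 b2 b3 b4 c1 c2 c3 c4 d1 d2 d3 d4 f1 f2 f3
  simp [qf, Fin.sum_univ_four] at e1 e2 e3 e4 e5 e6 e7 e8 e9 e10 e11
  have s1 := h.sym 1 0
  have s2 := h.sym 2 0
  have s3 := h.sym 3 0
  have s4 := h.sym 2 1
  have s5 := h.sym 3 1
  have s6 := h.sym 3 2
  ext i j
  fin_cases i <;> fin_cases j <;> simp [D4] <;> omega

theorem D4C : D4 * C4 = 2 • (1 : M4) := by decide +kernel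
theorem CD4 : C4 * D4 = 2 • (1 : M4) := by decide +kernel

theorem D4_fix {g : G4} (h : g.1.transpose * D4 * g.1 = D4) : g • c0 = c0 := by
  have h1 : g.1.transpose * (D4 * (g.1 * C4 * g.1.transpose)) = g.1.transpose * (D4 * C4) := by
    calc g.1.transpose * (D4 * (g.1 * C4 * g.1.transpose))
        = (g.1.transpose * D4 * g.1) * C4 * g.1.transpose := by simp only [Matrix.mul_assoc]
      _ = _ := by rw [h, D4C, Matrix.smul_mul, Matrix.mul_smul, Matrix.one_mul, Matrix.mul_one]
  have h2 : D4 * (g.1 * C4 * g.1.transpose) = D4 * C4 := by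
    have := congrArg ((g⁻¹).1.transpose * ·) h1
    simpa only [← Matrix.mul_assoc, inv_mul4t, Matrix.one_mul] using this
  have h3 : 2 • (g.1 * C4 * g.1.transpose) = 2 • C4 := by
    have := congrArg (C4 * ·) h2
    simpa only [← Matrix.mul_assoc, CD4, Matrix.smul_mul, Matrix.one_mul] using this
  have h4 : g.1 * C4 * g.1.transpose = C4 := by
    ext i j
    have := congrFun (congrFun h3 i) j
    simpa using this
  have h5 : c0.m = 4 • C4 := by ext i j; simp [c0]
  apply X4.ext'
  rw [smul_m, h5, Matrix.mul_smul, Matrix.smul_mul, h4]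

theorem detA4 : A4.det = 5 := by decide +kernel
theorem detD4 : D4.det = 4 := by decide +kernel

theorem A4_ne (g : G4) : g.1.transpose * A4 * g.1 ≠ D4 := by
  intro h
  have := congrArg Matrix.det h
  rw [Matrix.det_mul, Matrix.det_mul, Matrix.det_transpose, detA4, detD4] at this
  have h2 : g.1.det * g.1.det * 5 = 4 := by rw [← this]; ring
  omega

theorem base0 : base 0 = (4 : ℤ) • A4 := by decide +kernel
theorem base1 : base 1 = (3 : ℤ) • D4 + Na := by decide +kernel
theorem base2 : base 2 = (3 : ℤ) • D4 + Nb := by decide +kernel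

theorem pr_add (s : X4) (P Q : M4) : pr s (P + Q) = pr s P + pr s Q := by
  simp [pr_eq, Matrix.mul_add]
theorem pr_zsmul (s : X4) (c : ℤ) (P : M4) : pr s (c • P) = c * pr s P := by
  rw [pr_eq, pr_eq, Matrix.mul_smul, Matrix.trace_smul, smul_eq_mul]

theorem box_of_le {v : Fin 4 → ℤ} (h : ∀ i, -2 ≤ v i ∧ v i ≤ 2) :
    ∃ w : Fin 4 → Fin 5, v = fun i => (w i : ℤ) - 2 := by
  refine ⟨fun i => ⟨(v i + 2).toNat, by have := h i; omega⟩, ?_⟩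
  funext i
  have := h i
  simp; omega

theorem D4_box {v : Fin 4 → ℤ} (h : qf D4 v = 2) : ∀ i, -2 ≤ v i ∧ v i ≤ 2 := by
  rw [qf_D4] at h
  have e : (2 * v 0 - v 2)^2 + (2 * v 1 - v 2)^2 + (2 * v 3 - v 2)^2 + (v 2)^2 = 4 := by linarith
  have h2 : -2 ≤ v 2 ∧ v 2 ≤ 2 := by
    constructor <;> nlinarith [sq_nonneg (2 * v 0 - v 2), sq_nonneg (2 * v 1 - v 2), sq_nonneg (2 * v 3 - v 2)]
  have h0 : -2 ≤ 2 * v 0 - v 2 ∧ 2 * v 0 - v 2 ≤ 2 := by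
    constructor <;> nlinarith [sq_nonneg (v 2), sq_nonneg (2 * v 1 - v 2), sq_nonneg (2 * v 3 - v 2)]
  have h1 : -2 ≤ 2 * v 1 - v 2 ∧ 2 * v 1 - v 2 ≤ 2 := by
    constructor <;> nlinarith [sq_nonneg (v 2), sq_nonneg (2 * v 0 - v 2), sq_nonneg (2 * v 3 - v 2)]
  have h3 : -2 ≤ 2 * v 3 - v 2 ∧ 2 * v 3 - v 2 ≤ 2 := by
    constructor <;> nlinarith [sq_nonneg (v 2), sq_nonneg (2 * v 0 - v 2), sq_nonneg (2 * v 1 - v 2)]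
  intro i
  fin_cases i <;> simp <;> omega

theorem A4_box {v : Fin 4 → ℤ} (h : qf A4 v = 2) : ∀ i, -2 ≤ v i ∧ v i ≤ 2 := by
  rw [qf_A4] at h
  intro i
  fin_cases i <;> simp <;> constructor <;> nlinarith [sq_nonneg (v 0), sq_nonneg (v 1), sq_nonneg (v 2), sq_nonneg (v 3), sq_nonneg (v 0 + v 1 + v 2 + v 3)]

theorem fin_D : ∀ w : Fin 4 → Fin 5, qf D4 (fun i => (w i : ℤ) - 2) = 2 →
    (qf Na (fun i => (w i : ℤ) - 2) = 2 → ∃ j, ou (fun i => (w i : ℤ) - 2) = sv 1 j) ∧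
    (qf Nb (fun i => (w i : ℤ) - 2) = 2 → ∃ j, ou (fun i => (w i : ℤ) - 2) = sv 2 j) := by
  decide +kernel
theorem fin_A : ∀ w : Fin 4 → Fin 5, qf A4 (fun i => (w i : ℤ) - 2) = 2 →
    ∃ j, ou (fun i => (w i : ℤ) - 2) = sv 0 j := by
  decide +kernel

theorem base_V (τ : Fin 3) {v : Fin 4 → ℤ} (hv : v ≠ 0) : 136 ≤ pr (ou v) (base τ) ∧
    (pr (ou v) (base τ) = 136 → ∃ j, ou v = sv τ j) := by
  have h1 := epD4.two hv
  have h2 := epA4.two hv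
  have h3 := epNa.two hv
  have h4 := epNb.two hv
  fin_cases τ
  · change 136 ≤ pr (ou v) (base 0) ∧ (pr (ou v) (base 0) = 136 → ∃ j, ou v = sv 0 j)
    rw [base0, pr_zsmul, pr_ou]
    refine ⟨by omega, fun h => ?_⟩
    have h5 : qf A4 v = 2 := by omega
    obtain ⟨w, rfl⟩ := box_of_le (A4_box h5)
    exact fin_A w h5
  · change 136 ≤ pr (ou v) (base 1) ∧ (pr (ou v) (base 1) = 136 → ∃ j, ou v = sv 1 j)
    rw [base1, pr_add, pr_zsmul, pr_ou, pr_ou]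
    refine ⟨by omega, fun h => ?_⟩
    have h5 : qf D4 v = 2 := by omega
    have h6 : qf Na v = 2 := by omega
    obtain ⟨w, rfl⟩ := box_of_le (D4_box h5)
    exact (fin_D w h5).1 h6
  · change 136 ≤ pr (ou v) (base 2) ∧ (pr (ou v) (base 2) = 136 → ∃ j, ou v = sv 2 j)
    rw [base2, pr_add, pr_zsmul, pr_ou, pr_ou]
    refine ⟨by omega, fun h => ?_⟩
    have h5 : qf D4 v = 2 := by omega
    have h6 : qf Nb v = 2 := by omega
    obtain ⟨w, rfl⟩ := box_of_le (D4_box h5)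
    exact (fin_D w h5).2 h6

theorem base_C (τ : Fin 3) (g : G4) : 136 ≤ pr (g • c0) (base τ) ∧
    (pr (g • c0) (base τ) = 136 → τ ≠ 0 ∧ g • c0 = c0) := by
  have h2 : 40 ≤ pr (g • c0) A4 := by
    rw [pr_smul']
    by_contra h
    exact A4_ne g (pr_c0_eq (epA4.conj g) (not_le.mp h))
  have h1 : pr (g • c0) D4 < 40 → g • c0 = c0 := by
    rw [pr_smul']
    exact fun h => D4_fix (pr_c0_eq (epD4.conj g) h)
  have h1' : 32 ≤ pr (g • c0) D4 := by rw [pr_smul']; exact pr_c0_ge (epD4.conj g)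
  have h3 : 32 ≤ pr (g • c0) Na := by rw [pr_smul']; exact pr_c0_ge (epNa.conj g)
  have h4 : 32 ≤ pr (g • c0) Nb := by rw [pr_smul']; exact pr_c0_ge (epNb.conj g)
  fin_cases τ
  · change 136 ≤ pr (g • c0) (base 0) ∧ (pr (g • c0) (base 0) = 136 → (0 : Fin 3) ≠ 0 ∧ g • c0 = c0)
    rw [base0, pr_zsmul]
    constructor
    · omega
    · intro h; omega
  · change 136 ≤ pr (g • c0) (base 1) ∧ (pr (g • c0) (base 1) = 136 → (1 : Fin 3) ≠ 0 ∧ g • c0 = c0)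
    by_cases h5 : pr (g • c0) D4 < 40
    · refine ⟨?_, fun _ => ⟨by decide, h1 h5⟩⟩
      rw [h1 h5]; decide +kernel
    · rw [base1, pr_add, pr_zsmul]
      constructor
      · omega
      · intro h; omega
  · change 136 ≤ pr (g • c0) (base 2) ∧ (pr (g • c0) (base 2) = 136 → (2 : Fin 3) ≠ 0 ∧ g • c0 = c0)
    by_cases h5 : pr (g • c0) D4 < 40
    · refine ⟨?_, fun _ => ⟨by decide, h1 h5⟩⟩
      rw [h1 h5]; decide +kernel
    · rw [base2, pr_add, pr_zsmul]
      constructor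
      · omega
      · intro h; omega

open Equiv
open Pointwise

def IsK (s : X4) : Prop := IsV s ∨ IsC s

theorem IsV.smul {s : X4} (h : IsV s) (g : G4) : IsV (g • s) := by
  obtain ⟨v, hv, rfl⟩ := h
  exact ⟨_, mulVec_ne g hv, ou_smul g v⟩
theorem IsC.smul {s : X4} (h : IsC s) (g : G4) : IsC (g • s) := by
  obtain ⟨h, rfl⟩ := h
  exact ⟨g * h, by rw [mul_smul]⟩
theorem IsK.smul {s : X4} (h : IsK s) (g : G4) : IsK (g • s) := h.imp (fun h => h.smul g) (fun h => h.smul g)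
theorem IsV.iff (g : G4) {s : X4} : IsV (g • s) ↔ IsV s :=
  ⟨fun h => by simpa using h.smul g⁻¹, fun h => h.smul g⟩
theorem IsC.iff (g : G4) {s : X4} : IsC (g • s) ↔ IsC s :=
  ⟨fun h => by simpa using h.smul g⁻¹, fun h => h.smul g⟩
theorem IsK.iff (g : G4) {s : X4} : IsK (g • s) ↔ IsK s := by
  rw [IsK, IsK, IsV.iff, IsC.iff]

theorem IsVx.fa {P : M4} (h : IsVx P) (g : G4) : IsVx (fa g P) := by
  obtain ⟨k, τ, rfl⟩ := h
  exact ⟨g * k, τ, by rw [fa_mul]⟩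

def Sset (P : M4) : Set X4 := {s | IsK s ∧ pr s P = 136}

theorem Sset_fa (g : G4) (P : M4) : Sset (fa g P) = g • Sset P := by
  ext s
  rw [Set.mem_smul_set_iff_inv_smul_mem]
  simp only [Sset, Set.mem_setOf_eq, IsK.iff]
  rw [← pr_smul g (g⁻¹ • s) P, smul_inv_smul]

theorem sv_K (τ : Fin 3) (j : Fin 10) : IsK (sv τ j) := by
  by_cases h : τ ≠ 0 ∧ j = 9
  · right; exact ⟨1, by simp [sv, h]⟩
  · left; exact ⟨vec τ j, vec_ne τ j h, by simp only [sv, if_neg h]⟩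

theorem base_K (τ : Fin 3) {s : X4} (h : IsK s) : 136 ≤ pr s (base τ) ∧
    (pr s (base τ) = 136 → ∃ j, s = sv τ j) := by
  rcases h with ⟨v, hv, rfl⟩ | ⟨g, rfl⟩
  · exact base_V τ hv
  · refine ⟨(base_C τ g).1, fun h => ⟨9, ?_⟩⟩
    obtain ⟨h1, h2⟩ := (base_C τ g).2 h
    rw [h2, sv, if_pos ⟨h1, rfl⟩]

theorem Sset_base (τ : Fin 3) : Sset (base τ) = Set.range (sv τ) := by
  ext s
  constructor
  · rintro ⟨h1, h2⟩
    obtain ⟨j, hj⟩ := (base_K τ h1).2 h2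
    exact ⟨j, hj.symm⟩
  · rintro ⟨j, rfl⟩
    exact ⟨sv_K τ j, wprs τ j⟩

theorem Vx_ge {P : M4} (hP : IsVx P) {s : X4} (h : IsK s) : 136 ≤ pr s P := by
  obtain ⟨g, τ, rfl⟩ := hP
  have := (base_K τ (h.smul g⁻¹)).1
  rwa [← pr_smul g, smul_inv_smul] at this

theorem Sset_finite {P : M4} (hP : IsVx P) : (Sset P).Finite := by
  obtain ⟨g, τ, rfl⟩ := hP
  rw [Sset_fa, Sset_base]
  exact (Set.finite_range _).smul_set

abbrev V4 := {P : M4 // IsVx P}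

noncomputable def S4 (P : V4) : Finset X4 := (Sset_finite P.2).toFinset
theorem mem_S4 {P : V4} {s : X4} : s ∈ S4 P ↔ IsK s ∧ pr s P.1 = 136 := by
  simp [S4, Sset]
theorem coe_S4 (P : V4) : (S4 P : Set X4) = Sset P.1 := by simp [S4]

theorem card_S4 (P : V4) : (S4 P).card = 10 := by
  rw [← Set.ncard_coe_finset, coe_S4]
  obtain ⟨_, ⟨g, τ, rfl⟩⟩ := P
  change (Sset (fa g (base τ))).ncard = 10
  rw [Sset_fa, Sset_base, Set.ncard_smul_set, ← Set.image_univ, Set.ncard_image_of_injective _ (sv_inj τ)]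
  simp

theorem sym_base (τ : Fin 3) : (base τ).transpose = base τ := by
  revert τ; decide +kernel

theorem Vx_sym {P : M4} (hP : IsVx P) : P.transpose = P := by
  obtain ⟨g, τ, rfl⟩ := hP
  simp [fa, Matrix.transpose_mul, sym_base, Matrix.mul_assoc]

/-- neighbours of base vertices -/
theorem base_nb (τ : Fin 3) (i : Fin 10) : 136 < pr (sv τ i) (fa (wG τ i) (base (wty τ i))) ∧
    ∀ j, j ≠ i → pr (sv τ j) (fa (wG τ i) (base (wty τ i))) = 136 :=
  ⟨(wpr τ i i).2 rfl, fun j hj => (wpr τ i j).1 hj⟩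

theorem exists_nb (P : V4) {s : X4} (hs : s ∈ S4 P) : ∃ N : V4, 136 < pr s N.1 ∧
    ∀ s' ∈ S4 P, s' ≠ s → pr s' N.1 = 136 := by
  obtain ⟨_, ⟨g, τ, rfl⟩⟩ := P
  have key : ∀ s, s ∈ Sset (fa g (base τ)) → ∃ j, s = g • sv τ j := by
    intro s hs
    rw [Sset_fa, Sset_base] at hs
    obtain ⟨_, ⟨j, rfl⟩, rfl⟩ := hs
    exact ⟨j, rfl⟩
  rw [← Finset.mem_coe, coe_S4] at hs
  obtain ⟨i, rfl⟩ := key s hs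
  refine ⟨⟨fa g (fa (wG τ i) (base (wty τ i))), IsVx.fa (P := fa (wG τ i) (base (wty τ i))) ⟨_, _, rfl⟩ g⟩, ?_, ?_⟩
  · change _ < pr _ (fa _ _)
    rw [pr_smul]; exact (base_nb τ i).1
  · intro s' hs' hne
    rw [← Finset.mem_coe, coe_S4] at hs'
    obtain ⟨j, rfl⟩ := key s' hs'
    change pr _ (fa _ _) = _
    rw [pr_smul]
    exact (base_nb τ i).2 j (by rintro rfl; exact hne rfl)

open Classical in
noncomputable def nb4 (P : V4) (s : X4) : V4 := if hs : s ∈ S4 P then (exists_nb P hs).choose else P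

theorem nb4_spec (P : V4) {s : X4} (hs : s ∈ S4 P) : 136 < pr s (nb4 P s).1 ∧
    ∀ s' ∈ S4 P, s' ≠ s → pr s' (nb4 P s).1 = 136 := by
  rw [nb4, dif_pos hs]; exact (exists_nb P hs).choose_spec

/-! real forms -/
abbrev R4 := Matrix (Fin 4) (Fin 4) ℝ
def toR (P : M4) : R4 := P.map (Int.castRingHom ℝ)
theorem toR_apply (P : M4) (i j : Fin 4) : toR P i j = (P i j : ℝ) := rfl
theorem toR_mul (P Q : M4) : toR (P * Q) = toR P * toR Q := Matrix.map_mul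
theorem toR_tr (P : M4) : toR P.transpose = (toR P).transpose := rfl
theorem toR_one : toR 1 = 1 := by simp [toR]

noncomputable def prR (s : X4) : R4 →ₗ[ℝ] ℝ where
  toFun M := Matrix.trace (toR s.m * M)
  map_add' M N := by rw [Matrix.mul_add, Matrix.trace_add]
  map_smul' c M := by rw [Matrix.mul_smul, Matrix.trace_smul]; rfl
theorem prR_apply (s : X4) (M : R4) : prR s M = Matrix.trace (toR s.m * M) := rfl

theorem prR_toR (s : X4) (P : M4) : prR s (toR P) = (pr s P : ℝ) := by
  rw [prR_apply, ← toR_mul, pr_eq]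
  simp [Matrix.trace, toR]

theorem prR_smul' (g : G4) (s : X4) (M : R4) :
    prR (g • s) M = prR s ((toR g.1).transpose * M * toR g.1) := by
  rw [prR_apply, prR_apply, smul_m, toR_mul, toR_mul, toR_tr]
  calc Matrix.trace (toR g.1 * toR s.m * (toR g.1).transpose * M)
      = Matrix.trace (toR g.1 * (toR s.m * (toR g.1).transpose * M)) := by simp only [Matrix.mul_assoc]
    _ = Matrix.trace ((toR s.m * (toR g.1).transpose * M) * toR g.1) := Matrix.trace_mul_comm _ _
    _ = _ := by simp only [Matrix.mul_assoc]

theorem prR_sum (s : X4) (M : R4) : prR s M = ∑ i, ∑ j, (s.m i j : ℝ) * M j i := by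
  simp [prR_apply, Matrix.trace, Matrix.mul_apply, toR]

theorem prR_ou (v : Fin 4 → ℤ) (M : R4) : prR (ou v) M = 17 * ∑ i, ∑ j, (v i * v j : ℝ) * M j i := by
  rw [prR_sum, Finset.mul_sum]
  refine Finset.sum_congr rfl fun i _ => ?_
  rw [Finset.mul_sum]
  refine Finset.sum_congr rfl fun j _ => ?_
  rw [ou_m]; push_cast; ring

theorem prR_c0 (M : R4) : prR c0 M = 4 * ∑ i, ∑ j, (C4 i j : ℝ) * M j i := by
  rw [prR_sum, Finset.mul_sum]
  refine Finset.sum_congr rfl fun i _ => ?_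
  rw [Finset.mul_sum]
  refine Finset.sum_congr rfl fun j _ => ?_
  change (((4 * C4 i j : ℤ)) : ℝ) * _ = _
  push_cast; ring

theorem sv_v {τ : Fin 3} {j : Fin 10} (h : ¬ (τ ≠ 0 ∧ j = 9)) : sv τ j = ou (vec τ j) := by
  rw [sv, if_neg h]
theorem sv_c {τ : Fin 3} (h : τ ≠ 0) : sv τ 9 = c0 := by
  rw [sv, if_pos ⟨h, rfl⟩]

theorem M_zero {M : R4} (hM : ∀ i j, M i j = M j i) (h : M 0 0 = 0 ∧ M 0 1 = 0 ∧ M 0 2 = 0 ∧ M 0 3 = 0 ∧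
    M 1 1 = 0 ∧ M 1 2 = 0 ∧ M 1 3 = 0 ∧ M 2 2 = 0 ∧ M 2 3 = 0 ∧ M 3 3 = 0) : M = 0 := by
  obtain ⟨h1, h2, h3, h4, h5, h6, h7, h8, h9, h10⟩ := h
  have s1 := hM 1 0
  have s2 := hM 2 0
  have s3 := hM 3 0
  have s4 := hM 2 1
  have s5 := hM 3 1
  have s6 := hM 3 2
  ext i j
  fin_cases i <;> fin_cases j <;> simp <;> linarith

theorem sep0 {M : R4} (hM : ∀ i j, M i j = M j i) (h : ∀ j, prR (sv 0 j) M = 0) : M = 0 := by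
  have h0 := h 0
  rw [sv_v (by decide), prR_ou] at h0
  have h1 := h 1
  rw [sv_v (by decide), prR_ou] at h1
  have h2 := h 2
  rw [sv_v (by decide), prR_ou] at h2
  have h3 := h 3
  rw [sv_v (by decide), prR_ou] at h3
  have h4 := h 4
  rw [sv_v (by decide), prR_ou] at h4
  have h5 := h 5
  rw [sv_v (by decide), prR_ou] at h5
  have h6 := h 6
  rw [sv_v (by decide), prR_ou] at h6
  have h7 := h 7
  rw [sv_v (by decide), prR_ou] at h7
  have h8 := h 8
  rw [sv_v (by decide), prR_ou] at h8
  have h9 := h 9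
  rw [sv_v (by decide), prR_ou] at h9
  simp [vec, Fin.sum_univ_four] at h0 h1 h2 h3 h4 h5 h6 h7 h8 h9
  have s1 := hM 1 0
  have s2 := hM 2 0
  have s3 := hM 3 0
  have s4 := hM 2 1
  have s5 := hM 3 1
  have s6 := hM 3 2
  refine M_zero hM ⟨?_, ?_, ?_, ?_, ?_, ?_, ?_, ?_, ?_, ?_⟩ <;> linarith

theorem sep1 {M : R4} (hM : ∀ i j, M i j = M j i) (h : ∀ j, prR (sv 1 j) M = 0) : M = 0 := by
  have h0 := h 0
  rw [sv_v (by decide), prR_ou] at h0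
  have h1 := h 1
  rw [sv_v (by decide), prR_ou] at h1
  have h2 := h 2
  rw [sv_v (by decide), prR_ou] at h2
  have h3 := h 3
  rw [sv_v (by decide), prR_ou] at h3
  have h4 := h 4
  rw [sv_v (by decide), prR_ou] at h4
  have h5 := h 5
  rw [sv_v (by decide), prR_ou] at h5
  have h6 := h 6
  rw [sv_v (by decide), prR_ou] at h6
  have h7 := h 7
  rw [sv_v (by decide), prR_ou] at h7
  have h8 := h 8
  rw [sv_v (by decide), prR_ou] at h8
  have h9 := h 9
  rw [sv_c (by decide), prR_c0] at h9
  simp [vec, Fin.sum_univ_four] at h0 h1 h2 h3 h4 h5 h6 h7 h8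
  simp [C4, Fin.sum_univ_four] at h9
  have s1 := hM 1 0
  have s2 := hM 2 0
  have s3 := hM 3 0
  have s4 := hM 2 1
  have s5 := hM 3 1
  have s6 := hM 3 2
  refine M_zero hM ⟨?_, ?_, ?_, ?_, ?_, ?_, ?_, ?_, ?_, ?_⟩ <;> linarith

theorem sep2 {M : R4} (hM : ∀ i j, M i j = M j i) (h : ∀ j, prR (sv 2 j) M = 0) : M = 0 := by
  have h0 := h 0
  rw [sv_v (by decide), prR_ou] at h0
  have h1 := h 1
  rw [sv_v (by decide), prR_ou] at h1
  have h2 := h 2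
  rw [sv_v (by decide), prR_ou] at h2
  have h3 := h 3
  rw [sv_v (by decide), prR_ou] at h3
  have h4 := h 4
  rw [sv_v (by decide), prR_ou] at h4
  have h5 := h 5
  rw [sv_v (by decide), prR_ou] at h5
  have h6 := h 6
  rw [sv_v (by decide), prR_ou] at h6
  have h7 := h 7
  rw [sv_v (by decide), prR_ou] at h7
  have h8 := h 8
  rw [sv_v (by decide), prR_ou] at h8
  have h9 := h 9
  rw [sv_c (by decide), prR_c0] at h9
  simp [vec, Fin.sum_univ_four] at h0 h1 h2 h3 h4 h5 h6 h7 h8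
  simp [C4, Fin.sum_univ_four] at h9
  have s1 := hM 1 0
  have s2 := hM 2 0
  have s3 := hM 3 0
  have s4 := hM 2 1
  have s5 := hM 3 1
  have s6 := hM 3 2
  refine M_zero hM ⟨?_, ?_, ?_, ?_, ?_, ?_, ?_, ?_, ?_, ?_⟩ <;> linarith

theorem sep (P : V4) {M : R4} (hM : ∀ i j, M i j = M j i) (h : ∀ s ∈ S4 P, prR s M = 0) : M = 0 := by
  obtain ⟨_, ⟨g, τ, rfl⟩⟩ := P
  have hMt : M.transpose = M := by ext i j; exact hM j i
  set N : R4 := (toR g.1).transpose * M * toR g.1 with hN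
  have hNs : ∀ i j, N i j = N j i := by
    intro i j
    have : N.transpose = N := by
      simp [hN, Matrix.transpose_mul, hMt, Matrix.mul_assoc]
    conv_lhs => rw [← this]
    rfl
  have h1 : ∀ j, prR (sv τ j) N = 0 := by
    intro j
    rw [hN, ← prR_smul']
    apply h
    rw [← Finset.mem_coe, coe_S4]
    change _ ∈ Sset (fa g (base τ))
    rw [Sset_fa, Sset_base]
    exact ⟨_, ⟨j, rfl⟩, rfl⟩
  have hN0 : N = 0 := by
    fin_cases τ
    · exact sep0 hNs h1
    · exact sep1 hNs h1
    · exact sep2 hNs h1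
  have e1 : (toR (g⁻¹).1).transpose * (toR g.1).transpose = 1 := by
    rw [← toR_tr, ← toR_tr, ← toR_mul, inv_mul4t, toR_one]
  have e2 : toR g.1 * toR (g⁻¹).1 = 1 := by rw [← toR_mul, mul_inv4, toR_one]
  calc M = ((toR (g⁻¹).1).transpose * (toR g.1).transpose) * M * (toR g.1 * toR (g⁻¹).1) := by
        rw [e1, e2]; simp
    _ = (toR (g⁻¹).1).transpose * N * toR (g⁻¹).1 := by rw [hN]; simp only [Matrix.mul_assoc]
    _ = 0 := by rw [hN0]; simp

open Equiv
open Pointwise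

theorem expand (P Q : V4) : toR Q.1 - toR P.1 =
    ∑ s ∈ S4 P, (((pr s Q.1 : ℝ) - 136) / ((pr s (nb4 P s).1 : ℝ) - 136)) • (toR (nb4 P s).1 - toR P.1) := by
  have hs : ∀ P : V4, ∀ i j, toR P.1 i j = toR P.1 j i := by
    intro P i j
    have := Vx_sym P.2
    rw [toR_apply, toR_apply]
    conv_lhs => rw [← this]
    rfl
  rw [← sub_eq_zero]
  apply sep P
  · intro i j
    simp only [Matrix.sub_apply, Matrix.sum_apply, Matrix.smul_apply]
    simp only [hs _ j i]
  · intro s hs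
    rw [map_sub, map_sub, map_sum]
    have h0 : ∀ s ∈ S4 P, prR s (toR P.1) = 136 := by
      intro s hs; rw [prR_toR, (mem_S4.1 hs).2]; norm_num
    rw [Finset.sum_eq_single s]
    · rw [map_smul, map_sub, h0 s hs, prR_toR, prR_toR, smul_eq_mul]
      have h1 : (136 : ℝ) < pr s (nb4 P s).1 := by exact_mod_cast (nb4_spec P hs).1
      rw [div_mul_cancel₀ _ (by linarith)]; ring
    · intro s' hs' hne
      rw [map_smul, map_sub, h0 s hs, prR_toR, (nb4_spec P hs').2 s hs hne.symm]
      norm_num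
    · exact fun h => absurd hs h

/-- generic height -/
def wt (x : ℝ) : R4 := !![1,x^4,x^5,x^6;0,1+x,x^7,x^8;0,0,1+x^2,x^9;0,0,0,1+x^3]
noncomputable def fl (x : ℝ) : R4 →ₗ[ℝ] ℝ where
  toFun M := ∑ i, ∑ j, wt x i j * M i j
  map_add' M N := by simp only [Matrix.add_apply, mul_add, Finset.sum_add_distrib]
  map_smul' c M := by
    simp only [Matrix.smul_apply, smul_eq_mul, RingHom.id_apply, Finset.mul_sum]
    refine Finset.sum_congr rfl fun i _ => Finset.sum_congr rfl fun j _ => by ring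

theorem fl_apply (x : ℝ) (M : R4) : fl x M = M 0 0 + M 1 1 + M 2 2 + M 3 3 + x * M 1 1 + x^2 * M 2 2
    + x^3 * M 3 3 + x^4 * M 0 1 + x^5 * M 0 2 + x^6 * M 0 3 + x^7 * M 1 2 + x^8 * M 1 3 + x^9 * M 2 3 := by
  change ∑ i, ∑ j, wt x i j * M i j = _
  simp [Fin.sum_univ_four, wt]
  ring

theorem exists_x : ∃ x : ℝ, 0 < x ∧ x < 1/2 ∧ Transcendental ℤ x := by
  by_contra h
  push Not at h
  have h1 : (Set.Ioo (0:ℝ) (1/2)).Countable := by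
    refine (Algebraic.countable ℤ ℝ).mono fun x hx => ?_
    have := h x hx.1 hx.2
    rw [Transcendental, not_not] at this
    exact this
  rw [Cardinal.Real.Ioo_countable_iff] at h1
  norm_num at h1

noncomputable def xx : ℝ := exists_x.choose
theorem xx_pos : 0 < xx := exists_x.choose_spec.1
theorem xx_lt : xx < 1/2 := exists_x.choose_spec.2.1
theorem xx_tr : Transcendental ℤ xx := exists_x.choose_spec.2.2

noncomputable def f4 (P : V4) : ℝ := fl xx (toR P.1)

open Polynomial in
theorem f4_inj {P Q : V4} (h : f4 P = f4 Q) : P = Q := by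
  rw [f4, f4, ← sub_eq_zero, ← map_sub, fl_apply] at h
  set D : M4 := P.1 - Q.1 with hD
  have hd : ∀ i j, (toR P.1 - toR Q.1) i j = (D i j : ℝ) := by
    intro i j; rw [Matrix.sub_apply, toR_apply, toR_apply, hD, Matrix.sub_apply]; push_cast; rfl
  have hsym : ∀ i j, D i j = D j i := by
    intro i j
    have h1 := congrFun (congrFun (Vx_sym P.2) j) i
    have h2 := congrFun (congrFun (Vx_sym Q.2) j) i
    rw [Matrix.transpose_apply] at h1 h2
    rw [hD, Matrix.sub_apply, Matrix.sub_apply, h1, h2]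
  simp only [hd] at h
  set p : ℤ[X] := C (D 0 0 + D 1 1 + D 2 2 + D 3 3) + C (D 1 1) * X + C (D 2 2) * X^2 + C (D 3 3) * X^3
    + C (D 0 1) * X^4 + C (D 0 2) * X^5 + C (D 0 3) * X^6 + C (D 1 2) * X^7 + C (D 1 3) * X^8
    + C (D 2 3) * X^9 with hp
  have h0 : aeval xx p = 0 := by
    rw [hp]
    simp only [map_add, map_mul, map_pow, aeval_X, aeval_C]
    simp only [eq_intCast, algebraMap_int_eq]
    push_cast
    rw [← h]
    ring
  have hp0 : p = 0 := by
    by_contra hne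
    exact xx_tr ⟨p, hne, h0⟩
  have hc : ∀ n, p.coeff n = 0 := by rw [hp0]; simp
  have c0 := hc 0
  have c1 := hc 1
  have c2 := hc 2
  have c3 := hc 3
  have c4 := hc 4
  have c5 := hc 5
  have c6 := hc 6
  have c7 := hc 7
  have c8 := hc 8
  have c9 := hc 9
  simp only [hp, coeff_add, coeff_C_mul, coeff_C, coeff_X_pow, coeff_X] at c0 c1 c2 c3 c4 c5 c6 c7 c8 c9
  norm_num at c0 c1 c2 c3 c4 c5 c6 c7 c8 c9
  have s1 := hsym 1 0
  have s2 := hsym 2 0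
  have s3 := hsym 3 0
  have s4 := hsym 2 1
  have s5 := hsym 3 1
  have s6 := hsym 3 2
  have hD0 : D = 0 := by
    ext i j
    fin_cases i <;> fin_cases j <;> simp <;> linarith
  exact Subtype.ext (sub_eq_zero.1 hD0)

theorem Vx_qf (P : V4) {v : Fin 4 → ℤ} (hv : v ≠ 0) : 8 ≤ qf P.1 v := by
  have := Vx_ge P.2 (Or.inl ⟨v, hv, rfl⟩ : IsK (ou v))
  rw [pr_ou] at this
  linarith

theorem Vx_diag (P : V4) (i : Fin 4) : 8 ≤ P.1 i i := by
  have := Vx_qf P (v := Pi.single i 1) (by simp)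
  revert this
  fin_cases i <;> simp [qf, Fin.sum_univ_four]

theorem Vx_off (P : V4) (i j : Fin 4) (h : i < j) : 2 * |P.1 i j| ≤ P.1 0 0 + P.1 1 1 + P.1 2 2 + P.1 3 3 ∧ P.1 j i = P.1 i j := by
  have h1 := Vx_qf P (v := Pi.single i 1 + Pi.single j 1) (by
    intro h0; have := congrFun h0 i; simp [h.ne] at this)
  have h2 := Vx_qf P (v := Pi.single i 1 - Pi.single j 1) (by
    intro h0; have := congrFun h0 i; simp [h.ne] at this)
  have d0 := Vx_diag P 0
  have d1 := Vx_diag P 1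
  have d2 := Vx_diag P 2
  have d3 := Vx_diag P 3
  have hs := congrFun (congrFun (Vx_sym P.2) i) j
  rw [Matrix.transpose_apply] at hs
  refine ⟨?_, hs⟩
  have : 2 * P.1 i j ≤ P.1 0 0 + P.1 1 1 + P.1 2 2 + P.1 3 3 ∧ -(2 * P.1 i j) ≤ P.1 0 0 + P.1 1 1 + P.1 2 2 + P.1 3 3 := by
    revert h1 h2 hs h
    fin_cases i <;> fin_cases j <;> simp [qf, Fin.sum_univ_four] <;> intros <;> constructor <;> linarith
  rcases abs_cases (P.1 i j) with ⟨h, _⟩ | ⟨h, _⟩ <;> rw [h] <;> linarith [this.1, this.2]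

def tr4 (P : V4) : ℤ := P.1 0 0 + P.1 1 1 + P.1 2 2 + P.1 3 3

theorem Vx_abs (P : V4) (i j : Fin 4) : |P.1 i j| ≤ tr4 P := by
  have d0 := Vx_diag P 0
  have d1 := Vx_diag P 1
  have d2 := Vx_diag P 2
  have d3 := Vx_diag P 3
  rcases lt_trichotomy i j with h | rfl | h
  · have := Vx_off P i j h
    have h3 := abs_nonneg (P.1 i j)
    unfold tr4; linarith [this.1]
  · have d := Vx_diag P i
    rw [abs_of_nonneg (by linarith)]
    unfold tr4
    fin_cases i <;> simp <;> linarith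
  · have := Vx_off P j i h
    rw [this.2]
    have h3 := abs_nonneg (P.1 j i)
    unfold tr4; linarith [this.1]

theorem f4_ge (P : V4) : (tr4 P : ℝ) ≤ 2 * f4 P := by
  have hx0 := xx_pos
  have hx1 := xx_lt
  have ht : (0:ℝ) < tr4 P := by
    have d0 := Vx_diag P 0
    have d1 := Vx_diag P 1
    have d2 := Vx_diag P 2
    have d3 := Vx_diag P 3
    have : 0 < tr4 P := by unfold tr4; linarith
    exact_mod_cast this
  have key : ∀ n, 4 ≤ n → ∀ i j : Fin 4, i < j → -(tr4 P / 32 : ℝ) ≤ xx^n * (P.1 i j : ℝ) := by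
    intro n hn i j hij
    have h1 : xx ^ n ≤ 1/16 := by
      calc xx^n ≤ xx^4 := pow_le_pow_of_le_one hx0.le (by linarith) hn
        _ ≤ (1/2)^4 := pow_le_pow_left₀ hx0.le hx1.le 4
        _ = 1/16 := by norm_num
    have h2 : (2 : ℝ) * |(P.1 i j : ℝ)| ≤ tr4 P := by exact_mod_cast (Vx_off P i j hij).1
    have h3 : |xx^n * (P.1 i j : ℝ)| ≤ 1/16 * (tr4 P / 2) := by
      rw [abs_mul, abs_of_nonneg (pow_nonneg hx0.le n)]
      exact mul_le_mul h1 (by linarith) (abs_nonneg _) (by norm_num)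
    linarith [(abs_le.1 h3).1]
  have hd : ∀ n, ∀ i : Fin 4, 0 ≤ xx^n * (P.1 i i : ℝ) := by
    intro n i
    have : (8 : ℝ) ≤ P.1 i i := by exact_mod_cast Vx_diag P i
    have := pow_nonneg hx0.le n
    positivity
  rw [f4, fl_apply]
  simp only [toR_apply]
  have k1 := key 4 (by norm_num) 0 1 (by decide)
  have k2 := key 5 (by norm_num) 0 2 (by decide)
  have k3 := key 6 (by norm_num) 0 3 (by decide)
  have k4 := key 7 (by norm_num) 1 2 (by decide)
  have k5 := key 8 (by norm_num) 1 3 (by decide)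
  have k6 := key 9 (by norm_num) 2 3 (by decide)
  have e1 := hd 1 1
  have e2 := hd 2 2
  have e3 := hd 3 3
  rw [pow_one] at e1
  have : (tr4 P : ℝ) = P.1 0 0 + P.1 1 1 + P.1 2 2 + P.1 3 3 := by unfold tr4; push_cast; ring
  linarith

theorem box_finite (c : ℤ) : {P : V4 | ∀ i j, |P.1 i j| ≤ c}.Finite := by
  have h := Set.finite_Icc (fun _ _ => -c : Fin 4 → Fin 4 → ℤ) (fun _ _ => c)
  refine (h.preimage (f := fun P : V4 => (P.1 : Fin 4 → Fin 4 → ℤ)) ?_).subset ?_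
  · intro P _ Q _ h
    exact Subtype.ext h
  · intro P hP
    exact ⟨fun i j => (abs_le.1 (hP i j)).1, fun i j => (abs_le.1 (hP i j)).2⟩

theorem f4_fin (c : ℝ) : {P | f4 P ≤ c}.Finite := by
  refine (box_finite ⌊2 * c⌋).subset fun P hP i j => (Vx_abs P i j).trans ?_
  rw [Int.le_floor]
  have := f4_ge P
  have h2 : f4 P ≤ c := hP
  linarith

theorem nb4_ne (P : V4) {s : X4} (hs : s ∈ S4 P) : nb4 P s ≠ P := by
  intro h
  have := (nb4_spec P hs).1
  rw [h, (mem_S4.1 hs).2] at this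
  exact lt_irrefl _ this

theorem f4_expand (P Q : V4) : f4 Q - f4 P = 
    ∑ s ∈ S4 P, (((pr s Q.1 : ℝ) - 136) / ((pr s (nb4 P s).1 : ℝ) - 136)) * (f4 (nb4 P s) - f4 P) := by
  rw [f4, f4, ← map_sub, expand P Q, map_sum]
  refine Finset.sum_congr rfl fun s _ => ?_
  rw [map_smul, map_sub, smul_eq_mul]; rfl

theorem lam_nonneg (P Q : V4) {s : X4} (hs : s ∈ S4 P) :
    0 ≤ ((pr s Q.1 : ℝ) - 136) / ((pr s (nb4 P s).1 : ℝ) - 136) := by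
  have h1 : (136 : ℝ) < pr s (nb4 P s).1 := by exact_mod_cast (nb4_spec P hs).1
  have h2 : (136 : ℝ) ≤ pr s Q.1 := by exact_mod_cast Vx_ge Q.2 (mem_S4.1 hs).1
  exact div_nonneg (by linarith) (by linarith)

noncomputable def A4p : Polyh X4 V4 where
  S := S4
  nb := nb4
  f := f4
  nb_mem P s hs s' hs' hne := mem_S4.2 ⟨(mem_S4.1 hs').1, (nb4_spec P hs).2 s' hs' hne⟩
  nb_ne P s hs h := nb4_ne P hs (f4_inj h)
  conv P σ hσ hd Q hQ hne := by
    refine lt_of_le_of_ne ?_ fun h => hne (f4_inj h)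
    have : f4 Q - f4 P ≤ 0 := by
      rw [f4_expand P Q]
      refine Finset.sum_nonpos fun s hs => ?_
      by_cases hsσ : s ∈ σ
      · rw [(mem_S4.1 (hQ hsσ)).2]; norm_num
      · exact mul_nonpos_of_nonneg_of_nonpos (lam_nonneg P Q hs) (by linarith [hd s hs hsσ])
    linarith
  fin := f4_fin

/-- a vertex without lower neighbours is the minimum -/
theorem min_of_local {P : V4} (h : ∀ s ∈ S4 P, f4 P ≤ f4 (nb4 P s)) (Q : V4) : f4 P ≤ f4 Q := by
  have : 0 ≤ f4 Q - f4 P := by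
    rw [f4_expand P Q]
    exact Finset.sum_nonneg fun s hs => mul_nonneg (lam_nonneg P Q hs) (by linarith [h s hs])
  linarith

/-- vertices of an edge -/
theorem edge_eq {P Q : V4} {s : X4} (hs : s ∈ S4 P) (h : ∀ s' ∈ S4 P, s' ≠ s → s' ∈ S4 Q) :
    Q = P ∨ Q = nb4 P s := by
  have main : ∀ Q : V4, (∀ s' ∈ S4 P, s' ≠ s → s' ∈ S4 Q) → ∃ l : ℝ, 0 ≤ l ∧ 
      toR Q.1 - toR P.1 = l • (toR (nb4 P s).1 - toR P.1) := by
    intro Q h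
    refine ⟨_, lam_nonneg P Q hs, ?_⟩
    rw [expand P Q, Finset.sum_eq_single s]
    · intro s' hs' hne
      rw [(mem_S4.1 (h s' hs' hne)).2]; norm_num
    · exact fun h => absurd hs h
  obtain ⟨l, hl, hl2⟩ := main Q h
  set N := nb4 P s with hN
  have hNP : N ≠ P := nb4_ne P hs
  have toRinj : ∀ {A B : V4}, toR A.1 = toR B.1 → A = B := by
    intro A B h
    apply Subtype.ext
    ext i j
    have := congrFun (congrFun h i) j
    rw [toR_apply, toR_apply] at this
    exact_mod_cast this
  -- a constraint of N not at P
  have hex : ∃ r ∈ S4 N, r ∉ S4 P := by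
    by_contra hc
    push Not at hc
    have h1 : S4 N ⊆ S4 P := hc
    have h2 : S4 N = S4 P := Finset.eq_of_subset_of_card_le h1 (by rw [card_S4, card_S4])
    have h3 : s ∈ S4 N := h2 ▸ hs
    have := (nb4_spec P hs).1
    rw [← hN, (mem_S4.1 h3).2] at this
    exact lt_irrefl _ this
  obtain ⟨r, hr, hrP⟩ := hex
  have hrK := (mem_S4.1 hr).1
  have hrP2 : (136:ℝ) < pr r P.1 := by
    have := lt_of_le_of_ne (Vx_ge P.2 hrK) (fun h => hrP (mem_S4.2 ⟨hrK, h.symm⟩))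
    exact_mod_cast this
  have e1 := congrArg (prR r) hl2
  rw [map_sub, map_smul, map_sub, prR_toR, prR_toR, prR_toR, (mem_S4.1 hr).2, smul_eq_mul] at e1
  have hrQ : (136:ℝ) ≤ pr r Q.1 := by exact_mod_cast Vx_ge Q.2 hrK
  push_cast at e1
  have hl1 : l ≤ 1 := by nlinarith
  by_cases hl0 : l = 0
  · left
    rw [hl0, zero_smul, sub_eq_zero] at hl2
    exact toRinj hl2
  right
  by_contra hQN
  have hl1' : l < 1 := by
    refine lt_of_le_of_ne hl1 fun h => hQN (toRinj ?_)
    rw [h, one_smul] at hl2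
    exact sub_left_inj.1 hl2
  have hlpos : 0 < l := lt_of_le_of_ne hl (Ne.symm hl0)
  -- Q is strictly between: S4 Q ⊆ S4 P
  have hsub : S4 Q ⊆ S4 P := by
    intro q hq
    have hqK := (mem_S4.1 hq).1
    by_contra hqP
    have hqP2 : (136:ℝ) < pr q P.1 := by
      have := lt_of_le_of_ne (Vx_ge P.2 hqK) (fun h => hqP (mem_S4.2 ⟨hqK, h.symm⟩))
      exact_mod_cast this
    have hqN : (136:ℝ) ≤ pr q N.1 := by exact_mod_cast Vx_ge N.2 hqK
    have e2 := congrArg (prR q) hl2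
    rw [map_sub, map_smul, map_sub, prR_toR, prR_toR, prR_toR, (mem_S4.1 hq).2, smul_eq_mul] at e2
    push_cast at e2
    nlinarith
  have h2 : S4 Q = S4 P := Finset.eq_of_subset_of_card_le hsub (by rw [card_S4, card_S4])
  have h3 : s ∈ S4 Q := h2 ▸ hs
  have e2 := congrArg (prR s) hl2
  have h4 : (136:ℝ) < pr s N.1 := by exact_mod_cast (nb4_spec P hs).1
  rw [map_sub, map_smul, map_sub, prR_toR, prR_toR, prR_toR, (mem_S4.1 h3).2, (mem_S4.1 hs).2, smul_eq_mul] at e2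
  push_cast at e2
  nlinarith

open Equiv
open Pointwise

def Bd (Q : M4) : Prop := ∀ c : ℤ, {v | qf Q v ≤ c}.Finite

theorem Bd_of_box {Q : M4} (h : ∀ v i, (v i)^2 ≤ 4 * qf Q v) : Bd Q := by
  intro c
  have hf := Set.finite_Icc (fun _ => -(4*c) : Fin 4 → ℤ) (fun _ => 4 * c)
  refine hf.subset fun v hv => ?_
  have hv' : qf Q v ≤ c := hv
  have : ∀ i, -(4*c) ≤ v i ∧ v i ≤ 4 * c := by
    intro i
    have := h v i
    constructor <;> nlinarith
  exact ⟨fun i => (this i).1, fun i => (this i).2⟩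

theorem Bd.mono {Q R : M4} (h : Bd Q) (h1 : ∀ v, qf Q v ≤ qf R v) : Bd R :=
  fun c => (h c).subset fun v hv => (h1 v).trans hv

theorem Bd_A4 : Bd A4 := Bd_of_box fun v i => by
  rw [qf_A4]
  fin_cases i <;> simp <;> nlinarith [sq_nonneg (v 0), sq_nonneg (v 1), sq_nonneg (v 2), sq_nonneg (v 3), sq_nonneg (v 0 + v 1 + v 2 + v 3)]

theorem Bd_D4 : Bd D4 := Bd_of_box fun v i => by
  rw [qf_D4]
  have e : 2 * (2 * v 0^2 + 2 * v 1^2 + 2 * v 2^2 + 2 * v 3^2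
    - 2 * v 2 * (v 0 + v 1 + v 3)) = (2 * v 0 - v 2)^2 + (2 * v 1 - v 2)^2 + (2 * v 3 - v 2)^2 + (v 2)^2 := by ring
  fin_cases i <;> simp <;> nlinarith [sq_nonneg (2 * v 0 - v 2), sq_nonneg (2 * v 1 - v 2), sq_nonneg (2 * v 3 - v 2),
   sq_nonneg (v 2), sq_nonneg (v 0), sq_nonneg (v 1), sq_nonneg (v 3), sq_nonneg (v 0 - v 2), sq_nonneg (v 1 - v 2), sq_nonneg (v 3 - v 2)]

theorem qf_add (P Q : M4) (v : Fin 4 → ℤ) : qf (P + Q) v = qf P v + qf Q v := by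
  simp [qf, Fin.sum_univ_four]; ring
theorem qf_zsmul (c : ℤ) (P : M4) (v : Fin 4 → ℤ) : qf (c • P) v = c * qf P v := by
  simp [qf, Fin.sum_univ_four]; ring
theorem EP.nonneg {Q : M4} (h : EP Q) (v : Fin 4 → ℤ) : 0 ≤ qf Q v := by
  by_cases hv : v = 0
  · subst hv; simp [qf]
  · exact (h.pos v hv).le

theorem Bd_base (τ : Fin 3) : Bd (base τ) := by
  fin_cases τ
  · change Bd (base 0)
    rw [base0]
    exact Bd_A4.mono fun v => by rw [qf_zsmul]; linarith [epA4.nonneg v]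
  · change Bd (base 1)
    rw [base1]
    exact Bd_D4.mono fun v => by rw [qf_add, qf_zsmul]; linarith [epD4.nonneg v, epNa.nonneg v]
  · change Bd (base 2)
    rw [base2]
    exact Bd_D4.mono fun v => by rw [qf_add, qf_zsmul]; linarith [epD4.nonneg v, epNb.nonneg v]

theorem qf_fa (g : G4) (Q : M4) (v : Fin 4 → ℤ) : qf (fa g Q) v = qf Q ((g⁻¹).1.mulVec v) :=
  qf_conj g⁻¹ Q v

theorem Bd_fa {Q : M4} (h : Bd Q) (g : G4) : Bd (fa g Q) := by
  intro c
  refine ((h c).preimage (f := fun v => (g⁻¹).1.mulVec v) ?_).subset fun v hv => ?_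
  · intro v _ w _ hvw
    have := congrArg (fun u => g.1.mulVec u) hvw
    simpa [Matrix.mulVec_mulVec, mul_inv4, -Matrix.coe_units_inv] using this
  · change qf Q _ ≤ c
    rw [← qf_fa]; exact hv

theorem fa_inj {g : G4} {P Q : M4} (h : fa g P = fa g Q) : P = Q := by
  have := congrArg (fa g⁻¹) h
  rwa [← fa_mul, ← fa_mul, inv_mul_cancel, fa_one, fa_one] at this

theorem Bd.finite {Q : M4} (h : Bd Q) (R : M4) : {g : G4 | fa g R = Q}.Finite := by
  have h1 := Set.Finite.pi' (fun i : Fin 4 => h (qf R (Pi.single i 1)))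
  refine (h1.preimage (f := fun g : G4 => fun i : Fin 4 => g.1.mulVec (Pi.single i 1)) ?_).subset ?_
  · intro g _ k _ hgk
    apply Units.ext
    ext i j
    have := congrFun (congrFun hgk j) i
    simpa using this
  · rintro g rfl i
    change qf _ _ ≤ _
    rw [qf_fa, Matrix.mulVec_mulVec, inv_mul4, Matrix.one_mulVec]

theorem Vx_Bd (P : V4) : Bd P.1 := by
  obtain ⟨_, ⟨g, τ, rfl⟩⟩ := P
  exact Bd_fa (Bd_base τ) g

theorem stabC_finite : {g : G4 | g • c0 = c0}.Finite := by
  refine (Bd_D4.finite D4).subset fun g hg => ?_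
  have h1 : EP (fa g D4) := epD4.conj g⁻¹
  refine pr_c0_eq h1 ?_
  have : pr c0 (fa g D4) = pr c0 D4 := by
    conv_lhs => rw [← show g • c0 = c0 from hg]
    rw [pr_smul]
  rw [this]; decide +kernel

def ga (g : G4) (P : V4) : V4 := ⟨fa g P.1, P.2.fa g⟩
theorem S4_ga (g : G4) (P : V4) : (S4 (ga g P) : Set X4) = g • (S4 P : Set X4) := by
  rw [coe_S4, coe_S4, ← Sset_fa]; rfl
theorem ga_inv (g : G4) (P : V4) : ga g (ga g⁻¹ P) = P := by
  apply Subtype.ext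
  change fa g (fa g⁻¹ P.1) = P.1
  rw [← fa_mul, mul_inv_cancel, fa_one]
theorem sub_ga (g : G4) (P : V4) (σ : Set X4) : g • σ ⊆ (S4 (ga g P) : Set X4) ↔ σ ⊆ S4 P := by
  rw [S4_ga, Set.smul_set_subset_smul_set_iff]
theorem mem_ga (g : G4) (P : V4) (s : X4) : g • s ∈ S4 (ga g P) ↔ s ∈ S4 P := by
  rw [← Finset.mem_coe, S4_ga, Set.smul_mem_smul_set_iff, Finset.mem_coe]

abbrev Ce : Set X4 → Prop := A4p.Cell
theorem Ce_def (σ : Set X4) : Ce σ ↔ (∃ P : V4, σ ⊆ S4 P) ∧ {P : V4 | σ ⊆ S4 P}.Finite := Iff.rfl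

theorem cellSys : CellSys (G := G4) Ce where
  good := A4p.good
  inv g σ h := by
    obtain ⟨⟨P, hP⟩, hf⟩ := h
    refine ⟨⟨ga g P, (sub_ga g P σ).2 hP⟩, (hf.image (ga g)).subset fun Q hQ => ?_⟩
    refine ⟨ga g⁻¹ Q, ?_, ga_inv g Q⟩
    change σ ⊆ S4 _
    rw [← sub_ga g, ga_inv]
    exact hQ
  stab σ h := by
    obtain ⟨⟨P, hP⟩, hf⟩ := h
    refine (hf.biUnion (t := fun Q : V4 => {g : G4 | fa g P.1 = Q.1}) fun Q _ => (Vx_Bd Q).finite P.1).subset ?_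
    intro g hg
    simp only [Set.mem_iUnion]
    refine ⟨ga g P, ?_, rfl⟩
    change σ ⊆ S4 _
    rw [← show g • σ = σ from hg]
    exact (sub_ga g P σ).2 hP

/-- the link of a facet -/
noncomputable def lk (c : X4) : Polyh X4 {P : V4 // c ∈ S4 P} where
  S P := (S4 P.1).erase c
  nb P s := if h : s ∈ S4 P.1 ∧ s ≠ c then ⟨nb4 P.1 s, A4p.nb_mem P.1 s h.1 c P.2 h.2.symm⟩ else P
  f P := f4 P.1
  nb_mem P s hs s' hs' hne := by
    rw [Finset.mem_erase] at hs hs'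
    rw [dif_pos ⟨hs.2, hs.1⟩, Finset.mem_erase]
    exact ⟨hs'.1, A4p.nb_mem P.1 s hs.2 s' hs'.2 hne⟩
  nb_ne P s hs := by
    rw [Finset.mem_erase] at hs
    rw [dif_pos ⟨hs.2, hs.1⟩]
    exact A4p.nb_ne P.1 s hs.2
  conv P σ hσ hd Q hQ hne := by
    refine A4p.conv P.1 (insert c σ) ?_ ?_ Q.1 ?_ (fun h => hne (Subtype.ext h))
    · rintro s (rfl | h)
      · exact P.2
      · exact Finset.mem_of_mem_erase (hσ h)
    · intro s hs hsσ
      rw [Set.mem_insert_iff, not_or] at hsσ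
      have := hd s (Finset.mem_erase.2 ⟨hsσ.1, hs⟩) hsσ.2
      rwa [dif_pos ⟨hs, hsσ.1⟩] at this
    · rintro s (rfl | h)
      · exact Q.2
      · exact Finset.mem_of_mem_erase (hQ h)
  fin x := (f4_fin x).preimage Subtype.val_injective.injOn

theorem lk_card (c : X4) (P : {P : V4 // c ∈ S4 P}) : ((lk c).S P).card = 9 := by
  change ((S4 P.1).erase c).card = 9
  rw [Finset.card_erase_of_mem P.2, card_S4]

theorem lk_cell (c : X4) (σ : Set X4) : (lk c).Cell σ ↔ c ∉ σ ∧ Ce (insert c σ) := by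
  have key : ∀ P : {P : V4 // c ∈ S4 P}, σ ⊆ ((lk c).S P) ↔ c ∉ σ ∧ insert c σ ⊆ S4 P.1 := by
    intro P
    change σ ⊆ (((S4 P.1).erase c : Finset X4) : Set X4) ↔ _
    constructor
    · intro h
      refine ⟨fun hc => ?_, ?_⟩
      · have := h hc
        simp at this
      · rintro s (rfl | hs)
        · exact P.2
        · exact Finset.mem_of_mem_erase (h hs)
    · rintro ⟨h1, h2⟩ s hs
      exact Finset.mem_coe.2 (Finset.mem_erase.2 ⟨fun h => h1 (h ▸ hs), h2 (Set.mem_insert_of_mem _ hs)⟩)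
  constructor
  · rintro ⟨⟨P, hP⟩, hf⟩
    have hc := ((key P).1 hP).1
    refine ⟨hc, ⟨P.1, ((key P).1 hP).2⟩, (hf.image Subtype.val).subset fun Q hQ => ?_⟩
    have hcQ : c ∈ S4 Q := hQ (Set.mem_insert _ _)
    exact ⟨⟨Q, hcQ⟩, (key _).2 ⟨hc, hQ⟩, rfl⟩
  · rintro ⟨hc, ⟨P, hP⟩, hf⟩
    have hcP : c ∈ S4 P := hP (Set.mem_insert _ _)
    refine ⟨⟨⟨P, hcP⟩, (key _).2 ⟨hc, hP⟩⟩, (hf.preimage Subtype.val_injective.injOn).subset fun Q hQ => ?_⟩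
    exact ((key Q).1 hQ).2

open Equiv
open Pointwise

def ix : Fin 4 → Fin 4 → Fin 10 := ![![0,1,2,3],![1,4,5,6],![2,5,7,8],![3,6,8,9]]
def pp : Fin 10 → Fin 4 := ![0,0,0,0,1,1,1,2,2,3]
def qq : Fin 10 → Fin 4 := ![0,1,2,3,1,2,3,2,3,3]
theorem ix_pq : ∀ a, ix (pp a) (qq a) = a := by decide
theorem ix_comm : ∀ i j, ix i j = ix j i := by decide
theorem pq_ix : ∀ i j, (pp (ix i j) = i ∧ qq (ix i j) = j) ∨ (pp (ix i j) = j ∧ qq (ix i j) = i) := by decide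

def mkl : (Fin 10 → ℝ) →ₗ[ℝ] R4 where
  toFun v := fun i j => v (ix i j)
  map_add' _ _ := rfl
  map_smul' _ _ := rfl
def col : R4 →ₗ[ℝ] (Fin 10 → ℝ) where
  toFun M := fun a => M (pp a) (qq a)
  map_add' _ _ := rfl
  map_smul' _ _ := rfl
theorem col_mkl (v : Fin 10 → ℝ) : col (mkl v) = v := by
  funext a; change v _ = v a; rw [ix_pq]
theorem mkl_sym (v : Fin 10 → ℝ) : (mkl v).transpose = mkl v := by
  ext i j; change v _ = v _; rw [ix_comm]
theorem mkl_col {M : R4} (h : M.transpose = M) : mkl (col M) = M := by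
  ext i j
  change M _ _ = _
  rcases pq_ix i j with ⟨h1, h2⟩ | ⟨h1, h2⟩ <;> rw [h1, h2]
  exact (congrFun (congrFun h j) i).symm

def cj (g : R4) : R4 →ₗ[ℝ] R4 where
  toFun M := g * M * g.transpose
  map_add' M N := by rw [Matrix.mul_add, Matrix.add_mul]
  map_smul' c M := by simp
theorem cj_apply (g M : R4) : cj g M = g * M * g.transpose := rfl
theorem cj_sym (g : R4) {M : R4} (h : M.transpose = M) : (cj g M).transpose = cj g M := by
  simp [cj_apply, Matrix.transpose_mul, h, Matrix.mul_assoc]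

def Rl (g : R4) : (Fin 10 → ℝ) →ₗ[ℝ] (Fin 10 → ℝ) := col ∘ₗ cj g ∘ₗ mkl
theorem Rl_apply (g : R4) (v : Fin 10 → ℝ) : Rl g v = col (cj g (mkl v)) := rfl
theorem Rl_mul (g h : R4) : Rl (g * h) = Rl g ∘ₗ Rl h := by
  apply LinearMap.ext
  intro v
  rw [LinearMap.comp_apply, Rl_apply, Rl_apply, Rl_apply, mkl_col (cj_sym h (mkl_sym v))]
  simp [cj_apply, Matrix.mul_assoc]
theorem Rl_one : Rl 1 = LinearMap.id := by
  apply LinearMap.ext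
  intro v
  rw [Rl_apply, cj_apply]; simp [col_mkl]
theorem det_Rl_mul (g h : R4) : LinearMap.det (Rl (g * h)) = LinearMap.det (Rl g) * LinearMap.det (Rl h) := by
  rw [Rl_mul, LinearMap.det_comp]

theorem det_Rl_diag (d : Fin 4 → ℝ) : LinearMap.det (Rl (Matrix.diagonal d)) = (Matrix.diagonal d).det ^ 5 := by
  have : Rl (Matrix.diagonal d) = Matrix.toLin' (Matrix.diagonal fun a => d (pp a) * d (qq a)) := by
    apply LinearMap.ext
    intro v
    funext a
    rw [Matrix.toLin'_apply, Matrix.mulVec_diagonal, Rl_apply, cj_apply]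
    change (Matrix.diagonal d * mkl v * (Matrix.diagonal d).transpose) (pp a) (qq a) = _
    rw [Matrix.diagonal_transpose, Matrix.mul_diagonal, Matrix.diagonal_mul]
    change d _ * v (ix _ _) * d _ = _
    rw [ix_pq]; ring
  rw [this, LinearMap.det_toLin', Matrix.det_diagonal, Matrix.det_diagonal, Fin.prod_univ_four]
  simp [Fin.prod_univ_succ, pp, qq]
  ring

theorem det_Rl (g : R4) (hg : g.det ≠ 0) : LinearMap.det (Rl g) = g.det ^ 5 := by
  refine Matrix.diagonal_transvection_induction_of_det_ne_zero
    (fun g => LinearMap.det (Rl g) = g.det ^ 5) g hg (fun d _ => det_Rl_diag d) ?_ ?_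
  · intro t
    rw [Matrix.TransvectionStruct.det, one_pow]
    obtain ⟨i, j, hij, c⟩ := t
    change LinearMap.det (Rl (Matrix.transvection i j c)) = 1
    set T := Matrix.transvection i j c with hT
    set d : Fin 4 → ℝ := fun k => if k = i then 2 else 1 with hd
    have h1 : Matrix.diagonal d * T = (T * T) * Matrix.diagonal d := by
      rw [hT, Matrix.transvection_mul_transvection_same i j hij]
      ext a b
      rw [Matrix.diagonal_mul, Matrix.mul_diagonal]
      simp only [Matrix.transvection, Matrix.add_apply, Matrix.single_apply, Matrix.one_apply, hd]
      by_cases ha : a = i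
      · subst ha
        by_cases hb : b = j
        · subst hb; simp [hij, Ne.symm hij]; ring
        · have : ¬ j = b := fun h => hb h.symm
          by_cases hab : a = b
          · subst hab; simp [this]
          · simp [this, hab]
      · have : ¬ i = a := fun h => ha h.symm
        by_cases hab : a = b
        · subst hab; simp [ha, this]
        · simp [this, hab]
    have h2 := congrArg (fun M => LinearMap.det (Rl M)) h1
    simp only [det_Rl_mul, det_Rl_diag] at h2
    have hd0 : (Matrix.diagonal d).det ^ 5 ≠ 0 := by
      apply pow_ne_zero
      rw [Matrix.det_diagonal, Finset.prod_ne_zero_iff]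
      intro k _
      simp only [hd]; split_ifs <;> norm_num
    have hT0 : LinearMap.det (Rl T) ≠ 0 := by
      intro h0
      have h3 : T * Matrix.transvection i j (-c) = 1 := by
        rw [hT, Matrix.transvection_mul_transvection_same i j hij]; simp
      have h4 := congrArg (fun M => LinearMap.det (Rl M)) h3
      simp only [det_Rl_mul, h0, zero_mul, Rl_one, LinearMap.det_id] at h4
      exact zero_ne_one h4
    have h5 : LinearMap.det (Rl T) * (LinearMap.det (Rl T) - 1) * (Matrix.diagonal d).det ^ 5 = 0 := by linear_combination (-1 : ℝ) * h2
    rcases mul_eq_zero.1 h5 with h | h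
    · rcases mul_eq_zero.1 h with h | h
      · exact absurd h hT0
      · linarith
    · exact absurd h hd0
  · intro A B _ _ hA hB
    rw [det_Rl_mul, hA, hB, Matrix.det_mul, mul_pow]

/-! coordinates of constraints -/
theorem IsK.sym {s : X4} (h : IsK s) : s.m.transpose = s.m := by
  rcases h with ⟨v, -, rfl⟩ | ⟨g, rfl⟩
  · ext i j; rw [Matrix.transpose_apply, ou_m, ou_m]; ring
  · rw [smul_m]
    have : c0.m.transpose = c0.m := by decide +kernel
    simp [Matrix.transpose_mul, this, Matrix.mul_assoc]

def co (s : X4) : Fin 10 → ℝ := col (toR s.m)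

theorem co_smul (g : G4) {s : X4} (h : IsK s) : co (g • s) = Rl (toR g.1) (co s) := by
  rw [Rl_apply, co, co, mkl_col (by rw [← toR_tr, h.sym]), smul_m, toR_mul, toR_mul, toR_tr]
  rfl

/-- dual coordinates -/
def cov (M : R4) : Fin 10 → ℝ := fun a => if pp a = qq a then M (pp a) (qq a) else 2 * M (pp a) (qq a)
theorem co_cov {s : X4} (h : IsK s) {M : R4} (hM : ∀ i j, M i j = M j i) :
    ∑ a, co s a * cov M a = prR s M := by
  rw [prR_sum]
  have hs : ∀ i j, (s.m i j : ℝ) = s.m j i := by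
    intro i j
    rw [← Matrix.transpose_apply s.m i j, h.sym]
  have e : ∀ a, co s a = (s.m (pp a) (qq a) : ℝ) := fun a => rfl
  simp only [e, cov]
  simp [Fin.sum_univ_succ, pp, qq]
  rw [hs 1 0, hs 2 0, hs 3 0, hs 2 1, hs 3 1, hs 3 2, hM 1 0, hM 2 0, hM 3 0, hM 2 1, hM 3 1, hM 3 2]
  ring
noncomputable def uncov (m : Fin 10 → ℝ) : R4 := fun i j => if i = j then m (ix i j) else m (ix i j) / 2
theorem uncov_sym (m : Fin 10 → ℝ) (i j : Fin 4) : uncov m i j = uncov m j i := by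
  simp only [uncov, ix_comm i j, eq_comm]
theorem cov_uncov (m : Fin 10 → ℝ) : cov (uncov m) = m := by
  funext a
  simp only [cov, uncov, ix_pq]
  split_ifs <;> ring
theorem cov_zero {M : R4} (hM : ∀ i j, M i j = M j i) (h : cov M = 0) : M = 0 := by
  ext i j
  have h1 := congrFun h (ix i j)
  simp only [cov, Pi.zero_apply] at h1
  have h2 : M (pp (ix i j)) (qq (ix i j)) = 0 := by
    split_ifs at h1
    · exact h1
    · linarith
  rcases pq_ix i j with ⟨e1, e2⟩ | ⟨e1, e2⟩ <;> rw [e1, e2] at h2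
  · exact h2
  · rw [hM]; exact h2

/-- the volume form -/
noncomputable def dt (v : Fin 10 → Fin 10 → ℝ) : ℝ := Matrix.det (Matrix.of v)
theorem dt_eq (v : Fin 10 → Fin 10 → ℝ) : dt v = (Pi.basisFun ℝ (Fin 10)).det v := by
  exact (Pi.basisFun_det_apply v).symm
theorem dt_Rl (g : R4) (v : Fin 10 → Fin 10 → ℝ) : dt (fun a => Rl g (v a)) = LinearMap.det (Rl g) * dt v := by
  rw [dt_eq, dt_eq]
  exact Module.Basis.det_comp _ _ _
theorem dt_perm (v : Fin 10 → Fin 10 → ℝ) (π : Perm (Fin 10)) : dt (v ∘ π) = ((Perm.sign π : ℤ) : ℝ) * dt v := by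
  rw [dt_eq, dt_eq, AlternatingMap.map_perm]
  rw [Units.smul_def, zsmul_eq_mul]
theorem dt_zero (v : Fin 10 → Fin 10 → ℝ) {m : Fin 10 → ℝ} (hm : m ≠ 0) (h : ∀ a, ∑ b, v a b * m b = 0) : dt v = 0 := by
  refine Matrix.exists_mulVec_eq_zero_iff.1 ⟨m, hm, ?_⟩
  funext a
  exact h a
theorem dt_cons (x y : Fin 10 → ℝ) (a b : ℝ) (u : Fin 9 → Fin 10 → ℝ) :
    dt (Fin.cons (a • x + b • y) u) = a * dt (Fin.cons x u) + b * dt (Fin.cons y u) := by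
  have e : ∀ z : Fin 10 → ℝ, (Fin.cons z u : Fin 10 → Fin 10 → ℝ) = Function.update (Fin.cons 0 u : Fin 10 → Fin 10 → ℝ) 0 z := by
    intro z; rw [Fin.update_cons_zero]
  rw [e, e x, e y, dt_eq, dt_eq, dt_eq, AlternatingMap.map_update_add, AlternatingMap.map_update_smul, AlternatingMap.map_update_smul]
  rfl

open Equiv
open Pointwise

/-- enumeration of the facets at a vertex -/
def En (P : V4) (t : Fin 10 → X4) : Prop := Function.Injective t ∧ Set.range t = S4 P

theorem exists_En (P : V4) : ∃ t, En P t := by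
  obtain e := (S4 P).equivFinOfCardEq (card_S4 P)
  refine ⟨fun i => (e.symm i : X4), fun i j h => e.symm.injective (Subtype.ext h), ?_⟩
  ext s
  constructor
  · rintro ⟨i, rfl⟩; exact (e.symm i).2
  · intro hs; exact ⟨e ⟨s, hs⟩, by simp⟩

theorem perm_of_range {X : Type*} {k : ℕ} {t u : Fin k → X} (ht : Function.Injective t) (hu : Function.Injective u)
    (h : Set.range u = Set.range t) : ∃ π : Perm (Fin k), u = t ∘ π := by
  have h1 : ∀ i, ∃ j, t j = u i := fun i => by
    have : u i ∈ Set.range t := h ▸ ⟨i, rfl⟩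
    exact this
  choose π hπ using h1
  have hinj : Function.Injective π := fun i j hij => hu (by rw [← hπ, ← hπ, hij])
  refine ⟨Equiv.ofBijective π (Finite.injective_iff_bijective.1 hinj), ?_⟩
  funext i
  exact (hπ i).symm

theorem En_perm {P : V4} {t u : Fin 10 → X4} (ht : En P t) (hu : En P u) : ∃ π : Perm (Fin 10), u = t ∘ π :=
  perm_of_range ht.1 hu.1 (by rw [ht.2, hu.2])

theorem En_of_sub {P : V4} {t : Fin 10 → X4} (ht : Function.Injective t) (h : Set.range t ⊆ S4 P) : En P t := by
  refine ⟨ht, ?_⟩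
  have h1 : Finset.univ.image t = S4 P := by
    apply Finset.eq_of_subset_of_card_le
    · intro s hs
      simp only [Finset.mem_image, Finset.mem_univ, true_and] at hs
      obtain ⟨i, rfl⟩ := hs
      exact h ⟨i, rfl⟩
    · rw [Finset.card_image_of_injective _ ht, card_S4]; simp
  rw [← h1]; simp

theorem En_of_mem {φ : (Fin 10 → X4) → ℂ} (h : φ ∈ DD Ce 10) {t : Fin 10 → X4} (ht : φ t ≠ 0) : ∃ P, En P t := by
  obtain ⟨⟨P, hP⟩, -⟩ := DD.cell h ht
  exact ⟨P, En_of_sub (h.1.inj ht) hP⟩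

theorem eq_of_S4_sub {P Q : V4} (h : (S4 P : Set X4) ⊆ S4 Q) : Q = P := by
  by_contra hne
  obtain ⟨t, ht⟩ := exists_En P
  have hs : t 0 ∈ S4 P := by rw [← Finset.mem_coe, ← ht.2]; exact ⟨0, rfl⟩
  rcases edge_eq hs (fun s' hs' _ => h hs') with h1 | h1
  · exact hne h1
  · have := (nb4_spec P hs).1
    have h2 : t 0 ∈ S4 Q := h hs
    rw [← h1, (mem_S4.1 h2).2] at this
    exact lt_irrefl _ this

theorem En.cell {P : V4} {t : Fin 10 → X4} (h : En P t) : Ce (Set.range t) := by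
  rw [h.2]
  exact ⟨⟨P, le_refl (S4 P : Set X4)⟩, (Set.finite_singleton P).subset fun Q hQ => eq_of_S4_sub hQ⟩

/-- two sided edges -/
structure Edge (P : V4) (s0 : X4) (u : Fin 9 → X4) (N : V4) (s1 : X4) : Prop where
  e0 : En P (Fin.cons s0 u)
  e1 : En N (Fin.cons s1 u)
  a : 136 < pr s0 N.1
  b : 136 < pr s1 P.1
  hN : N = nb4 P s0
  only : ∀ Q : V4, Set.range u ⊆ S4 Q → Q = P ∨ Q = N

theorem exists_edge {P : V4} {s0 : X4} {u : Fin 9 → X4} (h : En P (Fin.cons s0 u)) :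
    ∃ N s1, Edge P s0 u N s1 := by
  have hr : (S4 P : Set X4) = insert s0 (Set.range u) := by rw [← h.2, Fin.range_cons]
  have hs0 : s0 ∈ S4 P := by rw [← Finset.mem_coe, hr]; exact Set.mem_insert _ _
  have hs0u : s0 ∉ Set.range u := (Fin.cons_injective_iff.1 h.1).1
  have hui : Function.Injective u := (Fin.cons_injective_iff.1 h.1).2
  have hmem : ∀ s' ∈ S4 P, s' ≠ s0 → s' ∈ Set.range u := by
    intro s' hs' hne
    rw [← Finset.mem_coe, hr] at hs'
    exact hs'.resolve_left hne
  set N := nb4 P s0 with hN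
  have hNs := nb4_spec P hs0
  rw [← hN] at hNs
  have hu : Set.range u ⊆ S4 N := by
    intro s hs
    have hsP : s ∈ S4 P := by rw [← Finset.mem_coe, hr]; exact Set.mem_insert_of_mem _ hs
    exact mem_S4.2 ⟨(mem_S4.1 hsP).1, hNs.2 s hsP (by rintro rfl; exact hs0u hs)⟩
  have hex : ∃ s1 ∈ S4 N, s1 ∉ Set.range u := by
    by_contra hc
    push Not at hc
    have : (S4 N) ⊆ Finset.univ.image u := by
      intro s hs
      obtain ⟨i, rfl⟩ := hc s hs
      exact Finset.mem_image_of_mem _ (Finset.mem_univ _)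
    have := Finset.card_le_card this
    rw [card_S4] at this
    have h2 := Finset.card_image_le (s := (Finset.univ : Finset (Fin 9))) (f := u)
    simp at h2
    omega
  obtain ⟨s1, hs1, hs1u⟩ := hex
  have hs1P : s1 ∉ S4 P := by
    intro h1
    by_cases h2 : s1 = s0
    · subst h2
      have := hNs.1
      rw [(mem_S4.1 hs1).2] at this
      exact lt_irrefl _ this
    · exact hs1u (hmem s1 h1 h2)
  refine ⟨N, s1, h, ?_, hNs.1, ?_, hN, ?_⟩
  · refine En_of_sub (Fin.cons_injective_iff.2 ⟨hs1u, hui⟩) ?_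
    rw [Fin.range_cons]
    rintro s (rfl | hs)
    · exact hs1
    · exact hu hs
  · have hK := (mem_S4.1 hs1).1
    exact lt_of_le_of_ne (Vx_ge P.2 hK) (fun h => hs1P (mem_S4.2 ⟨hK, h.symm⟩))
  · intro Q hQ
    exact edge_eq hs0 fun s' hs' hne => hQ (hmem s' hs' hne)

theorem Edge.cell {P s0 u N s1} (h : Edge P s0 u N s1) : Ce (Set.range u) := by
  refine ⟨⟨P, ?_⟩, ?_⟩
  · change _ ⊆ (S4 P : Set X4)
    rw [← h.e0.2, Fin.range_cons]; exact Set.subset_insert _ _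
  · exact (Set.toFinite ({P, N} : Set V4)).subset fun Q hQ => by
      rcases h.only Q hQ with rfl | rfl <;> simp

theorem Edge.ne {P s0 u N s1} (h : Edge P s0 u N s1) : s0 ≠ s1 := by
  rintro rfl
  have h1 : s0 ∈ S4 P := by rw [← Finset.mem_coe, ← h.e0.2]; exact ⟨0, rfl⟩
  have := h.b
  rw [(mem_S4.1 h1).2] at this
  exact lt_irrefl _ this

theorem Edge.bd {P s0 u N s1} (h : Edge P s0 u N s1) {φ : (Fin 10 → X4) → ℂ} (hφ : φ ∈ DD Ce 10) :
    bd Ce φ u = φ (Fin.cons s0 u) + φ (Fin.cons s1 u) := by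
  rw [bd_of_cell h.cell, finsum_eq_sum_of_support_subset (s := {s0, s1}), Finset.sum_pair h.ne]
  intro s hs
  have hs' : φ (Fin.cons s u) ≠ 0 := hs
  obtain ⟨Q, hQ⟩ := En_of_mem hφ hs'
  have hsu := (Fin.cons_injective_iff.1 hQ.1).1
  have hsQ : s ∈ S4 Q := by rw [← Finset.mem_coe, ← hQ.2]; exact ⟨0, rfl⟩
  have huQ : Set.range u ⊆ S4 Q := by rw [← hQ.2, Fin.range_cons]; exact Set.subset_insert _ _
  rcases h.only Q huQ with rfl | rfl
  · rw [← Finset.mem_coe, ← h.e0.2, Fin.range_cons] at hsQ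
    simp [hsQ.resolve_right hsu]
  · rw [← Finset.mem_coe, ← h.e1.2, Fin.range_cons] at hsQ
    simp [hsQ.resolve_right hsu]

/-- any nonzero value at a codim 1 cell gives an edge -/
theorem exists_edge' {u : Fin 9 → X4} (hu : Function.Injective u) (hc : Ce (Set.range u)) :
    ∃ P s0 N s1, Edge P s0 u N s1 := by
  obtain ⟨⟨P, hP⟩, -⟩ := hc
  have hP' : Set.range u ⊆ S4 P := hP
  have hex : ∃ s1 ∈ S4 P, s1 ∉ Set.range u := by
    by_contra hc
    push Not at hc
    have : (S4 P) ⊆ Finset.univ.image u := by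
      intro s hs
      obtain ⟨i, rfl⟩ := hc s hs
      exact Finset.mem_image_of_mem _ (Finset.mem_univ _)
    have := Finset.card_le_card this
    rw [card_S4] at this
    have h2 := Finset.card_image_le (s := (Finset.univ : Finset (Fin 9))) (f := u)
    simp at h2
    omega
  obtain ⟨s0, hs0, hs0u⟩ := hex
  refine ⟨P, s0, exists_edge (En_of_sub (Fin.cons_injective_iff.2 ⟨hs0u, hu⟩) ?_)⟩
  rw [Fin.range_cons]
  rintro s (rfl | hs)
  · exact hs0
  · exact hP' hs

open Classical in
noncomputable def om (t : Fin 10 → X4) : ℂ :=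
  if Ce (Set.range t) then ((SignType.sign (dt (co ∘ t)) : ℤ) : ℂ) else 0

theorem om_of_cell {t : Fin 10 → X4} (h : Ce (Set.range t)) : om t = ((SignType.sign (dt (co ∘ t)) : ℤ) : ℂ) := if_pos h

theorem sign_unit_mul (e : ℤˣ) (x : ℝ) : ((SignType.sign (((e : ℤ) : ℝ) * x) : ℤ) : ℂ) =
    ((e : ℤ) : ℂ) * ((SignType.sign x : ℤ) : ℂ) := by
  rcases Int.units_eq_one_or e with rfl | rfl
  · simp
  · simp [Left.sign_neg]

theorem om_mem : om ∈ DD Ce 10 := by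
  refine ⟨fun t π => ?_, fun t ht => ?_⟩
  · have hr : Set.range (t ∘ π) = Set.range t := by
      rw [Set.range_comp, π.surjective.range_eq, Set.image_univ]
    by_cases h : Ce (Set.range t)
    · rw [om_of_cell h, om_of_cell (by rwa [hr]), ← Function.comp_assoc, dt_perm, sign_unit_mul]
    · rw [om, om, if_neg h, if_neg (by rwa [hr]), mul_zero]
  · by_contra h
    exact ht (if_neg h)

theorem En.K {P : V4} {t : Fin 10 → X4} (h : En P t) (i : Fin 10) : t i ∈ S4 P := by
  rw [← Finset.mem_coe, ← h.2]; exact ⟨i, rfl⟩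

theorem dt_ne {P : V4} {t : Fin 10 → X4} (h : En P t) : dt (co ∘ t) ≠ 0 := by
  intro h0
  obtain ⟨m, hm, hm2⟩ := Matrix.exists_mulVec_eq_zero_iff.2 h0
  apply hm
  have h1 : uncov m = 0 := by
    apply sep P (uncov_sym m)
    intro s hs
    rw [← Finset.mem_coe, ← h.2] at hs
    obtain ⟨i, rfl⟩ := hs
    rw [← co_cov (mem_S4.1 (h.K i)).1 (uncov_sym m), cov_uncov]
    exact congrFun hm2 i
  rw [← cov_uncov m, h1]
  funext a
  simp [cov]

theorem Edge.mem {P s0 u N s1} (h : Edge P s0 u N s1) (i : Fin 9) : u i ∈ S4 P ∧ u i ∈ S4 N :=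
  ⟨by have := h.e0.K i.succ; rwa [Fin.cons_succ] at this, by have := h.e1.K i.succ; rwa [Fin.cons_succ] at this⟩

theorem toR_sym (P : V4) (i j : Fin 4) : toR P.1 i j = toR P.1 j i := by
  rw [toR_apply, toR_apply, ← Matrix.transpose_apply P.1 i j, Vx_sym P.2]

theorem Edge.dt {P s0 u N s1} (h : Edge P s0 u N s1) : ∃ a b : ℝ, 0 < a ∧ 0 < b ∧
    b * dt (Fin.cons (co s0) (co ∘ u)) + a * dt (Fin.cons (co s1) (co ∘ u)) = 0 := by
  refine ⟨(pr s0 N.1 : ℝ) - 136, (pr s1 P.1 : ℝ) - 136, ?_, ?_, ?_⟩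
  · have : (136 : ℝ) < pr s0 N.1 := by exact_mod_cast h.a
    linarith
  · have : (136 : ℝ) < pr s1 P.1 := by exact_mod_cast h.b
    linarith
  have hs0 : s0 ∈ S4 P := h.e0.K 0
  have hs1 : s1 ∈ S4 N := h.e1.K 0
  rw [← dt_cons]
  have hsym : ∀ i j, (toR N.1 - toR P.1) i j = (toR N.1 - toR P.1) j i := by
    intro i j
    rw [Matrix.sub_apply, Matrix.sub_apply, toR_sym, toR_sym P]
  apply dt_zero (m := cov (toR N.1 - toR P.1))
  · intro h0
    have h1 := cov_zero hsym h0
    have h2 := congrArg (prR s0) h1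
    rw [map_sub, map_zero, prR_toR, prR_toR, (mem_S4.1 hs0).2] at h2
    have : (136 : ℝ) < pr s0 N.1 := by exact_mod_cast h.a
    push_cast at h2
    linarith
  · intro a
    refine Fin.cases ?_ (fun i => ?_) a
    · rw [Fin.cons_zero]
      simp only [Pi.add_apply, Pi.smul_apply, smul_eq_mul, add_mul, Finset.sum_add_distrib, mul_assoc]
      rw [← Finset.mul_sum, ← Finset.mul_sum, co_cov (mem_S4.1 hs0).1 hsym, co_cov (mem_S4.1 hs1).1 hsym,
        map_sub, map_sub, prR_toR, prR_toR, prR_toR, prR_toR, (mem_S4.1 hs0).2, (mem_S4.1 hs1).2]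
      push_cast; ring
    · rw [Fin.cons_succ, Function.comp_apply, co_cov (mem_S4.1 (h.mem i).1).1 hsym, map_sub, prR_toR, prR_toR,
        (mem_S4.1 (h.mem i).1).2, (mem_S4.1 (h.mem i).2).2, sub_self]

theorem comp_cons' {X Y : Type*} {k : ℕ} (f : X → Y) (x : X) (u : Fin k → X) :
    f ∘ (Fin.cons x u : Fin (k+1) → X) = Fin.cons (f x) (f ∘ u) := by
  funext i; refine Fin.cases rfl (fun i => rfl) i

theorem om_coc : bd Ce om = 0 := by
  funext u
  by_contra hne
  have hne' : bd Ce om u ≠ 0 := hne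
  obtain ⟨P, s0, N, s1, h⟩ := exists_edge' ((bd_mem om_mem).1.inj hne') ((bd_mem om_mem).2 u hne')
  apply hne'
  rw [h.bd om_mem, om_of_cell h.e0.cell, om_of_cell h.e1.cell, comp_cons', comp_cons']
  obtain ⟨a, b, ha, hb, hab⟩ := h.dt
  have h0 := dt_ne h.e0
  rw [comp_cons'] at h0
  rcases lt_or_gt_of_ne h0 with h2 | h2
  · have h3 : 0 < dt (Fin.cons (co s1) (co ∘ u)) := by
      by_contra h4
      nlinarith [mul_pos_of_neg_of_neg (neg_lt_zero.2 hb) h2, mul_nonneg ha.le (neg_nonneg.2 (not_lt.1 h4))]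
    rw [sign_neg h2, sign_pos h3]; simp
  · have h3 : dt (Fin.cons (co s1) (co ∘ u)) < 0 := by
      by_contra h4
      nlinarith [mul_pos hb h2, mul_nonneg ha.le (not_lt.1 h4)]
    rw [sign_pos h2, sign_neg h3]; simp

abbrev ch : G4 →* ℤˣ := Matrix.GeneralLinearGroup.det

theorem toR_det (g : G4) : (toR g.1).det = (((ch g : ℤˣ) : ℤ) : ℝ) := by
  have : (toR g.1).det = ((g.1.det : ℤ) : ℝ) := (Int.castRingHom ℝ).map_det g.1 |>.symm
  rw [this]; rfl

theorem om_inv : IsInv ch om := by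
  intro g t
  have hr : Set.range (g • t) = g • Set.range t := range_smul' g t
  by_cases h : Ce (Set.range t)
  · rw [om_of_cell h, om_of_cell (by rw [hr]; exact cellSys.inv g _ h)]
    have hK : ∀ i, IsK (t i) := by
      obtain ⟨⟨P, hP⟩, -⟩ := h
      intro i
      exact (mem_S4.1 (hP ⟨i, rfl⟩)).1
    have e : co ∘ (g • t) = fun a => Rl (toR g.1) ((co ∘ t) a) := by
      funext a
      exact co_smul g (hK a)
    have hd : (toR g.1).det ≠ 0 := by
      rw [toR_det]
      rcases Int.units_eq_one_or (ch g) with h | h <;> rw [h] <;> simp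
    rw [e, dt_Rl, det_Rl _ hd, toR_det]
    have : (((ch g : ℤˣ) : ℤ) : ℝ)^5 = (((ch g : ℤˣ) : ℤ) : ℝ) := by
      rcases Int.units_eq_one_or (ch g) with h | h <;> rw [h] <;> norm_num
    rw [this, sign_unit_mul]; rfl
  · rw [om, om, if_neg h, if_neg (by rwa [hr, cellSys.iff]), mul_zero]

theorem om_ne_of_En {P : V4} {t : Fin 10 → X4} (h : En P t) : om t ≠ 0 := by
  rw [om_of_cell h.cell]
  have := dt_ne h
  rcases lt_or_gt_of_ne this with h2 | h2
  · rw [sign_neg h2]; simp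
  · rw [sign_pos h2]; simp

def V0 : V4 := ⟨base 0, 1, 0, by rw [fa_one]⟩

theorem om_ne : om ≠ 0 := by
  obtain ⟨t, ht⟩ := exists_En V0
  intro h
  exact om_ne_of_En ht (by rw [h]; rfl)

theorem om_top {φ : (Fin 10 → X4) → ℂ} (hφ : φ ∈ DD Ce 10) (hc : bd Ce φ = 0) : ∃ c : ℂ, φ = c • om := by
  -- minimal vertex
  obtain ⟨P0, -, hmin⟩ := (f4_fin (f4 V0)).exists_minimalFor f4 _ ⟨V0, le_refl (f4 V0)⟩
  have hmin' : ∀ Q : V4, f4 P0 ≤ f4 Q := by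
    intro Q
    rcases le_total (f4 Q) (f4 P0) with h | h
    · by_cases hQ : f4 Q ≤ f4 V0
      · exact hmin hQ h
      · have h1 := hmin (j := V0) (le_refl (f4 V0))
        rcases le_total (f4 V0) (f4 P0) with h2 | h2
        · exact (h1 h2).trans (not_le.1 hQ).le
        · exact h2.trans (not_le.1 hQ).le
    · exact h
  obtain ⟨t0, ht0⟩ := exists_En P0
  refine ⟨φ t0 / om t0, ?_⟩
  set ψ := φ - (φ t0 / om t0) • om with hψ
  have hψm : ψ ∈ DD Ce 10 := Submodule.sub_mem _ hφ (Submodule.smul_mem _ _ om_mem)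
  have hψc : bd Ce ψ = 0 := by
    rw [hψ, bd_sub A4p.good hφ (Submodule.smul_mem _ _ om_mem), bd_smul, om_coc, hc]; simp
  have hψ0 : ψ t0 = 0 := by
    rw [hψ, Pi.sub_apply, Pi.smul_apply, smul_eq_mul, div_mul_cancel₀ _ (om_ne_of_En ht0), sub_self]
  have key : ∀ n : ℕ, ∀ P : V4, A4p.rk P < n → ∀ t, En P t → ψ t = 0 := by
    intro n
    induction n with
    | zero => intro P h; omega
    | succ n ih =>
      intro P hP t ht
      by_cases hlow : ∃ s ∈ S4 P, f4 (nb4 P s) < f4 P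
      · obtain ⟨s, hs, hlt⟩ := hlow
        have hst : s ∈ Set.range t := by rw [ht.2]; exact hs
        obtain ⟨u, π, hu⟩ := exists_cons_perm t hst
        have hE : En P (Fin.cons s u) := by
          refine ⟨?_, ?_⟩
          · have := ht.1
            rw [hu] at this
            exact (Function.Injective.of_comp_iff' _ π.bijective).1 this
          · rw [← ht.2, hu, Set.range_comp, π.surjective.range_eq, Set.image_univ]
        obtain ⟨N, s1, he⟩ := exists_edge hE
        have h1 := he.bd hψm
        rw [hψc] at h1
        have hrk : A4p.rk N < n := by
          have : A4p.rk N < A4p.rk P := A4p.rk_lt (by rw [he.hN]; exact hlt)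
          omega
        rw [ih N hrk _ he.e1, add_zero] at h1
        rw [hu, hψm.1, ← h1]; simp
      · push Not at hlow
        have hPP : P = P0 := f4_inj (le_antisymm (min_of_local hlow P0) (hmin' P))
        subst hPP
        obtain ⟨π, hπ⟩ := En_perm ht0 ht
        rw [hπ, hψm.1, hψ0, mul_zero]
  have hz : ψ = 0 := by
    funext t
    by_contra hne
    obtain ⟨P, hP⟩ := En_of_mem hψm hne
    exact hne (key _ P (Nat.lt_succ_self _) t hP)
  exact sub_eq_zero.1 hz

open Equiv
open Pointwise

theorem C_unique {P : V4} {c c' : X4} (h : c ∈ S4 P) (h' : c' ∈ S4 P) (hc : IsC c) (hc' : IsC c') : c = c' := by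
  obtain ⟨_, ⟨g, τ, rfl⟩⟩ := P
  have key : ∀ c : X4, IsC c → pr c (fa g (base τ)) = 136 → c = g • c0 := by
    rintro _ ⟨k, rfl⟩ hp
    have e : k • c0 = g • ((g⁻¹ * k) • c0) := by rw [← mul_smul, mul_inv_cancel_left]
    rw [e, pr_smul] at hp
    rw [e, ((base_C τ _).2 hp).2]
  rw [key c hc (mem_S4.1 h).2, key c' hc' (mem_S4.1 h').2]

theorem Ce_unique {σ : Set X4} (hσ : Ce σ) {c c' : X4} (h : c ∈ σ) (h' : c' ∈ σ) (hc : IsC c) (hc' : IsC c') :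
    c = c' := by
  obtain ⟨⟨P, hP⟩, -⟩ := hσ
  exact C_unique (hP h) (hP h') hc hc'

theorem lk_mem {k : ℕ} {η : (Fin (k+1) → X4) → ℂ} (h : η ∈ DD Ce (k+1)) (c : X4) :
    (fun w => η (Fin.cons c w)) ∈ DD (lk c).Cell k := by
  refine ⟨h.1.cons c, fun t ht => ?_⟩
  have h1 := h.2 _ ht
  have h2 := h.1.inj ht
  rw [lk_cell]
  rw [Fin.range_cons] at h1
  exact ⟨(Fin.cons_injective_iff.1 h2).1, h1⟩

theorem bd_lk {k : ℕ} {η : (Fin (k+2) → X4) → ℂ} (h : η ∈ DD Ce (k+2)) (c : X4) (u : Fin k → X4) :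
    bd Ce η (Fin.cons c u) = - bd (lk c).Cell (fun w => η (Fin.cons c w)) u := by
  by_cases hu : (lk c).Cell (Set.range u)
  · have hu' := (lk_cell c _).1 hu
    rw [bd_of_cell hu, bd_of_cell (by rw [Fin.range_cons]; exact hu'.2), ← finsum_neg_distrib]
    exact finsum_congr fun s => h.1.cons_swap _ _ _
  · rw [bd_of_not hu, neg_zero]
    by_contra hne
    exact hu ((lk_mem (bd_mem h) c).2 u hne)

theorem bd_sum {X ι : Type*} {Cell : Set X → Prop} (hC : GoodCells Cell) {k : ℕ} (s : Finset ι)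
    (f : ι → (Fin (k+1) → X) → ℂ) (hf : ∀ i, f i ∈ DD Cell (k+1)) :
    bd Cell (∑ i ∈ s, f i) = ∑ i ∈ s, bd Cell (f i) := by
  classical
  induction s using Finset.induction_on with
  | empty => simp [bd_zero]
  | insert a s ha ih =>
    rw [Finset.sum_insert ha, Finset.sum_insert ha, bd_add hC (hf a) (Submodule.sum_mem _ fun i _ => hf i), ih]

theorem avgI {H X : Type} [Group H] [Finite H] [MulAction H X] {Cell : Set X → Prop} (χ : H →* ℤˣ)
    (hC : CellSys (G := H) Cell) {k : ℕ} {η : (Fin (k+1) → X) → ℂ} (hη : η ∈ DD Cell (k+1))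
    (hi : IsInv χ (bd Cell η)) : ∃ η' ∈ DD Cell (k+1), IsInv χ η' ∧ bd Cell η' = bd Cell η := by
  have := Fintype.ofFinite H
  have hm : ∀ h : H, act χ h η ∈ DD Cell (k+1) := fun h => act_mem χ hC h hη
  refine ⟨((Fintype.card H : ℂ))⁻¹ • ∑ h, act χ h η, Submodule.smul_mem _ _ (Submodule.sum_mem _ fun i _ => hm i), ?_, ?_⟩
  · rw [inv_iff_act]
    intro g
    rw [map_smul, map_sum]
    congr 1
    refine Fintype.sum_equiv (Equiv.mulLeft g) _ _ fun h => ?_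
    rw [← act_mul]; rfl
  · rw [bd_smul, bd_sum hC.good _ _ hm]
    have : ∀ h : H, bd Cell (act χ h η) = bd Cell η := fun h => by
      rw [bd_act χ hC, (inv_iff_act χ _).1 hi]
    have hne : (Fintype.card H : ℂ) ≠ 0 := by exact_mod_cast Fintype.card_ne_zero
    simp only [this, Finset.sum_const, Finset.card_univ]
    rw [← Nat.cast_smul_eq_nsmul ℂ, smul_smul, inv_mul_cancel₀ hne, one_smul]

abbrev H0 : Subgroup G4 := MulAction.stabilizer G4 c0
instance : Finite H0 := stabC_finite.to_subtype
abbrev ch0 : H0 →* ℤˣ := ch.comp H0.subtype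

theorem cellSys0 : CellSys (G := H0) (lk c0).Cell where
  good := (lk c0).good
  inv g σ h := by
    rw [lk_cell] at h ⊢
    have hg : (g : G4) • c0 = c0 := g.2
    have e : insert c0 (g • σ) = (g : G4) • insert c0 σ := by
      rw [Set.smul_set_insert, hg]; rfl
    refine ⟨fun hc => h.1 ?_, by rw [e]; exact cellSys.inv _ _ h.2⟩
    obtain ⟨x, hx, hxc⟩ := hc
    have : (g : G4) • x = (g : G4) • c0 := by rw [hg]; exact hxc
    rwa [← smul_left_cancel _ this]
  stab σ _ := Set.toFinite _

/-- no facet of the second kind -/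
def CV {k : ℕ} (φ : (Fin k → X4) → ℂ) : Prop := ∀ t, φ t ≠ 0 → ∀ i, ¬ IsC (t i)

theorem wedge_inv {k : ℕ} {B : X4 → (Fin k → X4) → ℂ} (hB : ∀ (g : G4) c w, B (g • c) (g • w) = sg ch g * B c w) :
    IsInv ch (wedge B) := by
  intro g t
  unfold wedge
  rw [mul_left_comm]
  congr 1
  rw [Finset.mul_sum]
  refine Finset.sum_congr rfl fun π _ => ?_
  rw [show (g • t) ∘ π ∘ Fin.succ = g • (t ∘ π ∘ Fin.succ) from rfl, Pi.smul_apply, hB]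
  ring

theorem wedge_supp {X : Type*} {k : ℕ} {B : X → (Fin k → X) → ℂ} {t : Fin (k+1) → X} (h : wedge B t ≠ 0) :
    ∃ π : Perm (Fin (k+1)), B (t (π 0)) (t ∘ π ∘ Fin.succ) ≠ 0 := by
  by_contra hc
  push Not at hc
  exact h (by unfold wedge; simp [hc])

theorem kill_c {k : ℕ} (hk : k < 9) {φ : (Fin (k+1) → X4) → ℂ} (hφ : φ ∈ DD Ce (k+1)) (hco : bd Ce φ = 0)
    (hi : IsInv ch φ) : ∃ η ∈ DD Ce (k+2), IsInv ch η ∧ CV (φ - bd Ce η) := by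
  classical
  have h1 : Polyh.Coc (lk c0).Cell k (fun w => φ (Fin.cons c0 w)) := by
    cases k with
    | zero => trivial
    | succ k =>
      change bd _ _ = 0
      funext u
      have := bd_lk hφ c0 u
      rw [hco] at this
      simpa using this.symm
  obtain ⟨η0, hη0, hb0⟩ := (lk c0).exact (lk_card c0) hk (lk_mem hφ c0) h1
  have hi0 : IsInv ch0 (bd (lk c0).Cell η0) := by
    rw [hb0]
    intro g t
    have hg : (g : G4) • c0 = c0 := g.2
    have := hi (g : G4) (Fin.cons c0 t)
    rw [smul_cons, hg] at this
    exact this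
  obtain ⟨η1, hη1, hi1, hb1⟩ := avgI ch0 cellSys0 hη0 hi0
  rw [hb0] at hb1
  let B : X4 → (Fin (k+1) → X4) → ℂ := fun c w =>
    if h : IsC c then sg ch h.choose * η1 (h.choose⁻¹ • w) else 0
  have hBg : ∀ (g : G4) w, B (g • c0) w = sg ch g * η1 (g⁻¹ • w) := by
    intro g w
    have h : IsC (g • c0) := ⟨g, rfl⟩
    have hs := h.choose_spec
    simp only [B, dif_pos h]
    generalize h.choose = g' at hs
    have hm : g⁻¹ * g' ∈ H0 := by
      rw [MulAction.mem_stabilizer_iff, mul_smul, ← hs, inv_smul_smul]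
    have := hi1 ⟨g⁻¹ * g', hm⟩ (g'⁻¹ • w)
    have e : (⟨g⁻¹ * g', hm⟩ : H0) • (g'⁻¹ • w) = g⁻¹ • w := by
      change (g⁻¹ * g') • (g'⁻¹ • w) = _
      rw [← mul_smul, mul_inv_cancel_right]
    rw [e] at this
    have e2 : sg ch0 (⟨g⁻¹ * g', hm⟩ : H0) = sg ch g * sg ch g' := by
      change sg ch (g⁻¹ * g') = _
      rw [sg_mul, sg_inv]
    rw [this, e2, ← mul_assoc, ← mul_assoc, sg_self, one_mul]
  have hBn : ∀ c w, ¬ IsC c → B c w = 0 := fun c w h => dif_neg h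
  have hBne : ∀ c w, B c w ≠ 0 → IsC c ∧ c ∉ Set.range w ∧ Ce (insert c (Set.range w)) := by
    intro c w h
    have hc : IsC c := by by_contra hc; exact h (hBn c w hc)
    refine ⟨hc, ?_⟩
    obtain ⟨g, rfl⟩ := hc
    rw [hBg] at h
    have h2 := hη1.2 _ (right_ne_zero_of_mul h)
    rw [lk_cell, range_smul', Set.mem_inv_smul_set_iff] at h2
    refine ⟨h2.1, ?_⟩
    have := cellSys.inv g _ h2.2
    rwa [Set.smul_set_insert, smul_inv_smul] at this
  have hBalt : ∀ c, Alt (B c) := by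
    intro c t π
    by_cases hc : IsC c
    · obtain ⟨g, rfl⟩ := hc
      rw [hBg, hBg, show g⁻¹ • (t ∘ π) = (g⁻¹ • t) ∘ π from rfl, hη1.1]; ring
    · rw [hBn _ _ hc, hBn _ _ hc, mul_zero]
  have hBi : ∀ (g : G4) c w, B (g • c) (g • w) = sg ch g * B c w := by
    intro g c w
    by_cases hc : IsC c
    · obtain ⟨k, rfl⟩ := hc
      rw [← mul_smul, hBg, hBg, sg_mul, mul_inv_rev, mul_smul, inv_smul_smul, mul_assoc]
    · rw [hBn _ _ hc, hBn _ _ (fun h => hc ((IsC.iff g).1 h)), mul_zero]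
  have hm : wedge B ∈ DD Ce (k+2) := by
    refine ⟨wedge_alt _, fun t ht => ?_⟩
    obtain ⟨π, hπ⟩ := wedge_supp ht
    have := (hBne _ _ hπ).2.2
    rwa [Polyh.insert_range_perm] at this
  have hcons : ∀ c w, IsC c → wedge B (Fin.cons c w) = B c w := by
    intro c w hc
    refine wedge_cons B c w (hBalt c) fun π hπ => ?_
    by_contra hne
    obtain ⟨a, b, d⟩ := hBne _ _ hne
    rw [Polyh.insert_range_perm] at d
    have e : (Fin.cons c w : Fin (k+2) → X4) (π 0) = c := Ce_unique d ⟨_, rfl⟩ ⟨0, rfl⟩ a hc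
    rw [e] at b
    apply b
    obtain ⟨j, hj⟩ := π.surjective 0
    have hj0 : j ≠ 0 := by rintro rfl; exact hπ hj
    obtain ⟨i, rfl⟩ := Fin.exists_succ_eq.2 hj0
    exact ⟨i, by simp [hj]⟩
  have hlk : ∀ (u : Fin k → X4), bd Ce (wedge B) (Fin.cons c0 u) = - φ (Fin.cons c0 u) := by
    intro u
    rw [bd_lk hm, show (fun w => wedge B (Fin.cons c0 w)) = η1 from ?_, hb1]
    funext w
    rw [hcons c0 w ⟨1, by simp⟩]
    have := hBg 1 w
    simpa [sg_one] using this
  have hi2 : IsInv ch (bd Ce (wedge B)) := by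
    rw [inv_iff_act]
    intro g
    rw [← bd_act ch cellSys, (inv_iff_act ch _).1 (wedge_inv hBi)]
  refine ⟨-wedge B, Submodule.neg_mem _ hm, ?_, ?_⟩
  · intro g t
    simp [wedge_inv hBi g t]
  · have e : bd Ce (-wedge B) = - bd Ce (wedge B) := by
      have := bd_smul (Cell := Ce) (-1 : ℂ) (φ := wedge B)
      simpa using this
    rw [e, sub_neg_eq_add]
    intro t ht i hc
    have hs : (φ + bd Ce (wedge B)) ∈ DD Ce (k+1) := Submodule.add_mem _ hφ (bd_mem hm)
    have hsi : ∀ (g : G4) t, (φ + bd Ce (wedge B)) (g • t) = sg ch g * (φ + bd Ce (wedge B)) t := by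
      intro g t
      simp only [Pi.add_apply, hi g t, hi2 g t]; ring
    obtain ⟨g, hg⟩ := hc
    obtain ⟨u, π, hu⟩ := exists_cons_perm t ⟨i, hg⟩
    apply ht
    have e3 : (Fin.cons (g • c0) u : Fin (k+1) → X4) = g • Fin.cons c0 (g⁻¹ • u) := by
      rw [smul_cons, smul_inv_smul]
    rw [hu, hs.1, e3, hsi, Pi.add_apply, hlk]
    simp

open Equiv
open Pointwise

/-- orientation reversing symmetries -/
def Killed {k : ℕ} (t : Fin k → X4) : Prop :=
  ∃ (h : G4) (π : Perm (Fin k)), h • t = t ∘ π ∧ ch h * Perm.sign π = -1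

theorem Killed.smul {k : ℕ} {t : Fin k → X4} (h : Killed t) (g : G4) : Killed (g • t) := by
  obtain ⟨x, π, h1, h2⟩ := h
  refine ⟨g * x * g⁻¹, π, ?_, ?_⟩
  · rw [mul_smul, inv_smul_smul, mul_smul, h1]; rfl
  · rw [map_mul, map_mul, map_inv, mul_comm (ch g), mul_inv_cancel_right]; exact h2

theorem Killed.of_smul {k : ℕ} {t : Fin k → X4} (g : G4) (h : Killed (g • t)) : Killed t := by
  simpa using h.smul g⁻¹

theorem Killed.zero {k : ℕ} {t : Fin k → X4} (h : Killed t) {φ : (Fin k → X4) → ℂ} (ha : Alt φ)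
    (hi : IsInv ch φ) : φ t = 0 := by
  obtain ⟨x, π, h1, h2⟩ := h
  have h3 := hi x t
  rw [h1, ha] at h3
  have h4 : ch x = - Perm.sign π := by
    rcases Int.units_eq_one_or (Perm.sign π) with h | h <;> rw [h] at h2 ⊢ <;> simpa using h2
  have h5 : sg ch x = - ((Perm.sign π : ℤ) : ℂ) := by
    unfold sg; rw [h4]; simp
  rw [h5] at h3
  have h6 : ((Perm.sign π : ℤ) : ℂ) ≠ 0 := fun h => by
    have := sign_mul_self' π
    rw [h] at this; simp at this
  have : 2 * ((Perm.sign π : ℤ) : ℂ) * φ t = 0 := by linear_combination h3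
  simpa [h6] using this

theorem wty2 : wty 2 9 = 0 := by decide +kernel
theorem wty1 : ∀ i : Fin 10, i ≠ 9 → wty 1 i = 2 := by decide +kernel

theorem nb_mv {k : ℕ} {t : Fin k → X4} {τ : Fin 3} {i : Fin 10} (h : Set.range t ⊆ Set.range (sv τ))
    (hi : sv τ i ∉ Set.range t) : Set.range ((wG τ i)⁻¹ • t) ⊆ Set.range (sv (wty τ i)) := by
  rw [range_smul', ← Sset_base, ← Set.subset_smul_set_iff, ← Sset_fa]
  intro s hs
  obtain ⟨j, rfl⟩ := h hs
  exact ⟨sv_K τ j, (base_nb τ i).2 j (by rintro rfl; exact hi hs)⟩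

theorem mv2 {k : ℕ} {t : Fin k → X4} (h : Set.range t ⊆ Set.range (sv 2)) (hc : ∀ i, ¬ IsC (t i)) :
    ∃ g : G4, Set.range (g • t) ⊆ Set.range (sv 0) := by
  refine ⟨_, (nb_mv (i := 9) h ?_).trans (by rw [wty2])⟩
  rintro ⟨i, hi⟩
  exact hc i ⟨1, by rw [hi, sv_c (by decide), one_smul]⟩

theorem mv {k : ℕ} {t : Fin k → X4} (h : Ce (Set.range t)) (hc : ∀ i, ¬ IsC (t i)) :
    (∃ g : G4, Set.range (g • t) ⊆ Set.range (sv 0)) ∨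
    (∃ g : G4, ∀ i : Fin 10, i ≠ 9 → sv 1 i ∈ Set.range (g • t)) := by
  obtain ⟨⟨P, hP⟩, -⟩ := h
  obtain ⟨_, ⟨g, τ, rfl⟩⟩ := P
  have h1 : Set.range (g⁻¹ • t) ⊆ Set.range (sv τ) := by
    rw [range_smul', ← Sset_base, ← Set.subset_smul_set_iff, ← Sset_fa]
    intro s hs
    exact mem_S4.1 (hP hs)
  have hc1 : ∀ i, ¬ IsC ((g⁻¹ • t) i) := fun i => by
    rw [Pi.smul_apply, IsC.iff]; exact hc i
  have hτ : τ = 0 ∨ τ = 1 ∨ τ = 2 := by clear h1 hP hc1; revert τ; decide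
  rcases hτ with rfl | rfl | rfl
  · exact Or.inl ⟨_, h1⟩
  · by_cases h2 : ∀ i : Fin 10, i ≠ 9 → sv 1 i ∈ Set.range (g⁻¹ • t)
    · exact Or.inr ⟨_, h2⟩
    · push Not at h2
      obtain ⟨i, hi, h2⟩ := h2
      have h3 := nb_mv h1 h2
      rw [wty1 i hi] at h3
      obtain ⟨g', hg'⟩ := mv2 h3 (fun i => by rw [Pi.smul_apply, IsC.iff]; exact hc1 i)
      rw [← mul_smul, ← mul_smul] at hg'
      exact Or.inl ⟨_, hg'⟩
  · obtain ⟨g', hg'⟩ := mv2 h1 hc1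
    rw [← mul_smul] at hg'
    exact Or.inl ⟨_, hg'⟩

theorem lift_sv {k : ℕ} {t : Fin k → X4} {τ : Fin 3} (h : Set.range t ⊆ Set.range (sv τ)) (ht : Function.Injective t) :
    ∃ a : Fin k → Fin 10, Function.Injective a ∧ t = sv τ ∘ a := by
  have : ∀ i, ∃ j, sv τ j = t i := fun i => h ⟨i, rfl⟩
  choose a ha using this
  exact ⟨a, fun i j hij => ht (by rw [← ha, ← ha, hij]), funext fun i => (ha i).symm⟩

theorem mv8 {k : ℕ} (hk : k ≤ 8) {t : Fin k → X4} (h : Ce (Set.range t)) (hc : ∀ i, ¬ IsC (t i))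
    (ht : Function.Injective t) : ∃ (g : G4) (a : Fin k → Fin 10), Function.Injective a ∧ g • t = sv 0 ∘ a := by
  have hinj : ∀ g : G4, Function.Injective (g • t) := fun g i j hij => ht (smul_left_cancel g hij)
  rcases mv h hc with ⟨g, hg⟩ | ⟨g, hg⟩
  · exact ⟨g, lift_sv hg (hinj g)⟩
  · exfalso
    have : ∀ i : Fin 9, ∃ j, (g • t) j = sv 1 (i.castSucc) := fun i => hg _ (by
      intro h; have := congrArg Fin.val h; simp at this; omega)
    choose f hf using this
    have hfi : Function.Injective f := fun i j hij => by
      have h1 := hf i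
      rw [hij, hf j] at h1
      exact (Fin.castSucc_injective _ (sv_inj 1 h1)).symm
    have := Fintype.card_le_of_injective f hfi
    simp at this
    omega

/-- explicit iteration over the ten edges -/
def allE (f : Fin 10 → Bool) : Bool := f 0 && f 1 && f 2 && f 3 && f 4 && f 5 && f 6 && f 7 && f 8 && f 9
def cnt (f : Fin 10 → Bool) : ℕ := (f 0).toNat + (f 1).toNat + (f 2).toNat + (f 3).toNat + (f 4).toNat +
  (f 5).toNat + (f 6).toNat + (f 7).toNat + (f 8).toNat + (f 9).toNat
theorem allE_iff {f : Fin 10 → Bool} : allE f = true ↔ ∀ e, f e = true := by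
  constructor
  · intro h e
    simp only [allE, Bool.and_eq_true] at h
    fin_cases e <;> simp_all
  · intro h; simp [allE, h]
theorem cnt_eq (f : Fin 10 → Bool) : cnt f = (Finset.univ.filter (fun e => f e = true)).card := by
  rw [Finset.card_filter]
  have : ∀ b : Bool, b.toNat = if b = true then 1 else 0 := by decide
  simp only [cnt, this, Fin.sum_univ_succ, Finset.univ_eq_empty, Finset.sum_empty]
  simp [Fin.sum_univ_succ]
  ring

/-- transposition of vertices -/
def sw (a b x : Fin 5) : Fin 5 := if x = a then b else if x = b then a else x
def gsm (a b : Fin 5) : M4 := fun r i =>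
  (if sw a b i.castSucc = r.castSucc then 1 else 0) - (if sw a b 4 = r.castSucc then 1 else 0)
theorem gsm_sq : ∀ a b, gsm a b * gsm a b = 1 := by decide +kernel
def gs (a b : Fin 5) : G4 := ⟨gsm a b, gsm a b, gsm_sq a b, gsm_sq a b⟩
def ei : Fin 10 → Fin 5 := ![0, 0, 0, 0, 1, 1, 1, 2, 2, 3]
def ej : Fin 10 → Fin 5 := ![1, 2, 3, 4, 2, 3, 4, 3, 4, 4]
def ixe : Fin 5 → Fin 5 → Fin 10 := ![![0, 0, 1, 2, 3], ![0, 0, 4, 5, 6], ![1, 4, 0, 7, 8], ![2, 5, 7, 0, 9], ![3, 6, 8, 9, 0]]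
def pe (a b : Fin 5) (e : Fin 10) : Fin 10 := ixe (sw a b (ei e)) (sw a b (ej e))
theorem gs_sv : ∀ a b e, gs a b • sv 0 e = sv 0 (pe a b e) := by decide +kernel
theorem gsm_det : ∀ a b, a ≠ b → (gsm a b).det = -1 := by decide +kernel
theorem gs_ch {a b : Fin 5} (h : a ≠ b) : ch (gs a b) = -1 := by
  apply Units.ext
  change (gsm a b).det = -1
  exact gsm_det a b h

def gl : List (Fin 5 × Fin 5) → G4
  | [] => 1
  | x :: l => gs x.1 x.2 * gl l
def pl : List (Fin 5 × Fin 5) → Fin 10 → Fin 10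
  | [], e => e
  | x :: l, e => pe x.1 x.2 (pl l e)
theorem gl_sv (l : List (Fin 5 × Fin 5)) (e : Fin 10) : gl l • sv 0 e = sv 0 (pl l e) := by
  induction l with
  | nil => simp [gl, pl]
  | cons x l ih => rw [gl, pl, mul_smul, ih, gs_sv]
theorem gl_ch {l : List (Fin 5 × Fin 5)} (h : ∀ x ∈ l, x.1 ≠ x.2) : ch (gl l) = (-1) ^ l.length := by
  induction l with
  | nil => simp [gl]
  | cons x l ih =>
    rw [gl, map_mul, gs_ch (h x (by simp)), ih (fun y hy => h y (by simp [hy])), List.length_cons, pow_succ']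

/-- involutions -/
def SL : List (List (Fin 5 × Fin 5)) := [[(0, 1)], [(0, 2)], [(0, 3)], [(0, 4)], [(1, 2)], [(1, 3)],
  [(1, 4)], [(2, 3)], [(2, 4)], [(3, 4)], [(0, 1), (2, 3)], [(0, 1), (2, 4)],
  [(0, 1), (3, 4)], [(0, 2), (1, 3)], [(0, 2), (1, 4)], [(0, 2), (3, 4)], [(0, 3), (1, 2)], [(0, 3), (1, 4)],
  [(0, 3), (2, 4)], [(0, 4), (1, 2)], [(0, 4), (1, 3)], [(0, 4), (2, 3)], [(1, 2), (3, 4)], [(1, 3), (2, 4)],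
  [(1, 4), (2, 3)]]
theorem SL_ok : ∀ l ∈ SL, (∀ x ∈ l, x.1 ≠ x.2) ∧ ∀ e, pl l (pl l e) = e := by decide +kernel

/-- reflections -/
def RT : List (ℕ × Fin 10 × ℕ) := [(1, 0, 14), (1, 1, 13), (1, 2, 11), (1, 3, 7), (2, 0, 112), (2, 4, 97), (2, 5, 81), (2, 6, 49),
  (3, 1, 124), (3, 2, 122), (3, 3, 118), (3, 4, 110), (3, 5, 94), (3, 6, 62), (4, 1, 400), (4, 4, 386),
  (4, 7, 274), (4, 8, 146), (5, 0, 412), (5, 2, 409), (5, 3, 405), (5, 4, 397), (5, 7, 285), (5, 8, 157),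
  (6, 0, 482), (6, 1, 481), (6, 5, 451), (6, 6, 419), (6, 7, 355), (6, 8, 227), (7, 2, 488), (7, 3, 484),
  (7, 5, 460), (7, 6, 428), (7, 7, 364), (7, 8, 236), (8, 2, 672), (8, 5, 644), (8, 7, 548), (8, 9, 164),
  (9, 0, 682), (9, 1, 681), (9, 3, 675), (9, 5, 651), (9, 7, 555), (9, 9, 171), (10, 0, 724), (10, 2, 721),
  (10, 4, 709), (10, 6, 661), (10, 7, 597), (10, 9, 213), (11, 1, 728), (11, 3, 722), (11, 4, 714), (11, 6, 666),
  (11, 7, 602), (11, 9, 218), (12, 1, 820), (12, 2, 818), (12, 4, 806), (12, 5, 790), (12, 8, 566), (12, 9, 310),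
  (13, 0, 824), (13, 3, 817), (13, 4, 809), (13, 5, 793), (13, 8, 569), (13, 9, 313), (14, 0, 838), (14, 1, 837),
  (14, 2, 835), (14, 6, 775), (14, 8, 583), (14, 9, 327), (15, 3, 832), (15, 6, 776), (15, 8, 584), (15, 9, 328)]
def lv (A : ℕ) (i : Fin 5) : ℤ := if A.testBit i then 1 else 0
def rfm (A : ℕ) (e : Fin 10) : M4 := fun r c => (if r = c then 1 else 0) -
  2 * (lv A (ei e) - lv A (ej e)) * vec 0 e r * lv A c.castSucc
theorem RT_ok : ∀ x ∈ RT, rfm x.1 x.2.1 * rfm x.1 x.2.1 = 1 ∧ (rfm x.1 x.2.1).det = -1 ∧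
    ∀ e : Fin 10, x.2.2.testBit e = false → (rfm x.1 x.2.1).mulVec (vec 0 e) = vec 0 e ∨
      (rfm x.1 x.2.1).mulVec (vec 0 e) = - vec 0 e := by decide +kernel

theorem ou_neg (v : Fin 4 → ℤ) : ou (-v) = ou v := by
  apply X4.ext'; funext i j; simp [ou_m]

theorem RT_ok' {x : ℕ × Fin 10 × ℕ} (hx : x ∈ RT) : ∃ h : G4, ch h = -1 ∧ ∀ e : Fin 10, x.2.2.testBit e = false →
    h • sv 0 e = sv 0 e := by
  obtain ⟨h1, h2, h3⟩ := RT_ok x hx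
  refine ⟨⟨rfm x.1 x.2.1, rfm x.1 x.2.1, h1, h1⟩, Units.ext h2, fun e he => ?_⟩
  rw [sv_v (by simp), ou_smul]
  rcases h3 e he with h | h
  · exact congrArg ou h
  · rw [← ou_neg (vec 0 e)]; exact congrArg ou h

/-- certificates of orientation reversal, for sets of edges -/
def kb (n : ℕ) : Bool := RT.any (fun x => n &&& x.2.2 == 0) || SL.any (fun l =>
  allE (fun e => !n.testBit e || n.testBit (pl l e)) &&
    ((cnt (fun e => n.testBit e && pl l e != e) / 2 + l.length) % 2 == 1))

/-- the set of edges of a tuple -/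
def msk {k : ℕ} (a : Fin k → Fin 10) : ℕ := Nat.ofBits (fun e : Fin 10 => decide (∃ i, a i = e))
theorem msk_bit {k : ℕ} (a : Fin k → Fin 10) (e : Fin 10) : (msk a).testBit e = decide (∃ i, a i = e) := by
  rw [msk, Nat.testBit_ofBits_lt _ _ e.2]
theorem msk_lt {k : ℕ} (a : Fin k → Fin 10) : msk a < 1024 := Nat.ofBits_lt_two_pow _
def pc (n : ℕ) : ℕ := cnt (fun e => n.testBit e)
theorem msk_pc {k : ℕ} {a : Fin k → Fin 10} (ha : Function.Injective a) : pc (msk a) = k := by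
  rw [pc, cnt_eq]
  have : Finset.univ.filter (fun e : Fin 10 => (msk a).testBit e = true) = Finset.univ.image a := by
    ext e; simp [msk_bit]
  rw [this, Finset.card_image_of_injective _ ha]; simp

theorem kb_killed {k : ℕ} {a : Fin k → Fin 10} (ha : Function.Injective a) (h : kb (msk a) = true) :
    Killed (sv 0 ∘ a) := by
  rw [kb, Bool.or_eq_true, List.any_eq_true, List.any_eq_true] at h
  rcases h with ⟨x, hx, h⟩ | ⟨l, hl, h⟩
  · obtain ⟨g, hg, hg1⟩ := RT_ok' hx
    refine ⟨g, 1, ?_, by simp [hg]⟩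
    funext i
    change g • sv 0 (a i) = sv 0 (a i)
    apply hg1
    have h0 : msk a &&& x.2.2 = 0 := by simpa using h
    have h1 := congrArg (fun n => Nat.testBit n (a i)) h0
    simpa [Nat.testBit_and, msk_bit] using h1
  · obtain ⟨h1, h2⟩ := SL_ok l hl
    rw [Bool.and_eq_true, allE_iff] at h
    obtain ⟨h3, h4⟩ := h
    have h5 : ∀ i, ∃ j, a j = pl l (a i) := by
      intro i
      have := h3 (a i)
      simpa [msk_bit] using this
    choose f hf using h5
    have hff : ∀ i, f (f i) = i := fun i => ha (by rw [hf, hf, h2])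
    let π : Perm (Fin k) := ⟨f, f, hff, hff⟩
    have hπ2 : π ^ 2 = 1 := by
      ext i; rw [pow_two]; exact congrArg Fin.val (hff i)
    refine ⟨gl l, π, ?_, ?_⟩
    · funext i
      change gl l • sv 0 (a i) = sv 0 (a (f i))
      rw [gl_sv, hf]
    · have h6 : Fintype.card (Fin k) - Fintype.card (Function.fixedPoints π) =
          cnt (fun e => (msk a).testBit e && pl l e != e) := by
        rw [cnt_eq, ← Fintype.card_compl_set, ← Set.toFinset_card,
          ← Finset.card_image_of_injective _ ha]
        congr 1
        ext e
        simp only [Finset.mem_image, Set.mem_toFinset, Set.mem_compl_iff, Function.mem_fixedPoints,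
          Finset.mem_filter, Finset.mem_univ, true_and, msk_bit, Bool.and_eq_true, decide_eq_true_eq, bne_iff_ne]
        constructor
        · rintro ⟨i, hi, rfl⟩
          refine ⟨⟨i, rfl⟩, fun h => hi (ha ?_)⟩
          rw [← h, ← hf]; rfl
        · rintro ⟨⟨i, rfl⟩, h⟩
          refine ⟨i, fun hi => h ?_, rfl⟩
          rw [← hf]; exact congrArg a hi
      rw [Equiv.Perm.sign_of_pow_two_eq_one hπ2, h6, gl_ch h1, ← pow_add, Odd.neg_one_pow]
      rw [Nat.odd_iff, add_comm]
      simpa using h4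

open Equiv
open Pointwise

theorem dec_low : (List.range 1024).all (fun n => !(Nat.ble (pc n) 4 || Nat.beq (pc n) 7 || Nat.beq (pc n) 8) || kb n) = true := by
  decide +kernel

/-- all permutations of the vertices -/
def S5L : List (List (Fin 5 × Fin 5)) :=
  [0, 1, 2, 3, 4].flatMap fun a => [1, 2, 3, 4].flatMap fun b => [2, 3, 4].flatMap fun c =>
    [3, 4].map fun d => [(0, a), (1, b), (2, c), (3, d)]
/-- the pentagon -/
def Ub (e : Fin 10) : Bool := e == 0 || e == 4 || e == 7 || e == 9 || e == 3

theorem dec_five : (List.range 1024).all (fun n => !(Nat.beq (pc n) 6) ||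
    Nat.ble (cnt (fun e => n.testBit e && !kb (n ^^^ (1 <<< e.val)))) 1) = true := by
  decide +kernel

theorem dec_six1 : (List.range 1024).all (fun n => !(Nat.beq (pc n) 6) || kb n ||
    S5L.any (fun l => allE (fun x => !n.testBit x || (pl l x == 1 || Ub (pl l x))))) = true := by
  decide +kernel

theorem dec_six2 : (List.range 1024).all (fun n => !(Nat.beq (pc n) 6) || kb n ||
    allE (fun e => !n.testBit e || kb (n ^^^ (1 <<< e.val)) ||
    S5L.any (fun l => pl l e == 1 && allE (fun x => !n.testBit x || x == e || Ub (pl l x))))) = true := by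
  decide +kernel

open Equiv
open Pointwise

theorem msk_perm {k : ℕ} (a : Fin k → Fin 10) (π : Perm (Fin k)) : msk (a ∘ π) = msk a := by
  unfold msk
  congr 1
  funext e
  congr 1
  apply propext
  constructor
  · rintro ⟨i, hi⟩; exact ⟨π i, hi⟩
  · rintro ⟨i, hi⟩; exact ⟨π.symm i, by simpa using hi⟩

theorem msk_tail {k : ℕ} {a : Fin (k+1) → Fin 10} (ha : Function.Injective a) :
    msk (a ∘ Fin.succ) = msk a ^^^ (1 <<< (a 0).val) := by
  apply Nat.eq_of_testBit_eq
  intro i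
  by_cases hi : i < 10
  · obtain ⟨e, rfl⟩ : ∃ e : Fin 10, e.val = i := ⟨⟨i, hi⟩, rfl⟩
    rw [Nat.testBit_xor, msk_bit, msk_bit, Nat.one_shiftLeft, Nat.testBit_two_pow]
    by_cases h0 : a 0 = e
    · subst h0
      have : ¬ ∃ i, (a ∘ Fin.succ) i = a 0 := by
        rintro ⟨i, hi⟩
        exact Fin.succ_ne_zero _ (ha hi)
      rw [decide_eq_false this]
      have : ∃ i, a i = a 0 := ⟨0, rfl⟩
      simp
    · have h1 : (a 0).val ≠ e.val := fun h => h0 (Fin.ext h)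
      have h2 : (∃ i, a i = e) ↔ ∃ i, (a ∘ Fin.succ) i = e := by
        constructor
        · rintro ⟨i, hi⟩
          have : i ≠ 0 := by rintro rfl; exact h0 hi
          obtain ⟨j, rfl⟩ := Fin.exists_succ_eq.2 this
          exact ⟨j, hi⟩
        · rintro ⟨i, hi⟩; exact ⟨_, hi⟩
      simp [h1, h2]
  · have hl : ∀ n, n < 1024 → n.testBit i = false := fun n hn =>
      Nat.testBit_lt_two_pow (hn.trans_le (by
        have : 2 ^ 10 ≤ 2 ^ i := Nat.pow_le_pow_right (by norm_num) (by omega)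
        omega))
    have h1 : (a 0).val ≠ i := by have := (a 0).2; omega
    rw [Nat.testBit_xor, hl _ (msk_lt _), hl _ (msk_lt _), Nat.one_shiftLeft, Nat.testBit_two_pow]
    simp [h1]

theorem all_range {f : ℕ → Bool} (h : (List.range 1024).all f = true) {n : ℕ} (hn : n < 1024) : f n = true :=
  List.all_eq_true.1 h n (List.mem_range.2 hn)

theorem zero_low {k : ℕ} (hk : k ≤ 4 ∨ k = 7 ∨ k = 8) {φ : (Fin k → X4) → ℂ} (hφ : φ ∈ DD Ce k) (cv : CV φ)
    (hi : IsInv ch φ) : φ = 0 := by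
  funext t
  by_contra hne
  obtain ⟨g, a, ha, hg⟩ := mv8 (by omega) (hφ.2 t hne) (cv t hne) (hφ.1.inj hne)
  apply hne
  have h1 := all_range dec_low (msk_lt a)
  rw [msk_pc ha] at h1
  have h2 : kb (msk a) = true := by
    rcases hk with hk | rfl | rfl
    · have : Nat.ble k 4 = true := Nat.ble_eq_true_of_le hk
      simpa [this] using h1
    · simpa using h1
    · simpa using h1
  have h3 := kb_killed ha h2
  rw [← hg] at h3
  exact (h3.of_smul).zero hφ.1 hi

theorem bd_inv {k : ℕ} {ψ : (Fin (k+1) → X4) → ℂ} (h : IsInv ch ψ) : IsInv ch (bd Ce ψ) := by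
  rw [inv_iff_act] at h ⊢
  intro g
  rw [← bd_act ch cellSys, h]

/-- possible extensions of a tuple -/
def Nset {k : ℕ} (u : Fin k → X4) : Set X4 := {s | ¬ IsC s ∧ s ∉ Set.range u ∧ Ce (insert s (Set.range u))}
noncomputable def Nn {k : ℕ} (u : Fin k → X4) : ℂ := ((Nset u).ncard : ℂ)
theorem Nset_smul {k : ℕ} (g : G4) (u : Fin k → X4) : Nset (g • u) = g • Nset u := by
  ext s
  rw [Set.mem_smul_set_iff_inv_smul_mem]
  simp only [Nset, Set.mem_setOf_eq, IsC.iff, range_smul', Set.mem_smul_set_iff_inv_smul_mem (a := g) (A := Set.range u)]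
  have : insert s (g • Set.range u) = g • insert (g⁻¹ • s) (Set.range u) := by
    rw [Set.smul_set_insert, smul_inv_smul]
  rw [this, cellSys.iff]
theorem Nn_smul {k : ℕ} (g : G4) (u : Fin k → X4) : Nn (g • u) = Nn u := by
  unfold Nn
  rw [Nset_smul, Set.ncard_smul_set]
theorem Nn_perm {k : ℕ} (u : Fin k → X4) (π : Perm (Fin k)) : Nn (u ∘ π) = Nn u := by
  unfold Nn Nset
  rw [EquivLike.range_comp]

theorem sv0_nC (i : Fin 10) : ¬ IsC (sv 0 i) := by
  rintro ⟨g, hg⟩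
  have := (base_C 0 g).2 (by rw [← hg]; exact wprs 0 i)
  exact this.1 rfl

theorem sv0_sub : Set.range (sv 0) ⊆ (S4 V0 : Set X4) := by
  rw [coe_S4]; change _ ⊆ Sset (base 0); rw [Sset_base]

theorem five {φ : (Fin 5 → X4) → ℂ} (hφ : φ ∈ DD Ce 5) (cv : CV φ) (hi : IsInv ch φ) :
    ∃ ψ ∈ DD Ce 6, IsInv ch ψ ∧ bd Ce ψ = φ := by
  classical
  let B : X4 → (Fin 5 → X4) → ℂ := fun x u => if ¬ IsC x ∧ Ce (insert x (Set.range u)) then φ u / Nn u else 0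
  have hBne : ∀ x u, B x u ≠ 0 → (¬ IsC x ∧ Ce (insert x (Set.range u))) ∧ φ u ≠ 0 := by
    intro x u h
    by_cases h1 : ¬ IsC x ∧ Ce (insert x (Set.range u))
    · refine ⟨h1, fun h0 => h ?_⟩
      simp only [B]
      rw [if_pos h1, h0, zero_div]
    · exact absurd (if_neg h1) h
  have hBalt : ∀ x, Alt (B x) := by
    intro x t π
    simp only [B]
    rw [EquivLike.range_comp, Nn_perm, hφ.1]
    split_ifs
    · ring
    · ring
  have hBi : ∀ (g : G4) c w, B (g • c) (g • w) = sg ch g * B c w := by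
    intro g c w
    simp only [B]
    rw [IsC.iff, range_smul', ← Set.smul_set_insert, cellSys.iff, Nn_smul, hi]
    split_ifs
    · ring
    · ring
  have hm : wedge B ∈ DD Ce 6 := by
    refine ⟨wedge_alt _, fun t ht => ?_⟩
    obtain ⟨π, hπ⟩ := wedge_supp ht
    have := (hBne _ _ hπ).1.2
    rwa [Polyh.insert_range_perm] at this
  have hwi := wedge_inv hBi
  have hcv : CV (wedge B) := by
    intro t ht i hc
    obtain ⟨π, hπ⟩ := wedge_supp ht
    obtain ⟨⟨h1, -⟩, h2⟩ := hBne _ _ hπ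
    obtain ⟨j, rfl⟩ := π.surjective i
    rcases Fin.eq_zero_or_eq_succ j with rfl | ⟨j, rfl⟩
    · exact h1 hc
    · exact cv _ h2 j hc
  refine ⟨wedge B, hm, hwi, ?_⟩
  funext u
  by_cases hcell : Ce (Set.range u)
  swap
  · rw [bd_of_not hcell]; by_contra h; exact hcell (hφ.2 u (Ne.symm h))
  by_cases hk : Killed u
  · rw [hk.zero (bd_mem hm).1 (bd_inv hwi), hk.zero hφ.1 hi]
  by_cases hc : ∀ i, ¬ IsC (u i)
  swap
  · push Not at hc
    obtain ⟨i, hc⟩ := hc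
    have : φ u = 0 := by by_contra h; exact cv u h i hc
    rw [this, bd_of_cell hcell]
    apply finsum_eq_zero_of_forall_eq_zero
    intro s
    by_contra h
    exact hcv _ h i.succ (by simpa using hc)
  by_cases hinj : Function.Injective u
  swap
  · have h1 : φ u = 0 := by by_contra h; exact hinj (hφ.1.inj h)
    rw [h1]; by_contra h; exact hinj ((bd_mem hm).1.inj h)
  -- the main case
  have hval : ∀ s ∈ Nset u, wedge B (Fin.cons s u) = φ u / Nn u := by
    rintro s ⟨hs1, hs2, hs3⟩
    have hsi : Function.Injective (Fin.cons s u : Fin 6 → X4) := Fin.cons_injective_iff.2 ⟨hs2, hinj⟩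
    have hsc : ∀ i, ¬ IsC ((Fin.cons s u : Fin 6 → X4) i) := fun i => by
      refine Fin.cases ?_ (fun i => ?_) i
      · exact hs1
      · exact hc i
    obtain ⟨g, a, ha, hg⟩ := mv8 (by norm_num) (by rw [Fin.range_cons]; exact hs3) hsc hsi
    rw [wedge_cons B s u (hBalt s)]
    · simp only [B]; rw [if_pos ⟨hs1, hs3⟩]
    · intro π hπ
      by_contra hne
      obtain ⟨-, hne⟩ := hBne _ _ hne
      apply hne
      have hkb : kb (msk a ^^^ (1 <<< (a (π 0)).val)) = true := by
        by_contra hkb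
        have h0 : ¬ kb (msk a ^^^ (1 <<< (a 0).val)) = true := by
          intro h0
          apply hk
          rw [← msk_tail ha] at h0
          have h1 := kb_killed (ha.comp (Fin.succ_injective _)) h0
          apply Killed.of_smul g
          convert h1 using 1
          have := congrArg (fun f => f ∘ Fin.succ) hg
          rw [smul_cons] at this
          exact this
        have h1 := all_range dec_five (msk_lt a)
        rw [msk_pc ha, cnt_eq] at h1
        have h2 : ({a 0, a (π 0)} : Finset (Fin 10)) ⊆ Finset.univ.filter
            (fun e => ((msk a).testBit e.val && !kb (msk a ^^^ (1 <<< e.val))) = true) := by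
          intro e he
          simp only [Finset.mem_insert, Finset.mem_singleton] at he
          rcases he with rfl | rfl
          · rw [Finset.mem_filter, Bool.eq_false_of_not_eq_true h0, msk_bit]
            simp
          · rw [Finset.mem_filter, Bool.eq_false_of_not_eq_true hkb, msk_bit]
            simp
        have h3 := Finset.card_le_card h2
        rw [Finset.card_pair (fun h => hπ (ha h).symm)] at h3
        have h4 : (Finset.univ.filter
            (fun e : Fin 10 => ((msk a).testBit e.val && !kb (msk a ^^^ (1 <<< e.val))) = true)).card ≤ 1 := by
          apply Nat.le_of_ble_eq_true
          simpa using h1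
        omega
      have e1 : msk a ^^^ (1 <<< (a (π 0)).val) = msk ((a ∘ π) ∘ Fin.succ) := by
        rw [msk_tail (ha.comp π.injective), msk_perm]; rfl
      rw [e1] at hkb
      have h1 := kb_killed ((ha.comp π.injective).comp (Fin.succ_injective _)) hkb
      refine Killed.zero (Killed.of_smul g ?_) hφ.1 hi
      convert h1 using 1
      exact congrArg (fun f => f ∘ π ∘ Fin.succ) hg
  have hz : ∀ s, s ∉ Nset u → wedge B (Fin.cons s u) = 0 := by
    intro s hs
    by_contra h
    apply hs
    refine ⟨hcv _ h 0, (Fin.cons_injective_iff.1 (hm.1.inj h)).1, ?_⟩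
    rw [← Fin.range_cons]; exact hm.2 _ h
  have hfin : (Nset u).Finite := (A4p.good.fin _ hcell).subset fun s hs => hs.2.2
  have hpos : Nn u ≠ 0 := by
    unfold Nn
    obtain ⟨g, a, ha, hg⟩ := mv8 (by norm_num) hcell hc hinj
    have hex : ∃ e, e ∉ Set.range a := by
      by_contra hcon
      push Not at hcon
      have := Fintype.card_le_of_surjective a hcon
      simp at this
    obtain ⟨e, he⟩ := hex
    have hne : (Nset u).Nonempty := by
      refine ⟨g⁻¹ • sv 0 e, ?_⟩
      rw [← Set.mem_smul_set_iff_inv_smul_mem, ← Nset_smul, hg]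
      refine ⟨sv0_nC e, ?_, ?_⟩
      · rintro ⟨i, hi⟩
        exact he ⟨i, sv_inj 0 hi⟩
      · refine A4p.cell_mono (P := V0) (σ := Set.range (sv 0 ∘ a)) ?_ (Set.subset_insert _ _) ?_
        · rw [← hg, range_smul']; exact cellSys.inv g _ hcell
        · refine Set.Subset.trans ?_ sv0_sub
          rintro s (rfl | ⟨i, rfl⟩)
          · exact ⟨e, rfl⟩
          · exact ⟨a i, rfl⟩
    have := (Set.ncard_pos hfin).2 hne
    exact_mod_cast this.ne'
  rw [bd_of_cell hcell, finsum_eq_sum_of_support_subset (s := hfin.toFinset)]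
  · rw [Finset.sum_congr rfl (fun s hs => hval s (hfin.mem_toFinset.1 hs)), Finset.sum_const, nsmul_eq_mul,
      ← Set.ncard_eq_toFinset_card _ hfin]
    change Nn u * _ = _
    field_simp
  · intro s hs
    rw [Set.Finite.coe_toFinset]
    by_contra h
    exact hs (hz s h)

open Equiv
open Pointwise

/-- the vectors of the pentagon -/
def pw : Fin 5 → Fin 4 → ℤ := ![![1,-1,0,0],![0,1,-1,0],![0,0,1,-1],![0,0,0,1],![-1,0,0,0]]
def uix : Fin 5 → Fin 10 := ![0,4,7,9,3]
def us : Fin 5 → X4 := sv 0 ∘ uix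
theorem us_pw : ∀ i, us i = ou (pw i) := by decide +kernel
theorem uix_Ub : ∀ e, Ub e = true → ∃ i, e = uix i := by decide +kernel
theorem uix_inj : Function.Injective uix := by unfold Function.Injective; decide +kernel

def gm (π : Perm (Fin 5)) : M4 := fun r c =>
  (if c.val = 0 then pw (π 0) r else 0) + (if c.val ≤ 1 then pw (π 1) r else 0) +
  (if c.val ≤ 2 then pw (π 2) r else 0) + pw (π 3) r
theorem gm_det : ∀ π : Perm (Fin 5), (gm π).det = (Perm.sign π : ℤ) := by decide +kernel
theorem col_eq (h : M4) (r : Fin 4) : h r 3 = h.mulVec (pw 3) r ∧ h r 2 = h.mulVec (pw 2) r + h.mulVec (pw 3) r ∧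
    h r 1 = h.mulVec (pw 1) r + h.mulVec (pw 2) r + h.mulVec (pw 3) r ∧
    h r 0 = h.mulVec (pw 0) r + h.mulVec (pw 1) r + h.mulVec (pw 2) r + h.mulVec (pw 3) r ∧
    h.mulVec (pw 0) r + h.mulVec (pw 1) r + h.mulVec (pw 2) r + h.mulVec (pw 3) r + h.mulVec (pw 4) r = 0 := by
  simp [Matrix.mulVec, dotProduct, Fin.sum_univ_four, pw]

theorem ou_eq {v w : Fin 4 → ℤ} (h : ou v = ou w) : v = w ∨ v = -w := by
  have h1 : ∀ i j, v i * v j = w i * w j := by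
    intro i j
    have := congrArg (fun s => s.m i j) h
    simp only [ou_m] at this
    nlinarith
  by_cases hv : ∀ i, v i = w i
  · exact Or.inl (funext hv)
  · right
    push Not at hv
    obtain ⟨i, hi⟩ := hv
    have h2 : v i = - w i := by
      rcases mul_self_eq_mul_self_iff.1 (h1 i i) with h | h
      · exact absurd h hi
      · exact h
    funext j
    have h3 := h1 i j
    rw [h2] at h3
    have h4 : w i ≠ 0 := by rintro h0; apply hi; rw [h2, h0]; simp
    have : w i * (v j + w j) = 0 := by linarith
    have := (mul_eq_zero.1 this).resolve_left h4
    simp only [Pi.neg_apply]; linarith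

theorem pent_sign {h : G4} {π : Perm (Fin 5)} (hh : h • us = us ∘ π) : ch h = Perm.sign π := by
  have h1 : ∀ i, ∃ ε : ℤ, (ε = 1 ∨ ε = -1) ∧ h.1.mulVec (pw i) = ε • pw (π i) := by
    intro i
    have := congrFun hh i
    change h • us i = us (π i) at this
    rw [us_pw, us_pw, ou_smul] at this
    rcases ou_eq this with h | h
    · exact ⟨1, Or.inl rfl, by rw [h, one_smul]⟩
    · exact ⟨-1, Or.inr rfl, by rw [h]; simp⟩
  choose ε hε1 hε2 using h1
  have h2 : ∑ i, ε i • pw (π i) = 0 := by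
    funext r
    have := (col_eq h.1 r).2.2.2.2
    simp only [hε2] at this
    rw [Fin.sum_univ_five]
    simpa using this
  have h3 : ∑ j, ε (π.symm j) • pw j = 0 := by
    rw [← h2, ← Equiv.sum_comp π]
    simp
  have h4 : ∀ j, ε (π.symm j) = ε (π.symm 0) := by
    have e0 := congrFun h3 0
    have e1 := congrFun h3 1
    have e2 := congrFun h3 2
    have e3 := congrFun h3 3
    rw [Fin.sum_univ_five] at e0 e1 e2 e3
    simp [pw] at e0 e1 e2 e3
    intro j
    fin_cases j <;> simp <;> linarith
  have h5 : ∀ i, ε i = ε (π.symm 0) := fun i => by simpa using h4 (π i)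
  set δ := ε (π.symm 0)
  have hδ : δ = 1 ∨ δ = -1 := hε1 _
  have h6 : h.1 = δ • gm π := by
    funext r c
    obtain ⟨c3, c2, c1, c0, -⟩ := col_eq h.1 r
    simp only [hε2, h5, Pi.smul_apply, smul_eq_mul] at c3 c2 c1 c0
    rw [Matrix.smul_apply]
    fin_cases c
    · refine c0.trans ?_; simp [gm]; ring
    · refine c1.trans ?_; simp [gm]; ring
    · refine c2.trans ?_; simp [gm]; ring
    · refine c3.trans ?_; simp [gm]
  apply Units.ext
  change h.1.det = _
  rw [h6, Matrix.det_smul, gm_det]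
  rcases hδ with h | h <;> simp [h]

theorem us_cell : Ce (Set.range us) := by
  rw [Ce_def]
  refine ⟨⟨V0, ?_⟩, ?_⟩
  · refine Set.Subset.trans ?_ sv0_sub
    rintro _ ⟨i, rfl⟩
    exact ⟨uix i, rfl⟩
  · refine (box_finite 80).subset fun P hP => ?_
    have h1 : ∀ i, qf P.1 (pw i) = 8 := by
      intro i
      have := (mem_S4.1 (hP ⟨i, rfl⟩)).2
      rw [us_pw, pr_ou] at this
      omega
    have hs : ∀ i j, P.1 i j = P.1 j i := fun i j => congrFun (congrFun (Vx_sym P.2) j) i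
    have a1 := Vx_qf P (v := ![0,0,1,-2]) (by decide)
    have a2 := Vx_qf P (v := ![2,-1,0,0]) (by decide)
    have b0 := h1 0
    have b1 := h1 1
    have b2 := h1 2
    have b3 := h1 3
    have b4 := h1 4
    have s1 := hs 1 0
    have s2 := hs 2 1
    have s3 := hs 3 2
    simp [qf, Fin.sum_univ_four, pw] at a1 a2 b0 b1 b2 b3 b4
    have : tr4 P ≤ 80 := by unfold tr4; linarith
    exact fun i j => (Vx_abs P i j).trans this

theorem us_not_killed : ¬ Killed us := by
  rintro ⟨h, π, h1, h2⟩
  rw [pent_sign h1, Int.units_mul_self] at h2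
  exact absurd h2 (by decide)

theorem perm_of_mem {X : Type*} {k : ℕ} {t u : Fin k → X} (hu : Function.Injective u)
    (h : ∀ i, ∃ j, u i = t j) : ∃ π : Perm (Fin k), u = t ∘ π := by
  choose f hf using h
  have hfi : Function.Injective f := fun i j hij => hu (by rw [hf, hf, hij])
  exact ⟨Equiv.ofBijective f (Finite.injective_iff_bijective.1 hfi), funext hf⟩

theorem six {φ : (Fin 6 → X4) → ℂ} (hφ : φ ∈ DD Ce 6) (cv : CV φ) (hi : IsInv ch φ) (hb : bd Ce φ = 0) : φ = 0 := by
  have hinj : ∀ {k : ℕ} {t : Fin k → X4} (g : G4), Function.Injective t → Function.Injective (g • t) :=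
    fun g ht i j hij => ht (smul_left_cancel g hij)
  have hglo : ∀ {k : ℕ} (l) (a : Fin k → Fin 10), gl l • (sv 0 ∘ a) = sv 0 ∘ (pl l ∘ a) := by
    intro k l a
    funext i
    exact gl_sv l (a i)
  have hkb : ∀ {t} {g : G4} {a}, Function.Injective a → g • t = sv 0 ∘ a → φ t ≠ 0 → kb (msk a) = false := by
    intro t g a ha hg h
    by_contra hk
    have h1 := kb_killed ha (by simpa using hk)
    rw [← hg] at h1
    exact h (h1.of_smul.zero hφ.1 hi)
  set κ := φ (Fin.cons (sv 0 1) us) with hκ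
  have key : ∀ s, φ (Fin.cons s us) ≠ 0 → φ (Fin.cons s us) = κ := by
    intro s hs
    obtain ⟨g, a, ha, hg⟩ := mv8 (by norm_num) (hφ.2 _ hs) (cv _ hs) (hφ.1.inj hs)
    have h1 := all_range dec_six2 (msk_lt a)
    rw [msk_pc ha, hkb ha hg hs] at h1
    have h2 : allE (fun e => !(msk a).testBit e || kb (msk a ^^^ (1 <<< e.val)) ||
      S5L.any (fun l => pl l e == 1 && allE (fun x => !(msk a).testBit x || x == e || Ub (pl l x)))) = true := by
      simpa using h1
    have h3 := allE_iff.1 h2 (a 0)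
    have h4 : kb (msk a ^^^ (1 <<< (a 0).val)) = false := by
      by_contra hk
      have hk' : kb (msk a ^^^ (1 <<< (a 0).val)) = true := by simpa using hk
      rw [← msk_tail ha] at hk'
      have h5 := kb_killed (ha.comp (Fin.succ_injective _)) hk'
      apply us_not_killed
      apply Killed.of_smul g
      convert h5 using 1
      have := congrArg (fun f => f ∘ Fin.succ) hg
      rw [smul_cons] at this
      exact this
    have h5 : (msk a).testBit (a 0).val = true := by rw [msk_bit]; simp
    rw [h4, h5] at h3
    simp only [Bool.not_true, Bool.false_or, List.any_eq_true, Bool.and_eq_true, beq_iff_eq] at h3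
    obtain ⟨l, -, hl1, hl2⟩ := h3
    have hgl : (gl l * g) • (Fin.cons s us : Fin 6 → X4) = sv 0 ∘ (pl l ∘ a) := by
      rw [mul_smul, hg, hglo]
    have hbi : Function.Injective (pl l ∘ a) := by
      have := hinj (gl l * g) (hφ.1.inj hs)
      rw [hgl] at this
      exact Function.Injective.of_comp this
    obtain ⟨π, hπ⟩ := perm_of_mem (t := uix) (u := (pl l ∘ a) ∘ Fin.succ) (hbi.comp (Fin.succ_injective _)) (by
      intro i
      apply uix_Ub
      have h6 := allE_iff.1 hl2 (a i.succ)
      have h7 : (msk a).testBit (a i.succ).val = true := by rw [msk_bit]; simp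
      have h8 : (a i.succ == a 0) = false := by
        rw [beq_eq_false_iff_ne]
        exact fun h => Fin.succ_ne_zero _ (ha h)
      rw [h7, h8] at h6
      simpa using h6)
    have hx : sv 0 ∘ (pl l ∘ a) = Fin.cons (sv 0 1) (us ∘ π) := by
      funext i
      refine Fin.cases ?_ (fun i => ?_) i
      · simp [hl1]
      · exact congrArg (sv 0) (congrFun hπ i)
    have htail : (gl l * g) • us = us ∘ π := by
      have := hgl.trans hx
      rw [smul_cons] at this
      exact (Fin.cons_injective2 this).2
    have h9 := hi (gl l * g) (Fin.cons s us)
    rw [hgl, hx, hφ.1.cons, sg, pent_sign htail] at h9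
    have h10 : ((Perm.sign π : ℤ) : ℂ) ≠ 0 := by
      intro h0
      have := sign_mul_self' π
      rw [h0] at this
      simp at this
    exact (mul_left_cancel₀ h10 h9).symm
  have hκ0 : κ = 0 := by
    by_contra hne
    have hfin : {s | φ (Fin.cons s us) ≠ 0}.Finite := (A4p.good.fin _ us_cell).subset fun s hs => by
      have := hφ.2 _ hs
      rw [Fin.range_cons] at this
      exact this
    have h1 := congrFun hb us
    rw [bd_of_cell us_cell, finsum_eq_sum_of_support_subset (s := hfin.toFinset) _ (by
      intro s hs; rw [Set.Finite.coe_toFinset]; exact hs),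
      Finset.sum_congr rfl (fun s hs => key s (hfin.mem_toFinset.1 hs)), Finset.sum_const, nsmul_eq_mul] at h1
    have h2 := (mul_eq_zero.1 h1).resolve_right hne
    have h3 : hfin.toFinset = ∅ := Finset.card_eq_zero.1 (by exact_mod_cast h2)
    have h4 : sv 0 1 ∈ hfin.toFinset := hfin.mem_toFinset.2 hne
    rw [h3] at h4
    simp at h4
  funext t
  by_contra hne
  obtain ⟨g, a, ha, hg⟩ := mv8 (by norm_num) (hφ.2 t hne) (cv t hne) (hφ.1.inj hne)
  have h1 := all_range dec_six1 (msk_lt a)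
  rw [msk_pc ha, hkb ha hg hne] at h1
  have h2 : S5L.any (fun l => allE (fun x => !(msk a).testBit x || (pl l x == 1 || Ub (pl l x)))) = true := by
    simpa using h1
  rw [List.any_eq_true] at h2
  obtain ⟨l, -, hl⟩ := h2
  have hgl : (gl l * g) • t = sv 0 ∘ (pl l ∘ a) := by
    rw [mul_smul, hg, hglo]
  have hbi : Function.Injective (pl l ∘ a) := by
    have := hinj (gl l * g) (hφ.1.inj hne)
    rw [hgl] at this
    exact Function.Injective.of_comp this
  obtain ⟨π, hπ⟩ := perm_of_mem (t := (Fin.cons 1 uix : Fin 6 → Fin 10)) (u := pl l ∘ a) hbi (by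
    intro i
    have h6 := allE_iff.1 hl (a i)
    have h7 : (msk a).testBit (a i).val = true := by rw [msk_bit]; simp
    rw [h7] at h6
    simp only [Bool.not_true, Bool.false_or, Bool.or_eq_true, beq_iff_eq] at h6
    rcases h6 with h6 | h6
    · exact ⟨0, h6⟩
    · obtain ⟨j, hj⟩ := uix_Ub _ h6
      exact ⟨j.succ, hj⟩)
  have h9 := hi (gl l * g) t
  rw [hgl, hπ, ← Function.comp_assoc, hφ.1, comp_cons'] at h9
  change _ * φ (Fin.cons (sv 0 1) us) = _ at h9
  rw [← hκ, hκ0, mul_zero] at h9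
  exact hne ((mul_eq_zero.1 h9.symm).resolve_left (sg_ne _ _))

open Equiv
open Pointwise

def k9 : M4 := ![![1,1,-1,-1],![0,0,1,-2],![0,1,0,-2],![0,0,0,-1]]
def K9 : G4 := ⟨k9, k9, by decide +kernel, by decide +kernel⟩
def p9 : Perm (Fin 9) := ⟨![4,1,7,3,0,8,6,2,5], ![4,1,7,3,0,8,6,2,5], by unfold Function.LeftInverse; decide +kernel, by unfold Function.RightInverse Function.LeftInverse; decide +kernel⟩
theorem p9_sign : Perm.sign p9 = -1 := by decide +kernel
theorem K9_sv : ∀ i : Fin 9, K9 • sv 1 i.castSucc = sv 1 (p9 i).castSucc := by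
  intro i
  apply X4.ext'
  rw [smul_m]
  change k9 * _ * k9.transpose = _
  revert i
  decide +kernel
theorem K9_ch : ch K9 = 1 := by
  apply Units.ext
  change k9.det = 1
  decide +kernel
theorem nine_killed : Killed (sv 1 ∘ (Fin.castSucc : Fin 9 → Fin 10)) :=
  ⟨K9, p9, funext K9_sv, by rw [K9_ch, p9_sign, one_mul]⟩

theorem dec_tr : ∀ e : Fin 10, ∃ l ∈ S5L, pl l e = 0 := by decide +kernel
theorem pl_inj (l) : Function.Injective (pl l) := by
  intro x y h
  have : gl l • sv 0 x = gl l • sv 0 y := by rw [gl_sv, gl_sv, h]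
  exact sv_inj 0 (smul_left_cancel _ this)

open Classical in
noncomputable def omC (t : Fin 10 → X4) : ℂ := if ∃ i, IsC (t i) then om t else 0
theorem omC_of {t : Fin 10 → X4} (h : ∃ i, IsC (t i)) : omC t = om t := if_pos h
theorem omC_not {t : Fin 10 → X4} (h : ¬ ∃ i, IsC (t i)) : omC t = 0 := if_neg h
theorem omC_mem : omC ∈ DD Ce 10 := by
  refine ⟨fun t π => ?_, fun t ht => ?_⟩
  · have e : (∃ i, IsC ((t ∘ π) i)) ↔ ∃ i, IsC (t i) :=
      ⟨fun ⟨i, hi⟩ => ⟨π i, hi⟩, fun ⟨i, hi⟩ => ⟨π.symm i, by simpa using hi⟩⟩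
    by_cases h : ∃ i, IsC (t i)
    · rw [omC_of h, omC_of (e.2 h), om_mem.1]
    · rw [omC_not h, omC_not (fun h' => h (e.1 h')), mul_zero]
  · by_cases h : ∃ i, IsC (t i)
    · rw [omC_of h] at ht; exact om_mem.2 t ht
    · exact absurd (omC_not h) ht
theorem omC_inv : IsInv ch omC := by
  intro g t
  have e : (∃ i, IsC ((g • t) i)) ↔ ∃ i, IsC (t i) := by
    simp only [Pi.smul_apply, IsC.iff]
  by_cases h : ∃ i, IsC (t i)
  · rw [omC_of h, omC_of (e.2 h), om_inv]
  · rw [omC_not h, omC_not (fun h' => h (e.1 h')), mul_zero]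
theorem omC_cv : CV (bd Ce omC) := by
  intro u hu i hc
  apply hu
  have hcell := (bd_mem omC_mem).2 u hu
  have := congrFun om_coc u
  rw [bd_of_cell hcell] at this ⊢
  refine Eq.trans ?_ this
  congr 1
  funext s
  exact omC_of ⟨i.succ, hc⟩

def u9 : Fin 9 → X4 := sv 0 ∘ Fin.succ
theorem cons_u9 : (Fin.cons (sv 0 0) u9 : Fin 10 → X4) = sv 0 := by
  funext i; refine Fin.cases rfl (fun i => rfl) i
theorem En_sv0 : En V0 (sv 0) := En_of_sub (sv_inj 0) sv0_sub
theorem omC_u9 : bd Ce omC u9 ≠ 0 := by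
  have h0 : En V0 (Fin.cons (sv 0 0) u9) := by rw [cons_u9]; exact En_sv0
  obtain ⟨N, s1, he⟩ := exists_edge h0
  rw [he.bd omC_mem, cons_u9, omC_not (by rintro ⟨i, hi⟩; exact sv0_nC i hi), zero_add]
  have hs0 : sv 0 0 ∈ S4 V0 := En_sv0.K 0
  let N' : V4 := ⟨fa (wG 0 0) (base 2), ⟨_, _, rfl⟩⟩
  have hN' : N' = nb4 V0 (sv 0 0) := by
    have hb := base_nb 0 0
    rcases edge_eq (Q := N') hs0 (by
      intro s' hs' hne
      rw [← Finset.mem_coe, ← En_sv0.2] at hs'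
      obtain ⟨j, rfl⟩ := hs'
      exact mem_S4.2 ⟨sv_K 0 j, hb.2 j (fun h => hne (by rw [h]))⟩) with h | h
    · have h1 := hb.1
      have h2 : pr (sv 0 0) N'.1 = 136 := by rw [h]; exact (mem_S4.1 hs0).2
      exact absurd h2 h1.ne'
    · exact h
  have hN : N = nb4 V0 (sv 0 0) := by
    rcases edge_eq (Q := N) hs0 (by
      intro s' hs' hne
      rw [← Finset.mem_coe, ← h0.2, Fin.range_cons] at hs'
      rcases hs' with rfl | ⟨j, rfl⟩
      · exact absurd rfl hne
      · exact (he.mem j).2) with h | h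
    · have h1 := he.a
      have h2 : pr (sv 0 0) N.1 = 136 := by rw [h]; exact (mem_S4.1 hs0).2
      exact absurd h2 h1.ne'
    · exact h
  have hc : IsC (wG 0 0 • c0) := ⟨_, rfl⟩
  have hm : wG 0 0 • c0 ∈ (S4 N : Set X4) := by
    rw [hN, ← hN', coe_S4]
    change _ ∈ Sset (fa _ _)
    rw [Sset_fa, Set.smul_mem_smul_set_iff, Sset_base]
    exact ⟨9, sv_c (by decide)⟩
  rw [← he.e1.2, Fin.range_cons] at hm
  rcases hm with h | ⟨j, h⟩
  · rw [omC_of ⟨0, by rw [Fin.cons_zero, ← h]; exact hc⟩]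
    exact om_ne_of_En he.e1
  · rw [← h] at hc
    exact absurd hc (sv0_nC _)

theorem nine {φ : (Fin 9 → X4) → ℂ} (hφ : φ ∈ DD Ce 9) (cv : CV φ) (hi : IsInv ch φ) :
    ∃ ψ ∈ DD Ce 10, IsInv ch ψ ∧ bd Ce ψ = φ := by
  set c := φ u9 / bd Ce omC u9 with hc
  refine ⟨c • omC, (DD Ce 10).smul_mem c omC_mem, ?_, ?_⟩
  · intro g t
    simp only [Pi.smul_apply, smul_eq_mul, omC_inv g t]; ring
  rw [bd_smul]
  set β := bd Ce omC with hβ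
  have hβm : β ∈ DD Ce 9 := bd_mem omC_mem
  have hβi : IsInv ch β := bd_inv omC_inv
  set θ := c • β - φ with hθ
  have hθm : θ ∈ DD Ce 9 := (DD Ce 9).sub_mem ((DD Ce 9).smul_mem c hβm) hφ
  have hθi : IsInv ch θ := by
    intro g t
    simp only [hθ, Pi.sub_apply, Pi.smul_apply, smul_eq_mul, hβi g t, hi g t]; ring
  have hθc : CV θ := by
    intro t ht i hci
    apply ht
    have h1 : β t = 0 := by by_contra h; exact omC_cv t h i hci
    have h2 : φ t = 0 := by by_contra h; exact cv t h i hci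
    simp [hθ, h1, h2]
  have hθ0 : θ u9 = 0 := by
    have : β u9 ≠ 0 := omC_u9
    simp only [hθ, Pi.sub_apply, Pi.smul_apply, smul_eq_mul, hc]
    field_simp
    ring
  rw [← sub_eq_zero]
  change θ = 0
  funext t
  by_contra hne
  have hinj : ∀ g : G4, Function.Injective (g • t) := fun g i j hij => hθm.1.inj hne (smul_left_cancel g hij)
  rcases mv (hθm.2 t hne) (hθc t hne) with ⟨g, hg⟩ | ⟨g, hg⟩
  · obtain ⟨a, ha, hga⟩ := lift_sv hg (hinj g)
    have hex : ∃ e, e ∉ Set.range a := by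
      by_contra hcon
      push Not at hcon
      have := Fintype.card_le_of_surjective a hcon
      simp at this
    obtain ⟨e, he⟩ := hex
    obtain ⟨l, -, hl⟩ := dec_tr e
    obtain ⟨π, hπ⟩ := perm_of_mem (t := (Fin.succ : Fin 9 → Fin 10)) (u := pl l ∘ a) ((pl_inj l).comp ha) (by
      intro i
      have : pl l (a i) ≠ 0 := by
        rw [← hl]
        intro h
        exact he ⟨i, pl_inj l h⟩
      obtain ⟨j, hj⟩ := Fin.exists_succ_eq.2 this
      exact ⟨j, hj.symm⟩)
    have h9 := hθi (gl l * g) t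
    have hx : (gl l * g) • t = u9 ∘ π := by
      rw [mul_smul, hga]
      funext i
      refine (gl_sv l (a i)).trans ?_
      exact congrArg (sv 0) (congrFun hπ i)
    rw [hx, hθm.1, hθ0, mul_zero] at h9
    exact hne ((mul_eq_zero.1 h9.symm).resolve_left (sg_ne _ _))
  · obtain ⟨π, hπ⟩ := perm_of_mem (t := g • t) (u := sv 1 ∘ (Fin.castSucc : Fin 9 → Fin 10))
      ((sv_inj 1).comp (Fin.castSucc_injective _)) (by
      intro i
      obtain ⟨j, hj⟩ := hg i.castSucc (Fin.castSucc_lt_last i).ne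
      exact ⟨j, hj.symm⟩)
    have h1 := nine_killed.zero hθm.1 hθi
    rw [hπ, hθm.1, hθi] at h1
    have h10 : ((Perm.sign π : ℤ) : ℂ) ≠ 0 := by
      intro h0
      have := sign_mul_self' π
      rw [h0] at this
      simp at this
    exact hne ((mul_eq_zero.1 ((mul_eq_zero.1 h1).resolve_left h10)).resolve_left (sg_ne _ _))

open Equiv
open Pointwise

theorem isInv_zero {k : ℕ} : IsInv ch (0 : (Fin k → X4) → ℂ) := fun g t => by simp
theorem ex_zero {k : ℕ} {φ : (Fin k → X4) → ℂ} (h : φ = 0) : ∃ ψ ∈ DD Ce (k+1), IsInv ch ψ ∧ bd Ce ψ = φ :=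
  ⟨0, Submodule.zero_mem _, isInv_zero, by rw [h, bd_zero]⟩

theorem hin4 : ∀ k < 10, ∀ φ ∈ DD Ce k, Polyh.Coc Ce k φ → IsInv ch φ →
      ∃ ψ ∈ DD Ce (k+1), IsInv ch ψ ∧ bd Ce ψ = φ := by
  intro k hk φ hφ hco hi
  cases k with
  | zero => exact ex_zero (zero_low (by omega) hφ (fun t _ i => i.elim0) hi)
  | succ k =>
    have hb : bd Ce φ = 0 := hco
    obtain ⟨η, hη, hηi, hcv⟩ := kill_c (by omega) hφ hb hi
    have hβ := bd_mem hη
    have hβi := bd_inv hηi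
    have hm : φ - bd Ce η ∈ DD Ce (k+1) := Submodule.sub_mem _ hφ hβ
    have hi' : IsInv ch (φ - bd Ce η) := by
      intro g t
      simp only [Pi.sub_apply, hβi g t, hi g t]; ring
    have hb' : bd Ce (φ - bd Ce η) = 0 := by
      rw [bd_sub A4p.good hφ hβ, hb, bd_bd A4p.good hη, sub_zero]
    have key : ∃ ψ ∈ DD Ce (k+2), IsInv ch ψ ∧ bd Ce ψ = φ - bd Ce η := by
      generalize φ - bd Ce η = θ at hm hi' hb' hcv
      by_cases h5 : k = 4
      · subst h5; exact five hm hcv hi'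
      by_cases h6 : k = 5
      · subst h6; exact ex_zero (six hm hcv hi' hb')
      by_cases h9 : k = 8
      · subst h9; exact nine hm hcv hi'
      exact ex_zero (zero_low (by omega) hm hcv hi')
    obtain ⟨ψ, hψ, hψi, hψb⟩ := key
    refine ⟨η + ψ, Submodule.add_mem _ hη hψ, ?_, ?_⟩
    · intro g t
      simp only [Pi.add_apply, hηi g t, hψi g t]; ring
    · rw [bd_add A4p.good hη hψ, hψb]; simp

theorem acyc4 : Acyc (Rep.trivial ℂ G4 ℂ) :=
  acyc_trivial ch cellSys 10 (fun _ hk _ hφ hco => A4p.exact card_S4 hk hφ hco) hin4 om om_mem om_coc om_inv om_ne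
    (fun _ hφ hc => om_top hφ hc)

open Matrix

/-- `H⁰(GL 4 ℤ, ℂ) ≅ ℂ` and `Hⁱ(GL 4 ℤ, ℂ) = 0` for all `i ≥ 1`. -/
theorem stmt16 :
    Nonempty ((groupCohomology (Rep.trivial ℂ (GL (Fin 4) ℤ) ℂ) 0) ≃ₗ[ℂ] ℂ)
    ∧ ∀ i : ℕ, 1 ≤ i →
        Subsingleton (groupCohomology (Rep.trivial ℂ (GL (Fin 4) ℤ) ℂ) i) := by
  refine ⟨⟨(groupCohomology.H0IsoOfIsTrivial (Rep.trivial ℂ (GL (Fin 4) ℤ) ℂ)).toLinearEquiv⟩, ?_⟩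
  intro i hi
  obtain ⟨n, rfl⟩ := Nat.exists_eq_add_of_le' hi
  exact ModuleCat.subsingleton_of_isZero (acyc4 n)
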